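/- Let A ∈ H^∞(θ_A) have bounded H^∞-calculus of angle θ_A and B ∈ RH^∞(θ_B) have R-bounded H^∞-calculus of angle θ_B in a Banach space X₀, with θ_A + θ_B > π. Assume (B+μ)⁻¹ D(A) ⊆ D(A) for some μ ∈ S_{θ_B}, and that the commutator estimate ‖[A,(B+μ)⁻¹](A+λ)⁻¹‖ ≤ C / ((1+|λ|^{1−α})(1+|μ|^{1+β})) holds for all λ ∈ S_{θ_A}, μ ∈ S_{θ_B}, with constants α, C ≥ 0 and β > 0 satisfying α + β < 1. Then for each θ ∈ [0, θ_A + θ_B − π) there exists c > 0 such that AB + c, with domain {u ∈ D(B) : Bu ∈ D(A)}, has bounded H^∞-calculus of angle θ. -/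

import Mathlib

open MeasureTheory Set
open scoped Real Topology

noncomputable section

universe u

variable {X : Type u} [NormedAddCommGroup X] [NormedSpace ℂ X]

/-- The closed sector of half-angle `θ` around the positive real axis (contains `0`). -/
def Sector (θ : ℝ) : Set ℂ := {z : ℂ | |z.arg| ≤ θ}

/-- `R` is the resolvent `(A + lam)⁻¹` of the (unbounded) operator `A`. -/
def IsResolventAt (A : X →ₗ.[ℂ] X) (lam : ℂ) (R : X →L[ℂ] X) : Prop :=
  (∀ x : X, ∃ h : R x ∈ A.domain, A ⟨R x, h⟩ + lam • R x = x) ∧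
  (∀ u : A.domain, R (A u + lam • (u : X)) = (u : X))

/-- `R`-boundedness of a family of bounded operators with `R`-bound `C`, formulated
(equivalently to the usual Rademacher-function formulation, after squaring the
`L²(0,1;X)`-norms) through averages over all choices of signs. -/
def RBound (C : ℝ) (T : Set (X →L[ℂ] X)) : Prop :=
  ∀ (N : ℕ) (Ts : Fin N → X →L[ℂ] X) (x : Fin N → X), (∀ i, Ts i ∈ T) →
    ∑ s : Fin N → Bool, ‖∑ i, (if s i then (1:ℂ) else -1) • Ts i (x i)‖ ^ 2
      ≤ C ^ 2 * ∑ s : Fin N → Bool, ‖∑ i, (if s i then (1:ℂ) else -1) • x i‖ ^ 2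

/-- `f` belongs to the class `H₀^∞(φ)`: it is holomorphic on `ℂ\S_φ` and decays like
`(|λ|/(1+|λ|²))^η` there. -/
def MemH0 (φ : ℝ) (f : ℂ → ℂ) : Prop :=
  DifferentiableOn ℂ f {z : ℂ | z ∉ Sector φ} ∧
  ∃ c η : ℝ, 0 < c ∧ 0 < η ∧
    ∀ z ∉ Sector φ, ‖f z‖ ≤ c * (‖z‖ / (1 + ‖z‖ ^ 2)) ^ η

variable [CompleteSpace X]

/-- The Dunford integral `f(-A) = (2πi)⁻¹ ∫_{Γ_t} f(λ)(A+λ)⁻¹ dλ` over the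
counterclockwise oriented boundary `Γ_t` of the sector of angle `t`, expressed
through the resolvent family `R` of `A` and parametrized by the two rays
`re^{±it}`, `r ≥ 0`. -/
def fCalc (R : ℂ → X →L[ℂ] X) (t : ℝ) (f : ℂ → ℂ) : X →L[ℂ] X :=
  ((2 * (Real.pi : ℂ) * Complex.I)⁻¹) •
    ∫ r in Ioi (0 : ℝ),
      ((f ((r : ℂ) * Complex.exp ((t : ℂ) * Complex.I)) *
          Complex.exp ((t : ℂ) * Complex.I)) •
        R ((r : ℂ) * Complex.exp ((t : ℂ) * Complex.I)) -
       (f ((r : ℂ) * Complex.exp (-(t : ℂ) * Complex.I)) *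
          Complex.exp (-(t : ℂ) * Complex.I)) •
        R ((r : ℂ) * Complex.exp (-(t : ℂ) * Complex.I)))

/-- The family `R` (the resolvent family of an invertible sectorial operator of
angle `t`) has bounded `H^∞`-calculus of angle `φ < t`. -/
def HasBddHCalc (R : ℂ → X →L[ℂ] X) (t φ : ℝ) : Prop :=
  ∃ C : ℝ, 0 < C ∧ ∀ f : ℂ → ℂ, MemH0 φ f →
    ∀ M : ℝ, (∀ z ∉ Sector φ, ‖f z‖ ≤ M) → ‖fCalc R t f‖ ≤ C * M

/-- The sign `±1` attached to the upper (`true`) and lower (`false`) ray of a sector boundary. -/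
def raySign (b : Bool) : ℝ := if b then 1 else -1

/-- Logarithmic parametrization `s ↦ e^{s ± it}` of the two boundary rays of a sector. -/
def ctrPt (t : ℝ) (p : Bool × ℝ) : ℂ :=
  Complex.exp ((p.2 : ℂ) + ((raySign p.1 * t : ℝ) : ℂ) * Complex.I)

/-- The weight `dz / (2πi)` along the boundary of a sector. -/
def ctrWt (t : ℝ) (p : Bool × ℝ) : ℂ :=
  (raySign p.1 : ℂ) * ctrPt t p / (2 * (π : ℂ) * Complex.I)

/-- The parameter measure on the two boundary rays. -/
def ctrMeas : Measure (Bool × ℝ) := (Measure.count : Measure Bool).prod volume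

/-- The pair of punctured rays of argument `±t`. -/
def rays (t : ℝ) : Set ℂ := {z | z ≠ 0 ∧ |z.arg| = t}

/-- The open sector without its vertex. -/
def osec (t : ℝ) : Set ℂ := {z | z ≠ 0 ∧ |z.arg| < t}

/-- The closed sector without its vertex. -/
def csec (t : ℝ) : Set ℂ := {z | z ≠ 0 ∧ |z.arg| ≤ t}

/-- The weight `min (x ^ ν) (x ^ (-ν))`. -/
def mdec (ν x : ℝ) : ℝ := Real.exp (-ν * |Real.log x|)

/-- The total mass of `mdec ν` along a sector boundary. -/
def mdecMass (ν : ℝ) : ℝ := ∫ p : Bool × ℝ, Real.exp (-ν * |p.2|) ∂ctrMeas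

instance : SFinite ctrMeas := by unfold ctrMeas; infer_instance

section Contour

variable {E : Type*} [NormedAddCommGroup E] [NormedSpace ℂ E]

/-- The normalized contour integral along the boundary of the sector of angle `t`. -/
def cint (t : ℝ) (g : ℂ → E) : E := ∫ p, ctrWt t p • g (ctrPt t p) ∂ctrMeas

/-- Integrability along the boundary of the sector of angle `t`. -/
def CtrIntegrable (t : ℝ) (g : ℂ → E) : Prop :=
  Integrable (fun p => ctrWt t p • g (ctrPt t p)) ctrMeas

theorem abs_raySign (b : Bool) : |raySign b| = 1 := by cases b <;> simp [raySign]

theorem norm_ctrPt (t : ℝ) (p : Bool × ℝ) : ‖ctrPt t p‖ = Real.exp p.2 := by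
  simp [ctrPt, Complex.norm_exp]

theorem ctrPt_ne_zero (t : ℝ) (p : Bool × ℝ) : ctrPt t p ≠ 0 := Complex.exp_ne_zero _

theorem arg_exp_of_mem {ξ : ℂ} (h1 : -π < ξ.im) (h2 : ξ.im ≤ π) : (Complex.exp ξ).arg = ξ.im := by
  rw [← Complex.log_im, Complex.log_exp h1 h2]

theorem abs_arg_ctrPt {t : ℝ} (h0 : 0 ≤ t) (h1 : t < π) (p : Bool × ℝ) :
    |(ctrPt t p).arg| = t := by
  have h2 : -π < raySign p.1 * t ∧ raySign p.1 * t ≤ π := by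
    cases p.1 <;> simp [raySign] <;> constructor <;> linarith
  rw [ctrPt, arg_exp_of_mem (by simpa using h2.1) (by simpa using h2.2)]
  simp [abs_mul, abs_raySign, abs_of_nonneg h0]

theorem ctrPt_mem_rays {t : ℝ} (h0 : 0 ≤ t) (h1 : t < π) (p : Bool × ℝ) : ctrPt t p ∈ rays t :=
  ⟨ctrPt_ne_zero t p, abs_arg_ctrPt h0 h1 p⟩

theorem continuous_ctrPt (t : ℝ) : Continuous (ctrPt t) := by
  rw [continuous_prod_of_discrete_left]
  intro b
  unfold ctrPt
  fun_prop

theorem continuous_ctrWt (t : ℝ) : Continuous (ctrWt t) := by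
  have h := continuous_ctrPt t
  rw [continuous_prod_of_discrete_left] at h ⊢
  intro b
  unfold ctrWt
  have := h b
  fun_prop

theorem norm_ctrWt_le (t : ℝ) (p : Bool × ℝ) : ‖ctrWt t p‖ ≤ ‖ctrPt t p‖ := by
  have h : (1 : ℝ) ≤ 2 * π := by linarith [Real.pi_gt_three]
  rw [ctrWt, norm_div, norm_mul, Complex.norm_real, Real.norm_eq_abs, abs_raySign, one_mul]
  have h2 : ‖(2 * (π : ℂ) * Complex.I)‖ = 2 * π := by
    simp [abs_of_pos Real.pi_pos]
  rw [h2]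
  exact div_le_self (norm_nonneg _) h

theorem mdec_nonneg (ν x : ℝ) : 0 ≤ mdec ν x := (Real.exp_pos _).le

theorem mdec_pos (ν x : ℝ) : 0 < mdec ν x := Real.exp_pos _

theorem mdec_exp (ν s : ℝ) : mdec ν (Real.exp s) = Real.exp (-ν * |s|) := by
  rw [mdec, Real.log_exp]

theorem integrable_exp_abs {ν : ℝ} (hν : 0 < ν) :
    Integrable (fun s : ℝ => Real.exp (-ν * |s|)) := by
  rw [← integrableOn_univ, ← Iic_union_Ioi (a := (0 : ℝ)), integrableOn_union]
  constructor
  · refine (integrableOn_exp_mul_Iic hν 0).congr_fun (fun x hx => ?_) measurableSet_Iic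
    simp only [mem_Iic] at hx
    simp [abs_of_nonpos hx]
  · refine (integrableOn_exp_mul_Ioi (neg_lt_zero.2 hν) 0).congr_fun (fun x hx => ?_)
      measurableSet_Ioi
    simp only [mem_Ioi] at hx
    simp [abs_of_pos hx]

theorem integrable_ctr_exp {ν : ℝ} (hν : 0 < ν) :
    Integrable (fun p : Bool × ℝ => Real.exp (-ν * |p.2|)) ctrMeas := by
  have h : Integrable (fun _ : Bool => (1 : ℝ)) Measure.count := integrable_const 1
  have := h.mul_prod (integrable_exp_abs hν)
  simpa [ctrMeas] using this

theorem mdecMass_nonneg (ν : ℝ) : 0 ≤ mdecMass ν :=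
  integral_nonneg fun _ => (Real.exp_pos _).le

theorem ctrIntegrable_of_bound {t ν C : ℝ} (h0 : 0 ≤ t) (h1 : t < π) (hν : 0 < ν) {g : ℂ → E}
    (hc : ContinuousOn g (rays t)) (hb : ∀ z ∈ rays t, ‖z‖ * ‖g z‖ ≤ C * mdec ν ‖z‖) :
    CtrIntegrable t g := by
  refine ((integrable_ctr_exp hν).const_mul C).mono' ?_ (ae_of_all _ fun p => ?_)
  · exact ((continuous_ctrWt t).smul
      (hc.comp_continuous (continuous_ctrPt t) (ctrPt_mem_rays h0 h1))).aestronglyMeasurable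
  · have := hb _ (ctrPt_mem_rays h0 h1 p)
    rw [norm_ctrPt, mdec_exp] at this
    rw [norm_smul]
    refine le_trans ?_ this
    gcongr
    exact (norm_ctrWt_le t p).trans_eq (norm_ctrPt t p)

theorem norm_cint_le {t ν C : ℝ} (h0 : 0 ≤ t) (h1 : t < π) (hν : 0 < ν) {g : ℂ → E}
    (hb : ∀ z ∈ rays t, ‖z‖ * ‖g z‖ ≤ C * mdec ν ‖z‖) :
    ‖cint t g‖ ≤ C * mdecMass ν := by
  rw [mdecMass, ← integral_const_mul]
  refine norm_integral_le_of_norm_le ((integrable_ctr_exp hν).const_mul C) (ae_of_all _ fun p => ?_)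
  have := hb _ (ctrPt_mem_rays h0 h1 p)
  rw [norm_ctrPt, mdec_exp] at this
  rw [norm_smul]
  refine le_trans ?_ this
  gcongr
  exact (norm_ctrWt_le t p).trans_eq (norm_ctrPt t p)

theorem cint_congr {t : ℝ} (h0 : 0 ≤ t) (h1 : t < π) {f g : ℂ → E}
    (h : ∀ z ∈ rays t, f z = g z) : cint t f = cint t g := by
  unfold cint
  congr 1
  ext p
  rw [h _ (ctrPt_mem_rays h0 h1 p)]

theorem CtrIntegrable.congr {t : ℝ} (h0 : 0 ≤ t) (h1 : t < π) {f g : ℂ → E}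
    (hf : CtrIntegrable t f) (h : ∀ z ∈ rays t, f z = g z) : CtrIntegrable t g := by
  unfold CtrIntegrable at hf ⊢
  refine hf.congr (ae_of_all _ fun p => ?_)
  simp only [h _ (ctrPt_mem_rays h0 h1 p)]

theorem CtrIntegrable.add {t : ℝ} {f g : ℂ → E} (hf : CtrIntegrable t f) (hg : CtrIntegrable t g) :
    CtrIntegrable t fun z => f z + g z := by
  unfold CtrIntegrable at *
  simp only [smul_add]
  exact Integrable.add hf hg

theorem CtrIntegrable.sub {t : ℝ} {f g : ℂ → E} (hf : CtrIntegrable t f) (hg : CtrIntegrable t g) :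
    CtrIntegrable t fun z => f z - g z := by
  unfold CtrIntegrable at *
  simp only [smul_sub]
  exact Integrable.sub hf hg

theorem cint_add {t : ℝ} {f g : ℂ → E} (hf : CtrIntegrable t f) (hg : CtrIntegrable t g) :
    cint t (fun z => f z + g z) = cint t f + cint t g := by
  unfold cint
  simp only [smul_add]
  exact integral_add hf hg

theorem cint_sub {t : ℝ} {f g : ℂ → E} (hf : CtrIntegrable t f) (hg : CtrIntegrable t g) :
    cint t (fun z => f z - g z) = cint t f - cint t g := by
  unfold cint
  simp only [smul_sub]
  exact integral_sub hf hg

theorem cint_smul (t : ℝ) (c : ℂ) (g : ℂ → E) : cint t (fun z => c • g z) = c • cint t g := by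
  unfold cint
  rw [← integral_smul]
  simp only [smul_comm c]

theorem CtrIntegrable.smul {t : ℝ} (c : ℂ) {g : ℂ → E} (hg : CtrIntegrable t g) :
    CtrIntegrable t fun z => c • g z := by
  unfold CtrIntegrable at *
  simp only [smul_comm _ c]
  exact Integrable.smul c hg

theorem cint_clm {F : Type*} [NormedAddCommGroup F] [NormedSpace ℂ F] [CompleteSpace E]
    [CompleteSpace F] {t : ℝ} {g : ℂ → E} (L : E →L[ℂ] F) (hg : CtrIntegrable t g) :
    cint t (fun z => L (g z)) = L (cint t g) := by
  unfold cint
  rw [← L.integral_comp_comm hg]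
  simp only [map_smul]

theorem CtrIntegrable.clm {F : Type*} [NormedAddCommGroup F] [NormedSpace ℂ F]
    {t : ℝ} {g : ℂ → E} (L : E →L[ℂ] F) (hg : CtrIntegrable t g) :
    CtrIntegrable t (fun z => L (g z)) := by
  unfold CtrIntegrable at *
  simpa only [map_smul] using L.integrable_comp hg

theorem integrable_ctr_prod {t u ν C : ℝ} (ht0 : 0 ≤ t) (ht1 : t < π) (hu0 : 0 ≤ u) (hu1 : u < π)
    (hν : 0 < ν) {g : ℂ → ℂ → E} (hc : ContinuousOn (Function.uncurry g) (rays t ×ˢ rays u))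
    (hb : ∀ z ∈ rays t, ∀ w ∈ rays u,
      ‖z‖ * ‖w‖ * ‖g z w‖ ≤ C * (mdec ν ‖z‖ * mdec ν ‖w‖)) :
    Integrable (Function.uncurry fun p q => ctrWt t p • ctrWt u q • g (ctrPt t p) (ctrPt u q))
      (ctrMeas.prod ctrMeas) := by
  refine (((integrable_ctr_exp hν).mul_prod (integrable_ctr_exp hν)).const_mul C).mono' ?_
    (ae_of_all _ fun p => ?_)
  · have h1 : Continuous fun p : (Bool × ℝ) × (Bool × ℝ) => g (ctrPt t p.1) (ctrPt u p.2) :=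
      hc.comp_continuous (f := fun p : (Bool × ℝ) × (Bool × ℝ) => (ctrPt t p.1, ctrPt u p.2))
        (((continuous_ctrPt t).comp continuous_fst).prodMk
          ((continuous_ctrPt u).comp continuous_snd))
        (fun p => ⟨ctrPt_mem_rays ht0 ht1 p.1, ctrPt_mem_rays hu0 hu1 p.2⟩)
    exact (((continuous_ctrWt t).comp continuous_fst).smul
      (((continuous_ctrWt u).comp continuous_snd).smul h1)).aestronglyMeasurable
  · have := hb _ (ctrPt_mem_rays ht0 ht1 p.1) _ (ctrPt_mem_rays hu0 hu1 p.2)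
    simp only [norm_ctrPt, mdec_exp] at this
    simp only [Function.uncurry, norm_smul]
    refine le_trans ?_ this
    rw [← mul_assoc]
    gcongr
    · exact (norm_ctrWt_le t _).trans_eq (norm_ctrPt t _)
    · exact (norm_ctrWt_le u _).trans_eq (norm_ctrPt u _)

theorem cint_swap {t u ν C : ℝ} (ht0 : 0 ≤ t) (ht1 : t < π) (hu0 : 0 ≤ u) (hu1 : u < π)
    (hν : 0 < ν) {g : ℂ → ℂ → E} (hc : ContinuousOn (Function.uncurry g) (rays t ×ˢ rays u))
    (hb : ∀ z ∈ rays t, ∀ w ∈ rays u,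
      ‖z‖ * ‖w‖ * ‖g z w‖ ≤ C * (mdec ν ‖z‖ * mdec ν ‖w‖)) :
    cint t (fun z => cint u (g z)) = cint u (fun w => cint t fun z => g z w) := by
  unfold cint
  simp only [← integral_smul]
  rw [integral_integral_swap (integrable_ctr_prod ht0 ht1 hu0 hu1 hν hc hb)]
  simp only [smul_comm (ctrWt u _)]

theorem ctrIntegrable_cint {t u ν C : ℝ} (ht0 : 0 ≤ t) (ht1 : t < π) (hu0 : 0 ≤ u) (hu1 : u < π)
    (hν : 0 < ν) {g : ℂ → ℂ → E} (hc : ContinuousOn (Function.uncurry g) (rays t ×ˢ rays u))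
    (hb : ∀ z ∈ rays t, ∀ w ∈ rays u,
      ‖z‖ * ‖w‖ * ‖g z w‖ ≤ C * (mdec ν ‖z‖ * mdec ν ‖w‖)) :
    CtrIntegrable t (fun z => cint u (g z)) := by
  unfold CtrIntegrable cint
  simp only [← integral_smul]
  exact (integrable_ctr_prod ht0 ht1 hu0 hu1 hν hc hb).integral_prod_left

end Contour

section Cauchy

variable {E : Type*} [NormedAddCommGroup E] [NormedSpace ℂ E]

theorem CtrIntegrable.ray {t : ℝ} {g : ℂ → E} (hg : CtrIntegrable t g) (b : Bool) :
    Integrable fun s : ℝ => ctrWt t (b, s) • g (ctrPt t (b, s)) := by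
  have h := (integrable_prod_iff hg.aestronglyMeasurable).1 hg
  have h1 := h.1
  rw [Measure.ae_count_iff] at h1
  exact h1 b

variable [CompleteSpace E]

theorem cint_eq_rays {t : ℝ} {g : ℂ → E} (hg : CtrIntegrable t g) :
    cint t g = (∫ s : ℝ, ctrWt t (true, s) • g (ctrPt t (true, s))) +
      ∫ s : ℝ, ctrWt t (false, s) • g (ctrPt t (false, s)) := by
  unfold cint ctrMeas
  rw [integral_prod _ hg, integral_count]
  simp

theorem ctrPt_true (t s : ℝ) : ctrPt t (true, s) = Complex.exp (s + t * Complex.I) := by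
  simp [ctrPt, raySign]

theorem ctrPt_false (t s : ℝ) : ctrPt t (false, s) = Complex.exp (s + (-t) * Complex.I) := by
  simp [ctrPt, raySign]

theorem ctrWt_true (t s : ℝ) :
    ctrWt t (true, s) = (2 * (π : ℂ) * Complex.I)⁻¹ * ctrPt t (true, s) := by
  simp only [ctrWt, raySign, if_true]; push_cast; ring

theorem ctrWt_false (t s : ℝ) :
    ctrWt t (false, s) = -(2 * (π : ℂ) * Complex.I)⁻¹ * ctrPt t (false, s) := by
  simp only [ctrWt, raySign, Bool.false_eq_true, if_false]; push_cast; ring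

theorem two_pi_I_inv_ne_zero : (2 * (π : ℂ) * Complex.I)⁻¹ ≠ 0 := by
  simp [Real.pi_ne_zero]

/-- Cauchy's theorem for a function decaying along a sector. -/
theorem cint_eq_zero {t ν C : ℝ} (h0 : 0 ≤ t) (h1 : t < π) (hν : 0 < ν) {h : ℂ → E}
    (hc : ContinuousOn h (csec t)) (hd : DifferentiableOn ℂ h (osec t))
    (hi : CtrIntegrable t h) {S0 : ℝ}
    (hb : ∀ z ∈ csec t, S0 ≤ |Real.log ‖z‖| → ‖z‖ * ‖h z‖ ≤ C * mdec ν ‖z‖) :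
    cint t h = 0 := by
  set G : ℂ → E := fun ξ => Complex.exp ξ • h (Complex.exp ξ) with hG
  have harg : ∀ ξ : ℂ, |ξ.im| ≤ t → (Complex.exp ξ).arg = ξ.im := fun ξ hξ =>
    arg_exp_of_mem (by linarith [neg_le_of_abs_le hξ]) (by linarith [le_of_abs_le hξ])
  have hGc : ContinuousOn G {ξ | |ξ.im| ≤ t} :=
    Complex.continuous_exp.continuousOn.smul (hc.comp Complex.continuous_exp.continuousOn
      fun ξ hξ => ⟨Complex.exp_ne_zero _, by rw [harg ξ hξ]; exact hξ⟩)
  have hGd : DifferentiableOn ℂ G {ξ | |ξ.im| < t} :=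
    Complex.differentiable_exp.differentiableOn.smul
      (hd.comp Complex.differentiable_exp.differentiableOn
        fun ξ (hξ : |ξ.im| < t) => ⟨Complex.exp_ne_zero _, by rw [harg ξ hξ.le]; exact hξ⟩)
  have hGb : ∀ ξ : ℂ, |ξ.im| ≤ t → S0 ≤ |ξ.re| → ‖G ξ‖ ≤ C * Real.exp (-ν * |ξ.re|) := by
    intro ξ hξ hξ2
    have := hb (Complex.exp ξ) ⟨Complex.exp_ne_zero _, by rw [harg ξ hξ]; exact hξ⟩
    simp only [Complex.norm_exp, mdec_exp, Real.log_exp] at this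
    rw [hG]
    simp only [norm_smul, Complex.norm_exp]
    exact this hξ2
  have hT : ∀ σ : Bool, Integrable fun s : ℝ => ctrPt t (σ, s) • h (ctrPt t (σ, s)) := by
    intro σ
    have h2 := hi.ray σ
    cases σ
    · simp only [ctrWt_false, mul_smul] at h2
      exact (integrable_fun_smul_iff (neg_ne_zero.2 two_pi_I_inv_ne_zero) _).1 h2
    · simp only [ctrWt_true, mul_smul] at h2
      exact (integrable_fun_smul_iff two_pi_I_inv_ne_zero _).1 h2
  rw [cint_eq_rays hi]
  simp only [ctrWt_true, ctrWt_false, mul_smul, integral_smul]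
  rw [neg_smul, ← sub_eq_add_neg, ← smul_sub]
  refine smul_eq_zero_of_right _ ?_
  have ht := hT true
  have hf := hT false
  have lim1 := (intervalIntegral_tendsto_integral (hT true) Filter.tendsto_neg_atTop_atBot
    Filter.tendsto_id).sub (intervalIntegral_tendsto_integral (hT false)
      Filter.tendsto_neg_atTop_atBot Filter.tendsto_id)
  refine tendsto_nhds_unique lim1 ?_
  have key : ∀ S : ℝ, (∫ s in (-S)..S, ctrPt t (true, s) • h (ctrPt t (true, s))) -
      (∫ s in (-S)..S, ctrPt t (false, s) • h (ctrPt t (false, s))) =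
      Complex.I • (∫ y in (-t)..t, G (S + y * Complex.I)) -
      Complex.I • (∫ y in (-t)..t, G (-S + y * Complex.I)) := by
    intro S
    have hsub : uIcc (-S) S ×ℂ uIcc (-t) t ⊆ {ξ : ℂ | |ξ.im| ≤ t} := by
      intro ξ hξ
      rw [Complex.mem_reProdIm, uIcc_of_le (by linarith : -t ≤ t)] at hξ
      exact abs_le.2 hξ.2
    have := Complex.integral_boundary_rect_eq_zero_of_continuousOn_of_differentiableOn G
      ⟨-S, -t⟩ ⟨S, t⟩ (hGc.mono hsub) (hGd.mono (by
        intro ξ hξ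
        rw [Complex.mem_reProdIm] at hξ
        simp only [min_eq_left (by linarith : -t ≤ t), max_eq_right (by linarith : -t ≤ t)] at hξ
        exact abs_lt.2 hξ.2))
    simp only [Complex.ofReal_neg] at this
    simp only [ctrPt_true, ctrPt_false]
    simp only [hG] at this ⊢
    rw [← sub_eq_zero, ← neg_eq_zero, ← this]
    abel
  simp only [id, key]
  have small : ∀ σ : ℝ, |σ| = 1 → Filter.Tendsto (fun S : ℝ => Complex.I •
      (∫ y in (-t)..t, G (((σ * S : ℝ) : ℂ) + y * Complex.I))) Filter.atTop (𝓝 0) := by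
    intro σ hσ
    have hz : Filter.Tendsto (fun S : ℝ => (C * Real.exp (-ν * S)) * |t - (-t)|)
        Filter.atTop (𝓝 0) := by
      have : Filter.Tendsto (fun S : ℝ => -ν * S) Filter.atTop Filter.atBot :=
        Filter.tendsto_id.const_mul_atTop_of_neg (neg_lt_zero.2 hν)
      have := (Real.tendsto_exp_atBot.comp this).const_mul C |>.mul_const |t - (-t)|
      simpa using this
    refine squeeze_zero_norm' ?_ hz
    filter_upwards [Filter.eventually_ge_atTop S0, Filter.eventually_ge_atTop 0] with S hS hS1
    rw [norm_smul, Complex.norm_I, one_mul]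
    refine intervalIntegral.norm_integral_le_of_norm_le_const fun y hy => ?_
    rw [uIoc_of_le (by linarith : -t ≤ t)] at hy
    have h3 : |σ * S| = S := by rw [abs_mul, hσ, one_mul, abs_of_nonneg hS1]
    have := hGb (((σ * S : ℝ) : ℂ) + y * Complex.I) (by
      simpa using abs_le.2 ⟨hy.1.le, hy.2⟩) (by simp [h3] at *; simpa [h3] using hS)
    refine this.trans_eq ?_
    simp [h3] at *
  have s1 := small 1 (by simp)
  have s2 := small (-1) (by simp)
  simpa using s1.sub s2

/-- Reflection of a sector boundary at the origin. -/
theorem cint_reflect {t : ℝ} {g : ℂ → E} : cint t g = cint (π - t) fun v => g (-v) := by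
  have hpt : ∀ b s, ctrPt (π - t) (!b, s) = - ctrPt t (b, s) := by
    intro b s
    cases b
    · simp only [Bool.not_false, ctrPt_true, ctrPt_false]
      rw [← Complex.exp_add_pi_mul_I]
      congr 1; push_cast; ring
    · simp only [Bool.not_true, ctrPt_true, ctrPt_false]
      rw [← Complex.exp_sub_pi_mul_I]
      congr 1; push_cast; ring
  have hwt : ∀ b s, ctrWt (π - t) (!b, s) = ctrWt t (b, s) := by
    intro b s
    rw [ctrWt, hpt, ctrWt]
    cases b <;> simp [raySign]
  have hmp : MeasurePreserving (fun p : Bool × ℝ => (!p.1, p.2)) ctrMeas ctrMeas := by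
    have : MeasurePreserving (fun b : Bool => !b) Measure.count Measure.count := by
      refine ⟨measurable_of_finite _, Measure.ext fun s hs => ?_⟩
      rw [Measure.map_apply (measurable_of_finite _) hs, Measure.count_apply hs,
        Measure.count_apply (measurable_of_finite _ hs),
        Set.encard_preimage_of_bijective Bool.involutive_not.bijective]
    exact this.prod (MeasurePreserving.id _)
  unfold cint
  have he : MeasurableEmbedding (fun p : Bool × ℝ => (!p.1, p.2)) := by
    exact MeasurableEquiv.measurableEmbedding ((⟨Equiv.boolNot, measurable_of_finite _,
      measurable_of_finite _⟩ : Bool ≃ᵐ Bool).prodCongr (MeasurableEquiv.refl ℝ))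
  rw [← hmp.integral_comp he fun p => ctrWt (π - t) p • g (- ctrPt (π - t) p)]
  simp only [hpt, hwt, neg_neg]

end Cauchy

section Geometry

theorem re_mul_conj_eq (u v : ℂ) :
    (u * (starRingEnd ℂ) v).re = ‖u‖ * ‖v‖ * Real.cos (u.arg - v.arg) := by
  rw [Real.cos_sub]
  have h1 := Complex.norm_mul_cos_arg u
  have h2 := Complex.norm_mul_cos_arg v
  have h3 := Complex.norm_mul_sin_arg u
  have h4 := Complex.norm_mul_sin_arg v
  simp only [Complex.mul_re, Complex.conj_re, Complex.conj_im]
  rw [← h1, ← h2, ← h3, ← h4]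
  ring

theorem norm_sub_ge {u v : ℂ} {t δ : ℝ} (hδ : 0 < δ) (hu : |u.arg| ≤ t) (hv : t + δ ≤ |v.arg|) :
    Real.sin (δ / 2) * (‖u‖ + ‖v‖) ≤ ‖u - v‖ := by
  have hvπ := Complex.abs_arg_le_pi v
  have ht : 0 ≤ t := (abs_nonneg _).trans hu
  have hcos : Real.cos (u.arg - v.arg) ≤ Real.cos δ := by
    rw [← Real.cos_abs (u.arg - v.arg)]
    have h1 : δ ≤ |u.arg - v.arg| := by
      have := abs_sub_abs_le_abs_sub v.arg u.arg
      rw [abs_sub_comm] at this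
      linarith
    have h2 : |u.arg - v.arg| ≤ 2 * π - δ := by
      have := abs_sub u.arg v.arg
      linarith
    rcases le_total |u.arg - v.arg| π with h | h
    · exact Real.cos_le_cos_of_nonneg_of_le_pi hδ.le h h1
    · rw [← Real.cos_two_pi_sub |u.arg - v.arg|]
      exact Real.cos_le_cos_of_nonneg_of_le_pi hδ.le (by linarith) (by linarith)
  have hs : Real.sin (δ / 2) ^ 2 = (1 - Real.cos δ) / 2 := by
    rw [Real.sin_sq_eq_half_sub]; ring_nf
  refine le_of_sq_le_sq ?_ (norm_nonneg _)
  have h3 : ‖u - v‖ ^ 2 = ‖u‖ ^ 2 + ‖v‖ ^ 2 - 2 * (u * (starRingEnd ℂ) v).re := by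
    rw [← Complex.normSq_eq_norm_sq, Complex.normSq_sub, Complex.normSq_eq_norm_sq,
      Complex.normSq_eq_norm_sq]
  rw [mul_pow, hs, h3, re_mul_conj_eq]
  have h4 : ‖u‖ * ‖v‖ * Real.cos (u.arg - v.arg) ≤ ‖u‖ * ‖v‖ * Real.cos δ := by gcongr
  nlinarith [mul_nonneg (sq_nonneg (‖u‖ - ‖v‖)) (by linarith [Real.neg_one_le_cos δ] :
    0 ≤ 1 + Real.cos δ)]

theorem abs_arg_neg {v : ℂ} (hv : v ≠ 0) : |(-v).arg| = π - |v.arg| := by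
  rcases lt_trichotomy v.im 0 with h | h | h
  · rw [Complex.arg_neg_eq_arg_add_pi_of_im_neg h, abs_of_neg (Complex.arg_neg_iff.2 h),
      abs_of_nonneg (by linarith [Complex.neg_pi_lt_arg v])]
    ring
  · have him : v = (v.re : ℂ) := Complex.ext rfl (by simpa using h)
    rcases lt_trichotomy v.re 0 with h2 | h2 | h2
    · rw [him, Complex.arg_ofReal_of_neg h2, ← Complex.ofReal_neg,
        Complex.arg_ofReal_of_nonneg (by linarith), abs_of_pos Real.pi_pos]
      simp
    · exact absurd (Complex.ext h2 h) hv
    · rw [him, Complex.arg_ofReal_of_nonneg h2.le, ← Complex.ofReal_neg,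
        Complex.arg_ofReal_of_neg (by linarith), abs_of_pos Real.pi_pos]
      simp
  · rw [Complex.arg_neg_eq_arg_sub_pi_of_im_pos h, abs_of_nonneg (Complex.arg_nonneg_iff.2 h.le),
      abs_of_nonpos (by linarith [Complex.arg_le_pi v])]
    ring

theorem norm_add_ge {u v : ℂ} {δ : ℝ} (hδ : 0 < δ) (hv0 : v ≠ 0)
    (h : |u.arg| + |v.arg| + δ ≤ π) :
    Real.sin (δ / 2) * (‖u‖ + ‖v‖) ≤ ‖u + v‖ := by
  have := norm_sub_ge (u := u) (v := -v) hδ le_rfl (by rw [abs_arg_neg hv0]; linarith)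
  simpa using this

theorem abs_arg_mul_le {u v : ℂ} (hu : u ≠ 0) (hv : v ≠ 0) :
    |(u * v).arg| ≤ |u.arg| + |v.arg| := by
  by_cases h : u.arg + v.arg ∈ Ioc (-π) π
  · rw [(Complex.arg_mul_eq_add_arg_iff hu hv).2 h]
    exact abs_add_le _ _
  · refine (Complex.abs_arg_le_pi _).trans ?_
    by_contra! h2
    have := (abs_lt.1 ((abs_add_le u.arg v.arg).trans_lt h2))
    exact h ⟨this.1, this.2.le⟩

theorem sin_half_pos {δ : ℝ} (hδ : 0 < δ) (h : δ ≤ π) : 0 < Real.sin (δ / 2) :=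
  Real.sin_pos_of_pos_of_lt_pi (by linarith) (by linarith)

theorem abs_arg_inv (z : ℂ) : |z⁻¹.arg| = |z.arg| := by
  rw [Complex.arg_inv]
  split_ifs with h
  · rw [h]
  · rw [abs_neg]

theorem isOpen_osec {t : ℝ} (ht : t ≤ π) : IsOpen (osec t) := by
  have h : osec t = Complex.slitPlane ∩ Complex.arg ⁻¹' {x | |x| < t} := by
    ext z
    simp only [osec, mem_ofPred_eq, mem_inter_iff, mem_preimage, Complex.mem_slitPlane_iff_arg]
    constructor
    · rintro ⟨h0, h1⟩
      exact ⟨⟨fun h => by rw [h, abs_of_pos Real.pi_pos] at h1; linarith, h0⟩, h1⟩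
    · rintro ⟨⟨_, h0⟩, h1⟩
      exact ⟨h0, h1⟩
  rw [h]
  refine ContinuousOn.isOpen_inter_preimage
    (fun z hz => (Complex.continuousAt_arg hz).continuousWithinAt) Complex.isOpen_slitPlane ?_
  exact isOpen_lt continuous_abs continuous_const

theorem osec_subset_csec (t : ℝ) : osec t ⊆ csec t := fun _ h => ⟨h.1, h.2.le⟩

theorem rays_subset_csec (t : ℝ) : rays t ⊆ csec t := fun _ h => ⟨h.1, h.2.le⟩

theorem csec_mem_nhds {t : ℝ} (ht : t ≤ π) {z : ℂ} (hz : z ∈ osec t) : csec t ∈ 𝓝 z :=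
  Filter.mem_of_superset ((isOpen_osec ht).mem_nhds hz) (osec_subset_csec t)

end Geometry

section Decay

theorem mdec_of_one_le {ν x : ℝ} (hx : 1 ≤ x) : mdec ν x = x ^ (-ν) := by
  rw [mdec, abs_of_nonneg (Real.log_nonneg hx), Real.rpow_def_of_pos (by linarith), mul_comm]

theorem mdec_of_le_one {ν x : ℝ} (h0 : 0 < x) (hx : x ≤ 1) : mdec ν x = x ^ ν := by
  rw [mdec, abs_of_nonpos (Real.log_nonpos h0.le hx), Real.rpow_def_of_pos h0]
  ring_nf

theorem mdec_anti {ν ν' x : ℝ} (h : ν ≤ ν') : mdec ν' x ≤ mdec ν x := by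
  unfold mdec
  have := mul_le_mul_of_nonneg_right h (abs_nonneg (Real.log x))
  exact Real.exp_le_exp.2 (by linarith)

theorem mdec_le_one {ν x : ℝ} (h : 0 ≤ ν) : mdec ν x ≤ 1 := by
  unfold mdec
  refine Real.exp_le_one_iff.2 ?_
  have := mul_nonneg h (abs_nonneg (Real.log x))
  linarith

theorem mdec_mul_le {ν x y : ℝ} (hν : 0 ≤ ν) (hx : 0 < x) (hy : 0 < y) :
    mdec ν (x / y) * mdec ν y ≤ mdec ν x := by
  unfold mdec
  rw [← Real.exp_add, Real.log_div hx.ne' hy.ne']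
  refine Real.exp_le_exp.2 ?_
  have := abs_add_le (Real.log x - Real.log y) (Real.log y)
  rw [sub_add_cancel] at this
  nlinarith

theorem mdec_mul_le_half {ν x y : ℝ} (hν : 0 ≤ ν) (hx : 0 < x) (hy : 0 < y) :
    mdec ν (x / y) * mdec ν y ≤ mdec (ν / 2) x * mdec (ν / 2) y := by
  have hν2 : 0 ≤ ν / 2 := by linarith
  have h1 := mdec_mul_le hν2 hx hy
  have h2 : ∀ z, mdec ν z = mdec (ν / 2) z * mdec (ν / 2) z := fun z => by
    unfold mdec; rw [← Real.exp_add]; ring_nf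
  rw [h2 (x / y), h2 y]
  have h3 : mdec (ν / 2) (x / y) * mdec (ν / 2) y ≤ mdec (ν / 2) y :=
    mul_le_of_le_one_left (mdec_nonneg _ _) (mdec_le_one hν2)
  calc _ = (mdec (ν / 2) (x / y) * mdec (ν / 2) y) * (mdec (ν / 2) (x / y) * mdec (ν / 2) y) := by
        ring
    _ ≤ _ := mul_le_mul h1 h3 (mul_nonneg (mdec_nonneg _ _) (mdec_nonneg _ _)) (mdec_nonneg _ _)

/-- Decay of a Cauchy kernel against a power weight. -/
theorem rpow_div_add_le {κ x y : ℝ} (h0 : 0 < κ) (h1 : κ < 1) (hx : 0 < x) (hy : 0 < y) :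
    x ^ (1 - κ) / (x + y) ≤ (1 + 1 / y) * mdec (min κ (1 - κ)) x := by
  rcases le_total x 1 with h | h
  · rw [mdec_of_le_one hx h]
    have h2 : x ^ (1 - κ) ≤ x ^ (min κ (1 - κ)) :=
      Real.rpow_le_rpow_of_exponent_ge hx h (min_le_right _ _)
    calc x ^ (1 - κ) / (x + y) ≤ x ^ (min κ (1 - κ)) / y := by gcongr; linarith
      _ = (1 / y) * x ^ (min κ (1 - κ)) := by ring
      _ ≤ _ := by gcongr; linarith
  · rw [mdec_of_one_le h]
    have h2 : x ^ (-κ) ≤ x ^ (-(min κ (1 - κ))) :=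
      Real.rpow_le_rpow_of_exponent_le h (neg_le_neg (min_le_left _ _))
    calc x ^ (1 - κ) / (x + y) ≤ x ^ (1 - κ) / x := by gcongr; linarith
      _ = x ^ (-κ) := by
        rw [div_eq_iff hx.ne', ← Real.rpow_add_one hx.ne']; congr 1; ring
      _ ≤ 1 * x ^ (-(min κ (1 - κ))) := by rw [one_mul]; exact h2
      _ ≤ _ := by gcongr; linarith [one_div_pos.2 hy]

end Decay

section CauchyFormula

variable {E : Type*} [NormedAddCommGroup E] [NormedSpace ℂ E]

theorem ne_of_mem_rays {t : ℝ} {w z : ℂ} (hw : w ∈ rays t) (hz : |z.arg| ≠ t) : w - z ≠ 0 := by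
  intro h
  rw [sub_eq_zero] at h
  exact hz (h ▸ hw.2)

/-- Lower bound of `|w - z|` on the rays of argument `±t` for `z` away from them. -/
theorem exists_norm_sub_ge_rays (t : ℝ) (z : ℂ) (hz : |z.arg| ≠ t) :
    ∃ κ : ℝ, 0 < κ ∧ ∀ w ∈ rays t, κ * (‖w‖ + ‖z‖) ≤ ‖w - z‖ := by
  have hzπ := Complex.abs_arg_le_pi z
  rcases lt_or_gt_of_ne hz with h | h
  · by_cases htπ : t ≤ π
    · refine ⟨Real.sin ((t - |z.arg|) / 2), sin_half_pos (by linarith)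
        (by linarith [abs_nonneg z.arg]), fun w hw => ?_⟩
      rw [norm_sub_rev, add_comm]
      exact norm_sub_ge (by linarith) le_rfl (by rw [hw.2]; linarith)
    · exact ⟨1, one_pos, fun w hw => absurd (hw.2 ▸ Complex.abs_arg_le_pi w) htπ⟩
  · by_cases ht : 0 ≤ t
    · refine ⟨Real.sin ((|z.arg| - t) / 2), sin_half_pos (by linarith)
        (by linarith), fun w hw => ?_⟩
      exact norm_sub_ge (by linarith) hw.2.le (by linarith)
    · exact ⟨1, one_pos, fun w hw => absurd (hw.2 ▸ abs_nonneg w.arg) ht⟩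

theorem norm_pole_le {κ κ0 C : ℝ} (hκ0 : 0 < κ0) (h0 : 0 < κ) (h1 : κ < 1) {z w : ℂ} {x : E}
    (hz : z ≠ 0) (hw : w ≠ 0) (hb : ‖x‖ ≤ C * ‖w‖ ^ (-κ))
    (hwz : κ0 * (‖w‖ + ‖z‖) ≤ ‖w - z‖) :
    ‖w‖ * ‖(w - z)⁻¹ • x‖ ≤
      C / κ0 * (1 + 1 / ‖z‖) * mdec (min κ (1 - κ)) ‖w‖ := by
  have hw' := norm_pos_iff.2 hw
  have hz' := norm_pos_iff.2 hz
  have hC : 0 ≤ C := by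
    have := (norm_nonneg x).trans hb
    exact nonneg_of_mul_nonneg_left this (by positivity)
  rw [norm_smul, norm_inv]
  calc ‖w‖ * (‖w - z‖⁻¹ * ‖x‖) ≤ ‖w‖ * ((κ0 * (‖w‖ + ‖z‖))⁻¹ * (C * ‖w‖ ^ (-κ))) := by gcongr
    _ = C / κ0 * (‖w‖ ^ (-κ) * ‖w‖ / (‖w‖ + ‖z‖)) := by field_simp
    _ = C / κ0 * (‖w‖ ^ (1 - κ) / (‖w‖ + ‖z‖)) := by
      rw [← Real.rpow_add_one hw'.ne']; ring_nf
    _ ≤ C / κ0 * ((1 + 1 / ‖z‖) * mdec (min κ (1 - κ)) ‖w‖) := by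
      gcongr; exact rpow_div_add_le h0 h1 hw' hz'
    _ = _ := by ring

theorem ctrIntegrable_pole {t κ C : ℝ} (ht0 : 0 ≤ t) (ht1 : t < π) (h0 : 0 < κ) (h1 : κ < 1)
    {g : ℂ → E} (hc : ContinuousOn g (rays t)) (hb : ∀ w ∈ rays t, ‖g w‖ ≤ C * ‖w‖ ^ (-κ))
    {z : ℂ} (hz : z ≠ 0) (hzt : |z.arg| ≠ t) :
    CtrIntegrable t fun w => (w - z)⁻¹ • g w := by
  obtain ⟨κ0, hκ0, hκ⟩ := exists_norm_sub_ge_rays t z hzt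
  refine ctrIntegrable_of_bound (ν := min κ (1 - κ)) ht0 ht1 (lt_min h0 (by linarith)) ?_
    fun w hw => norm_pole_le hκ0 h0 h1 hz hw.1 (hb w hw) (hκ w hw)
  refine ContinuousOn.smul (ContinuousOn.inv₀ (by fun_prop) ?_) hc
  exact fun w hw => ne_of_mem_rays hw hzt

variable [CompleteSpace E]

/-- Cauchy's formula for a sector, exterior point. -/
theorem cauchy_right_ext {t κ C : ℝ} (ht0 : 0 ≤ t) (ht1 : t < π) (h0 : 0 < κ) (h1 : κ < 1)
    {g : ℂ → E} (hc : ContinuousOn g (csec t)) (hd : DifferentiableOn ℂ g (osec t))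
    (hb : ∀ w ∈ csec t, ‖g w‖ ≤ C * ‖w‖ ^ (-κ)) {z : ℂ} (hz : z ≠ 0) (hzt : t < |z.arg|) :
    cint t (fun w => (w - z)⁻¹ • g w) = 0 := by
  have hne : ∀ w ∈ csec t, w - z ≠ 0 := by
    intro w hw h
    rw [sub_eq_zero] at h
    exact absurd (h ▸ hw.2) (not_le.2 hzt)
  refine cint_eq_zero (ν := min κ (1 - κ)) (S0 := 0) ht0 ht1 (lt_min h0 (by linarith))
    ?_ ?_ (ctrIntegrable_pole ht0 ht1 h0 h1 (hc.mono (rays_subset_csec t))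
      (fun w hw => hb w (rays_subset_csec t hw)) hz hzt.ne')
    fun w hw _ => norm_pole_le (sin_half_pos (δ := |z.arg| - t) (by linarith)
      (by linarith [Complex.abs_arg_le_pi z])) h0 h1 hz hw.1 (hb w hw)
      (norm_sub_ge (by linarith) hw.2 (by linarith))
  · exact ContinuousOn.smul (ContinuousOn.inv₀ (by fun_prop) hne) hc
  · exact DifferentiableOn.smul (DifferentiableOn.inv (by fun_prop)
      fun w hw => hne w (osec_subset_csec t hw)) hd

theorem norm_inv_add_one_le {κ κ0 : ℝ} (hκ0 : 0 < κ0) (h0 : 0 ≤ κ) (h1 : κ ≤ 1) {w : ℂ}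
    (hw : w ≠ 0) (h : κ0 * (‖w‖ + 1) ≤ ‖w + 1‖) : ‖(w + 1)⁻¹‖ ≤ κ0⁻¹ * ‖w‖ ^ (-κ) := by
  have hw' := norm_pos_iff.2 hw
  rw [norm_inv]
  calc ‖w + 1‖⁻¹ ≤ (κ0 * (‖w‖ + 1))⁻¹ := by gcongr
    _ = κ0⁻¹ * (‖w‖ + 1)⁻¹ := by rw [mul_inv]
    _ ≤ κ0⁻¹ * ‖w‖ ^ (-κ) := by
      gcongr
      rw [Real.rpow_neg hw'.le]
      gcongr
      rcases le_total ‖w‖ 1 with h | h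
      · exact (Real.rpow_le_one hw'.le h h0).trans (by linarith)
      · calc ‖w‖ ^ κ ≤ ‖w‖ ^ (1 : ℝ) := Real.rpow_le_rpow_of_exponent_le h h1
          _ ≤ _ := by rw [Real.rpow_one]; linarith

theorem exists_add_one_ge {t : ℝ} (ht0 : 0 ≤ t) (ht1 : t < π) :
    ∃ κ0 : ℝ, 0 < κ0 ∧ ∀ w ∈ csec t, κ0 * (‖w‖ + 1) ≤ ‖w + 1‖ := by
  refine ⟨Real.sin ((π - t) / 2), sin_half_pos (by linarith) (by linarith), fun w hw => ?_⟩
  have := norm_add_ge (u := w) (v := 1) (δ := π - t) (by linarith) one_ne_zero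
    (by rw [Complex.arg_one, abs_zero]; linarith [hw.2])
  rwa [norm_one] at this

/-- The integral over the upper ray of the Cauchy kernel with poles at `±1`. -/
theorem integral_ray_kernel_one {t : ℝ} (ht0 : 0 < t) (ht1 : t < π)
    (hi : Integrable fun s : ℝ => ctrPt t (true, s) * ((ctrPt t (true, s) - 1)⁻¹ *
      ((ctrPt t (true, s) + 1)⁻¹ * 2))) :
    ∫ s : ℝ, ctrPt t (true, s) * ((ctrPt t (true, s) - 1)⁻¹ * ((ctrPt t (true, s) + 1)⁻¹ * 2)) =
      -(π * Complex.I) := by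
  set w : ℝ → ℂ := fun s => ctrPt t (true, s) with hw
  have him : ∀ s, 0 < (w s).im := by
    intro s
    simp only [hw, ctrPt_true, Complex.exp_im]
    have := Real.sin_pos_of_pos_of_lt_pi ht0 ht1
    simp; positivity
  have hp : ∀ s, w s + 1 ≠ 0 := fun s h => by
    have := congrArg Complex.im h
    simp at this; linarith [him s]
  have hm : ∀ s, w s - 1 ≠ 0 := fun s h => by
    have := congrArg Complex.im h
    simp at this; linarith [him s]
  have hwd : ∀ s, HasDerivAt w (w s) s := by
    intro s
    simp only [hw, ctrPt_true]
    have h1 : HasDerivAt (fun s : ℝ => (s : ℂ) + t * Complex.I) 1 s :=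
      (Complex.ofRealCLM.hasDerivAt).add_const _
    simpa using h1.cexp
  have hdiv : ∀ s, (w s - 1) / (w s + 1) = (((w s).re ^ 2 + (w s).im ^ 2 - 1 : ℝ) +
      (2 * (w s).im : ℝ) * Complex.I) / (Complex.normSq (w s + 1) : ℝ) := by
    intro s
    have hn : (Complex.normSq (w s + 1) : ℂ) ≠ 0 := by
      exact_mod_cast (Complex.normSq_pos.2 (hp s)).ne'
    rw [div_eq_div_iff (hp s) hn, ← Complex.mul_conj]
    have e : (w s - 1) * (starRingEnd ℂ) (w s + 1) = (((w s).re ^ 2 + (w s).im ^ 2 - 1 : ℝ) +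
      (2 * (w s).im : ℝ) * Complex.I) := by
      apply Complex.ext <;> simp [pow_two] <;> ring
    rw [← e]; ring
  have hWim : ∀ s, 0 < ((w s - 1) / (w s + 1)).im := by
    intro s
    rw [hdiv, Complex.div_ofReal_im]
    refine div_pos ?_ (Complex.normSq_pos.2 (hp s))
    have := him s
    rw [Complex.add_im, Complex.ofReal_im, Complex.im_ofReal_mul, Complex.I_im]
    linarith
  have hW : ∀ s, HasDerivAt (fun s => Complex.log ((w s - 1) / (w s + 1)))
      (w s * ((w s - 1)⁻¹ * ((w s + 1)⁻¹ * 2))) s := by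
    intro s
    have h1 := (((hwd s).sub_const 1).div ((hwd s).add_const 1) (hp s)).clog_real
      (Complex.mem_slitPlane_iff.2 (Or.inr (hWim s).ne'))
    refine h1.congr_deriv ?_
    have := hp s
    have := hm s
    simp only [Pi.div_apply]
    field_simp
    ring
  have hnorm : ∀ s, ‖w s‖ = Real.exp s := fun s => norm_ctrPt t _
  have hw0 : Filter.Tendsto w Filter.atBot (𝓝 0) := by
    rw [tendsto_zero_iff_norm_tendsto_zero]
    simp only [hnorm]
    exact Real.tendsto_exp_atBot
  have hwi : Filter.Tendsto (fun s => (w s)⁻¹) Filter.atTop (𝓝 0) := by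
    rw [tendsto_zero_iff_norm_tendsto_zero]
    simp only [norm_inv, hnorm]
    exact Real.tendsto_exp_atTop.inv_tendsto_atTop
  have hbot : Filter.Tendsto (fun s => Complex.log ((w s - 1) / (w s + 1))) Filter.atBot
      (𝓝 (π * Complex.I)) := by
    have h1 : Filter.Tendsto (fun s => (w s - 1) / (w s + 1)) Filter.atBot (𝓝 (-1)) := by
      have := (hw0.sub_const 1).div (hw0.add_const 1) (by norm_num)
      have e : ((0 : ℂ) - 1) / (0 + 1) = -1 := by norm_num
      rw [e] at this
      exact this
    have h2 := Complex.tendsto_log_nhdsWithin_im_nonneg_of_re_neg_of_im_zero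
      (z := -1) (by norm_num) (by norm_num)
    have h3 := h2.comp (tendsto_nhdsWithin_iff.2 ⟨h1, Filter.Eventually.of_forall
      fun s => (hWim s).le⟩)
    have e : ((Real.log ‖(-1 : ℂ)‖ : ℝ) : ℂ) + π * Complex.I = π * Complex.I := by
      rw [norm_neg, norm_one, Real.log_one, Complex.ofReal_zero, zero_add]
    rw [e] at h3
    exact h3
  have htop : Filter.Tendsto (fun s => Complex.log ((w s - 1) / (w s + 1))) Filter.atTop
      (𝓝 0) := by
    have h1 : Filter.Tendsto (fun s => (w s - 1) / (w s + 1)) Filter.atTop (𝓝 1) := by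
      have h2 := (hwi.const_sub 1).div (hwi.const_add 1) (by norm_num)
      have h3 : (fun s => (w s - 1) / (w s + 1)) = (fun s => 1 - (w s)⁻¹) / fun s =>
          1 + (w s)⁻¹ := by
        ext s
        have h4 : w s ≠ 0 := ctrPt_ne_zero t _
        have h5 : 1 + (w s)⁻¹ ≠ 0 := fun h => hp s (by
          have : w s * (1 + (w s)⁻¹) = 0 := by rw [h, mul_zero]
          rwa [mul_add, mul_one, mul_inv_cancel₀ h4] at this)
        rw [Pi.div_apply, div_eq_div_iff (hp s) h5]
        field_simp
      rw [h3]
      have e : ((1 : ℂ) - 0) / (1 + 0) = 1 := by norm_num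
      rw [e] at h2
      exact h2
    have := h1.clog (by simp)
    simpa using this
  rw [integral_of_hasDerivAt_of_tendsto hW hi hbot htop, zero_sub]

theorem cauchy_kernel_one {t : ℝ} (ht0 : 0 < t) (ht1 : t < π)
    (hi : CtrIntegrable t fun w => (w - 1)⁻¹ • ((w + 1)⁻¹ * (2 : ℂ))) :
    cint t (fun w => (w - 1)⁻¹ • ((w + 1)⁻¹ * (2 : ℂ))) = -1 := by
  have h1 := hi.ray true
  simp only [ctrWt_true, smul_eq_mul, mul_assoc (2 * (π : ℂ) * Complex.I)⁻¹] at h1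
  have h2 := (integrable_const_mul_iff (isUnit_iff_ne_zero.2 two_pi_I_inv_ne_zero) _).1 h1
  have h3 := integral_ray_kernel_one ht0 ht1 h2
  rw [cint_eq_rays hi]
  have hconj : ∀ s, ctrPt t (false, s) = (starRingEnd ℂ) (ctrPt t (true, s)) := by
    intro s
    rw [ctrPt_true, ctrPt_false, ← Complex.exp_conj]
    simp
  have h4 : ∫ s : ℝ, ctrPt t (false, s) * ((ctrPt t (false, s) - 1)⁻¹ *
      ((ctrPt t (false, s) + 1)⁻¹ * 2)) = π * Complex.I := by
    have := congrArg (starRingEnd ℂ) h3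
    rw [← integral_conj] at this
    have e : (starRingEnd ℂ) 2 = 2 := Complex.conj_ofNat 2
    simpa [hconj, e] using this
  simp only [ctrWt_true, ctrWt_false, smul_eq_mul, mul_assoc (2 * (π : ℂ) * Complex.I)⁻¹,
    mul_assoc (-(2 * (π : ℂ) * Complex.I)⁻¹)]
  rw [integral_const_mul, integral_const_mul, h3, h4]
  have := Real.pi_ne_zero
  have := Complex.I_ne_zero
  field_simp
  norm_num

theorem cauchy_kernel {t : ℝ} (ht0 : 0 < t) (ht1 : t < π) {z : ℂ} (hz : z ∈ osec t) :
    cint t (fun w => (w - z)⁻¹ • ((w + 1)⁻¹ * (z + 1))) = -1 := by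
  obtain ⟨κ0, hκ0, hκ⟩ := exists_add_one_ge ht0.le ht1
  obtain ⟨κ1, hκ1, hκ'⟩ := exists_add_one_ge (t := π - t) (by linarith) (by linarith)
  have hne : ∀ w ∈ csec t, w + 1 ≠ 0 := fun w hw h => by
    have := hκ w hw
    rw [h, norm_zero] at this
    have h2 := mul_pos hκ0 (by positivity : 0 < ‖w‖ + 1)
    linarith
  have hne' : ∀ w ∈ csec (π - t), w + 1 ≠ 0 := fun w hw h => by
    have := hκ' w hw
    rw [h, norm_zero] at this
    have h2 := mul_pos hκ1 (by positivity : 0 < ‖w‖ + 1)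
    linarith
  have hI : ∀ ζ ∈ osec t, ∀ c : ℂ, CtrIntegrable t fun w => (w - ζ)⁻¹ • ((w + 1)⁻¹ * c) := by
    intro ζ hζ c
    refine ctrIntegrable_pole (κ := 1 / 2) (C := κ0⁻¹ * ‖c‖) ht0.le ht1 (by norm_num)
      (by norm_num) ?_ ?_ hζ.1 hζ.2.ne
    · exact ContinuousOn.mul (ContinuousOn.inv₀ (by fun_prop)
        fun w hw => hne w (rays_subset_csec t hw)) continuousOn_const
    · intro w hw
      rw [norm_mul, mul_right_comm]
      gcongr
      exact norm_inv_add_one_le hκ0 (by norm_num) (by norm_num) hw.1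
        (hκ w (rays_subset_csec t hw))
  have h1 : (1 : ℂ) ∈ osec t := ⟨one_ne_zero, by simpa using ht0⟩
  have key : cint t (fun w => (w - z)⁻¹ • ((w + 1)⁻¹ * (z + 1))) -
      cint t (fun w => (w - 1)⁻¹ • ((w + 1)⁻¹ * (1 + 1))) = 0 := by
    rw [← cint_sub (hI z hz _) (hI 1 h1 _), cint_congr ht0.le ht1
      (g := fun w => (z - 1) • ((w - z)⁻¹ • (w - 1)⁻¹)), cint_smul, cint_reflect,
      cint_congr (by linarith) (by linarith)
      (g := fun v => (v - (-z))⁻¹ • (v + 1)⁻¹),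
      cauchy_right_ext (g := fun v => (v + 1)⁻¹) (κ := 1 / 2) (C := κ1⁻¹) (by linarith)
        (by linarith) (by norm_num) (by norm_num) (ContinuousOn.inv₀ (by fun_prop) hne')
        (DifferentiableOn.inv (by fun_prop) fun w hw => hne' w (osec_subset_csec _ hw)) ?_
        (neg_ne_zero.2 hz.1) (by rw [abs_arg_neg hz.1]; linarith [hz.2]), smul_zero]
    · intro w hw
      exact norm_inv_add_one_le hκ1 (by norm_num) (by norm_num) hw.1 (hκ' w hw)
    · intro v hv
      simp only [smul_eq_mul, sub_neg_eq_add, ← mul_inv]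
      congr 1; ring
    · intro w hw
      have e1 := hne w (rays_subset_csec t hw)
      have e2 := ne_of_mem_rays hw hz.2.ne
      have e3 := ne_of_mem_rays hw h1.2.ne
      simp only [smul_eq_mul]
      field_simp
      ring
  rw [sub_eq_zero] at key
  rw [key, one_add_one_eq_two]
  exact cauchy_kernel_one ht0 ht1 (hI 1 h1 2)

/-- Cauchy's formula for a sector, interior point. -/
theorem cauchy_right {t κ C : ℝ} (ht0 : 0 < t) (ht1 : t < π) (h0 : 0 < κ) (h1 : κ < 1)
    {g : ℂ → E} (hc : ContinuousOn g (csec t)) (hd : DifferentiableOn ℂ g (osec t))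
    (hb : ∀ w ∈ csec t, ‖g w‖ ≤ C * ‖w‖ ^ (-κ)) {z : ℂ} (hz : z ∈ osec t) :
    cint t (fun w => (w - z)⁻¹ • g w) = -g z := by
  obtain ⟨κ0, hκ0, hκ⟩ := exists_add_one_ge ht0.le ht1
  have hne : ∀ w ∈ csec t, w + 1 ≠ 0 := fun w hw h => by
    have := hκ w hw
    rw [h, norm_zero] at this
    have h2 := mul_pos hκ0 (by positivity : 0 < ‖w‖ + 1)
    linarith
  set q : ℂ → E := fun w => ((w + 1)⁻¹ * (z + 1)) • g z with hq
  have hqc : ContinuousOn q (csec t) := ContinuousOn.smul (ContinuousOn.mul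
    (ContinuousOn.inv₀ (by fun_prop) hne) continuousOn_const) continuousOn_const
  have hqd : DifferentiableOn ℂ q (osec t) := DifferentiableOn.smul_const
    (DifferentiableOn.mul_const (DifferentiableOn.inv (by fun_prop)
      fun w hw => hne w (osec_subset_csec t hw)) _) _
  have hqb : ∀ w ∈ csec t, ‖q w‖ ≤ κ0⁻¹ * (‖z + 1‖ * ‖g z‖) * ‖w‖ ^ (-κ) := by
    intro w hw
    rw [hq, norm_smul, norm_mul]
    have := norm_inv_add_one_le hκ0 h0.le h1.le hw.1 (hκ w hw)
    calc _ ≤ κ0⁻¹ * ‖w‖ ^ (-κ) * ‖z + 1‖ * ‖g z‖ := by gcongr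
      _ = _ := by ring
  set G : ℂ → E := fun w => g w - q w with hG
  have hGz : G z = 0 := by
    simp only [hG, hq]
    rw [inv_mul_cancel₀ (hne z (osec_subset_csec t hz)), one_smul, sub_self]
  have hds : ∀ w, w ≠ z → dslope G z w = (w - z)⁻¹ • G w := by
    intro w hw
    rw [dslope_of_ne _ hw, slope_def_module, hGz, sub_zero]
  have hGc : ContinuousOn G (csec t) := hc.sub hqc
  have hGd : DifferentiableOn ℂ G (osec t) := hd.sub hqd
  have hGb : ∀ w ∈ csec t, ‖G w‖ ≤ (C + κ0⁻¹ * (‖z + 1‖ * ‖g z‖)) * ‖w‖ ^ (-κ) := fun w hw => by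
    rw [add_mul]
    exact (norm_sub_le _ _).trans (add_le_add (hb w hw) (hqb w hw))
  have hwz : ∀ w ∈ rays t, w ≠ z := fun w hw h => sub_ne_zero.1 (ne_of_mem_rays hw hz.2.ne) h
  have hint := ctrIntegrable_pole ht0.le ht1 h0 h1 (hGc.mono (rays_subset_csec t))
    (fun w hw => hGb w (rays_subset_csec t hw)) hz.1 hz.2.ne
  have hz' := norm_pos_iff.2 hz.1
  have h2 : cint t (dslope G z) = 0 := by
    refine cint_eq_zero (ν := min κ (1 - κ)) (S0 := |Real.log ‖z‖| + Real.log 2) ht0.le ht1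
      (lt_min h0 (by linarith)) ?_ ?_ (hint.congr ht0.le ht1 fun w hw => (hds w (hwz w hw)).symm)
      (C := (C + κ0⁻¹ * (‖z + 1‖ * ‖g z‖)) / (1 / 3) * (1 + 1 / ‖z‖)) ?_
    · exact (continuousOn_dslope (csec_mem_nhds ht1.le hz)).2
        ⟨hGc, hGd.differentiableAt ((isOpen_osec ht1.le).mem_nhds hz)⟩
    · exact (Complex.differentiableOn_dslope ((isOpen_osec ht1.le).mem_nhds hz)).2 hGd
    · intro w hw hS
      have hw' := norm_pos_iff.2 hw.1
      have hfar : 1 / 3 * (‖w‖ + ‖z‖) ≤ ‖w - z‖ := by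
        have hl2 := Real.log_pos one_lt_two
        rcases le_abs.1 hS with h | h
        · have : Real.log (2 * ‖z‖) ≤ Real.log ‖w‖ := by
            rw [Real.log_mul two_ne_zero hz'.ne']
            linarith [le_abs_self (Real.log ‖z‖)]
          have := (Real.log_le_log_iff (by positivity) hw').1 this
          have := norm_sub_norm_le w z
          linarith
        · have : Real.log (2 * ‖w‖) ≤ Real.log ‖z‖ := by
            rw [Real.log_mul two_ne_zero hw'.ne']
            linarith [neg_abs_le (Real.log ‖z‖)]
          have := (Real.log_le_log_iff (by positivity) hz').1 this
          have := norm_sub_norm_le z w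
          rw [norm_sub_rev] at this
          linarith
      have hne2 : w ≠ z := by
        rintro rfl
        rw [sub_self, norm_zero] at hfar
        linarith
      rw [hds w hne2]
      exact norm_pole_le (by norm_num) h0 h1 hz.1 hw.1 (hGb w hw) hfar
  rw [cint_congr ht0.le ht1 fun w hw => hds w (hwz w hw)] at h2
  have i1 := ctrIntegrable_pole ht0.le ht1 h0 h1 (hc.mono (rays_subset_csec t))
    (fun w hw => hb w (rays_subset_csec t hw)) hz.1 hz.2.ne
  have i2 := ctrIntegrable_pole ht0.le ht1 h0 h1 (hqc.mono (rays_subset_csec t))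
    (fun w hw => hqb w (rays_subset_csec t hw)) hz.1 hz.2.ne
  have h3 : cint t (fun w => (w - z)⁻¹ • q w) = - g z := by
    have i3 : CtrIntegrable t fun w => (w - z)⁻¹ • ((w + 1)⁻¹ * (z + 1)) := by
      refine ctrIntegrable_pole (κ := 1 / 2) (C := κ0⁻¹ * ‖z + 1‖) ht0.le ht1 (by norm_num)
        (by norm_num) ?_ ?_ hz.1 hz.2.ne
      · exact ContinuousOn.mul (ContinuousOn.inv₀ (by fun_prop)
          fun w hw => hne w (rays_subset_csec t hw)) continuousOn_const
      · intro w hw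
        rw [norm_mul, mul_right_comm]
        gcongr
        exact norm_inv_add_one_le hκ0 (by norm_num) (by norm_num) hw.1
          (hκ w (rays_subset_csec t hw))
    have := cint_clm ((ContinuousLinearMap.id ℂ ℂ).smulRight (g z)) i3
    rw [cauchy_kernel ht0 ht1 hz] at this
    simpa [hq, mul_smul] using this
  simp only [hG, smul_sub] at h2
  rw [cint_sub i1 i2, h3, sub_eq_zero] at h2
  exact h2

theorem cauchy_left {t κ C : ℝ} (ht0 : 0 < t) (ht1 : t < π) (h0 : 0 < κ) (h1 : κ < 1)
    {g : ℂ → E} (hc : ContinuousOn g (csec (π - t))) (hd : DifferentiableOn ℂ g (osec (π - t)))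
    (hb : ∀ w ∈ csec (π - t), ‖g w‖ ≤ C * ‖w‖ ^ (-κ)) {z : ℂ} (hz : -z ∈ osec (π - t)) :
    cint t (fun w => (w - z)⁻¹ • g (-w)) = g (-z) := by
  rw [cint_reflect, ← neg_neg (g (-z)),
    ← cauchy_right (t := π - t) (by linarith) (by linarith) h0 h1 hc hd hb hz,
    ← neg_one_smul ℂ, ← cint_smul]
  refine cint_congr (by linarith) (by linarith) fun v hv => ?_
  rw [neg_neg, smul_smul, neg_one_mul, ← inv_neg]
  congr 2; ring

theorem cauchy_left_ext {t κ C : ℝ} (ht0 : 0 < t) (ht1 : t < π) (h0 : 0 < κ) (h1 : κ < 1)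
    {g : ℂ → E} (hc : ContinuousOn g (csec (π - t))) (hd : DifferentiableOn ℂ g (osec (π - t)))
    (hb : ∀ w ∈ csec (π - t), ‖g w‖ ≤ C * ‖w‖ ^ (-κ)) {z : ℂ} (hz : z ∈ osec t) :
    cint t (fun w => (w - z)⁻¹ • g (-w)) = 0 := by
  have := cauchy_right_ext (t := π - t) (by linarith) (by linarith) h0 h1 hc hd hb
    (z := -z) (neg_ne_zero.2 hz.1) (by rw [abs_arg_neg hz.1]; linarith [hz.2])
  rw [cint_reflect, ← neg_zero, ← this, ← neg_one_smul ℂ, ← cint_smul]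
  refine cint_congr (by linarith) (by linarith) fun v hv => ?_
  rw [neg_neg, smul_smul, neg_one_mul, ← inv_neg]
  congr 2; ring

end CauchyFormula

/-- The closed complement of a sector, without the vertex. -/
def cleft (t : ℝ) : Set ℂ := {z | z ≠ 0 ∧ t ≤ |z.arg|}

/-- The open complement of a sector. -/
def oleft (t : ℝ) : Set ℂ := {z | z ≠ 0 ∧ t < |z.arg|}

theorem oleft_subset_cleft (t : ℝ) : oleft t ⊆ cleft t := fun _ h => ⟨h.1, h.2.le⟩

theorem rays_subset_cleft (t : ℝ) : rays t ⊆ cleft t := fun _ h => ⟨h.1, h.2.ge⟩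

theorem cleft_subset_oleft {s t : ℝ} (h : s < t) : cleft t ⊆ oleft s :=
  fun _ hz => ⟨hz.1, h.trans_le hz.2⟩

theorem cleft_anti {s t : ℝ} (h : s ≤ t) : cleft t ⊆ cleft s := fun _ hz => ⟨hz.1, h.trans hz.2⟩

theorem oleft_anti {s t : ℝ} (h : s ≤ t) : oleft t ⊆ oleft s :=
  fun _ hz => ⟨hz.1, h.trans_lt hz.2⟩

theorem neg_mem_cleft {t : ℝ} {v : ℂ} (hv : v ∈ csec (π - t)) : -v ∈ cleft t :=
  ⟨neg_ne_zero.2 hv.1, by rw [abs_arg_neg hv.1]; linarith [hv.2]⟩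

theorem neg_mem_oleft {t : ℝ} {v : ℂ} (hv : v ∈ osec (π - t)) : -v ∈ oleft t :=
  ⟨neg_ne_zero.2 hv.1, by rw [abs_arg_neg hv.1]; linarith [hv.2]⟩

theorem neg_mem_osec {t : ℝ} {v : ℂ} (hv : v ∈ oleft t) : -v ∈ osec (π - t) :=
  ⟨neg_ne_zero.2 hv.1, by rw [abs_arg_neg hv.1]; linarith [hv.2]⟩

theorem oleft_eq_compl {t : ℝ} (ht : 0 ≤ t) : oleft t = {z : ℂ | z ∉ Sector t} := by
  ext z
  simp only [oleft, Sector, mem_ofPred_eq, not_le]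
  refine ⟨fun h => h.2, fun h => ⟨?_, h⟩⟩
  rintro rfl
  rw [Complex.arg_zero, abs_zero] at h
  linarith

theorem csec_subset_sector {s t : ℝ} (h : s ≤ t) : csec s ⊆ Sector t := fun _ hz => hz.2.trans h

section Left

variable {E : Type*} [NormedAddCommGroup E] [NormedSpace ℂ E] [CompleteSpace E]

/-- Cauchy's formula for the complement of a sector, interior point. -/
theorem cauchy_oleft {t κ C : ℝ} (ht0 : 0 < t) (ht1 : t < π) (h0 : 0 < κ) (h1 : κ < 1)
    {f : ℂ → E} (hc : ContinuousOn f (cleft t)) (hd : DifferentiableOn ℂ f (oleft t))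
    (hb : ∀ w ∈ cleft t, ‖f w‖ ≤ C * ‖w‖ ^ (-κ)) {z : ℂ} (hz : z ∈ oleft t) :
    cint t (fun w => (w - z)⁻¹ • f w) = f z := by
  have := cauchy_left (g := fun v => f (-v)) ht0 ht1 h0 h1
    (hc.comp continuousOn_neg fun v hv => neg_mem_cleft hv)
    (hd.comp (differentiableOn_neg _) fun v hv => neg_mem_oleft hv)
    (fun w hw => by simpa using hb _ (neg_mem_cleft hw)) (neg_mem_osec hz)
  simpa using this

/-- Cauchy's formula for the complement of a sector, exterior point. -/
theorem cauchy_oleft_ext {t κ C : ℝ} (ht0 : 0 < t) (ht1 : t < π) (h0 : 0 < κ) (h1 : κ < 1)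
    {f : ℂ → E} (hc : ContinuousOn f (cleft t)) (hd : DifferentiableOn ℂ f (oleft t))
    (hb : ∀ w ∈ cleft t, ‖f w‖ ≤ C * ‖w‖ ^ (-κ)) {z : ℂ} (hz : z ∈ osec t) :
    cint t (fun w => (w - z)⁻¹ • f w) = 0 := by
  have := cauchy_left_ext (g := fun v => f (-v)) ht0 ht1 h0 h1
    (hc.comp continuousOn_neg fun v hv => neg_mem_cleft hv)
    (hd.comp (differentiableOn_neg _) fun v hv => neg_mem_oleft hv)
    (fun w hw => by simpa using hb _ (neg_mem_cleft hw)) hz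
  simpa using this

end Left

section Kernels

theorem homogeneous_kernel_le {κ x y : ℝ} (h0 : 0 < κ) (h1 : κ < 1) (hx : 0 < x) (hy : 0 < y) :
    x ^ (1 - κ) * y ^ κ / (x + y) ≤ 2 * mdec (min κ (1 - κ)) (x / y) := by
  have h := rpow_div_add_le h0 h1 (div_pos hx hy) one_pos
  have e : x ^ (1 - κ) * y ^ κ / (x + y) = (x / y) ^ (1 - κ) / (x / y + 1) := by
    rw [Real.div_rpow hx.le hy.le, Real.rpow_sub hy, Real.rpow_one]
    field_simp
  rw [e]
  norm_num at h ⊢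
  exact h

theorem rpow_div_one_add_le {κ x : ℝ} (h0 : 0 < κ) (h1 : κ < 1) (hx : 0 < x) :
    x ^ (1 - κ) / (1 + x) ≤ 2 * mdec (min κ (1 - κ)) x := by
  have h := rpow_div_add_le h0 h1 hx one_pos
  rw [add_comm 1 x]
  norm_num at h ⊢
  exact h

theorem double_kernel_le {κ x y : ℝ} (h0 : 0 < κ) (h1 : κ < 1) (hx : 0 < x) (hy : 0 < y) :
    x ^ (1 - κ) * y / ((x + y) * (1 + y)) ≤
      4 * (mdec (min κ (1 - κ) / 2) x * mdec (min κ (1 - κ) / 2) y) := by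
  have hν : 0 ≤ min κ (1 - κ) := (lt_min h0 (by linarith)).le
  have e : x ^ (1 - κ) * y / ((x + y) * (1 + y)) =
      (x ^ (1 - κ) * y ^ κ / (x + y)) * (y ^ (1 - κ) / (1 + y)) := by
    have : y = y ^ κ * y ^ (1 - κ) := by rw [← Real.rpow_add hy]; simp
    rw [div_mul_div_comm]
    congr 1
    rw [mul_assoc, ← this]
  rw [e]
  calc _ ≤ (2 * mdec (min κ (1 - κ)) (x / y)) * (2 * mdec (min κ (1 - κ)) y) :=
        mul_le_mul (homogeneous_kernel_le h0 h1 hx hy) (rpow_div_one_add_le h0 h1 hy)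
          (by positivity) (by have := mdec_nonneg (min κ (1 - κ)) (x / y); positivity)
    _ = 4 * (mdec (min κ (1 - κ)) (x / y) * mdec (min κ (1 - κ)) y) := by ring
    _ ≤ _ := mul_le_mul_of_nonneg_left (mdec_mul_le_half hν hx hy) (by norm_num)

theorem inv_one_add_le_rpow {κ x : ℝ} (h0 : 0 ≤ κ) (h1 : κ ≤ 1) (hx : 0 < x) :
    (1 + x)⁻¹ ≤ x ^ (-κ) := by
  rw [Real.rpow_neg hx.le]
  gcongr
  rcases le_total x 1 with h | h
  · exact (Real.rpow_le_one hx.le h h0).trans (by linarith)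
  · calc x ^ κ ≤ x ^ (1 : ℝ) := Real.rpow_le_rpow_of_exponent_le h h1
      _ ≤ _ := by rw [Real.rpow_one]; linarith

end Kernels

section PseudoResolvent

variable {𝔸 : Type*} [NormedRing 𝔸] [NormedAlgebra ℂ 𝔸]

/-- A pseudo-resolvent on a sector with resolvent decay. -/
structure IsPRes (R : ℂ → 𝔸) (t K : ℝ) : Prop where
  bound : ∀ z ∈ Sector t, (1 + ‖z‖) * ‖R z‖ ≤ K
  res : ∀ z ∈ Sector t, ∀ w ∈ Sector t, R z - R w = (w - z) • (R z * R w)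

namespace IsPRes

variable {R : ℂ → 𝔸} {t K : ℝ}

theorem norm_le (h : IsPRes R t K) {z : ℂ} (hz : z ∈ Sector t) : ‖R z‖ ≤ K / (1 + ‖z‖) := by
  rw [le_div_iff₀ (by positivity), mul_comm]
  exact h.bound z hz

theorem nonneg (h : IsPRes R t K) (ht : 0 ≤ t) : 0 ≤ K := by
  have := h.bound 0 (by simpa [Sector] using ht)
  exact le_trans (by positivity) this

theorem norm_le_const (h : IsPRes R t K) {z : ℂ} (hz : z ∈ Sector t) : ‖R z‖ ≤ K := by
  refine le_trans ?_ (h.bound z hz)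
  nlinarith [norm_nonneg z, norm_nonneg (R z)]

theorem norm_le_rpow (h : IsPRes R t K) {z : ℂ} (hz : z ∈ csec t) {κ : ℝ} (h0 : 0 ≤ κ)
    (h1 : κ ≤ 1) : ‖R z‖ ≤ K * ‖z‖ ^ (-κ) := by
  have hz' := norm_pos_iff.2 hz.1
  have hK : 0 ≤ K := le_trans (by positivity) (h.bound z hz.2)
  refine (h.norm_le hz.2).trans ?_
  rw [div_eq_mul_inv]
  gcongr
  exact inv_one_add_le_rpow h0 h1 hz'

theorem comm (h : IsPRes R t K) {z w : ℂ} (hz : z ∈ Sector t) (hw : w ∈ Sector t) :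
    R z * R w = R w * R z := by
  by_cases hzw : w - z = 0
  · rw [sub_eq_zero.1 hzw]
  · have h1 := h.res z hz w hw
    have h2 := h.res w hw z hz
    have h3 : (w - z) • (R z * R w) = (w - z) • (R w * R z) := by
      rw [← h1, ← neg_sub (R w) (R z), h2, ← neg_smul, neg_sub]
    exact smul_right_injective 𝔸 hzw h3

theorem continuousOn (h : IsPRes R t K) : ContinuousOn R (Sector t) := by
  intro z hz
  have : Filter.Tendsto (fun w => ‖w - z‖ * (K * K)) (𝓝[Sector t] z) (𝓝 0) := by
    have : Continuous fun w => ‖w - z‖ * (K * K) := by fun_prop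
    have h2 := this.tendsto z
    simp only [sub_self, norm_zero, zero_mul] at h2
    exact h2.mono_left nhdsWithin_le_nhds
  refine tendsto_iff_norm_sub_tendsto_zero.2 (squeeze_zero' (Filter.Eventually.of_forall
    fun _ => norm_nonneg _) ?_ this)
  filter_upwards [self_mem_nhdsWithin] with w hw
  rw [h.res w hw z hz, norm_smul, norm_sub_rev]
  gcongr
  exact (norm_mul_le _ _).trans (mul_le_mul (h.norm_le_const hw) (h.norm_le_const hz)
    (norm_nonneg _) ((norm_nonneg _).trans (h.norm_le_const hw)))

theorem differentiableOn (h : IsPRes R t K) (ht : t ≤ π) : DifferentiableOn ℂ R (osec t) := by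
  intro z hz
  have hzt : Sector t ∈ 𝓝 z := Filter.mem_of_superset (csec_mem_nhds ht hz)
    (csec_subset_sector le_rfl)
  have hzs : z ∈ Sector t := hz.2.le
  have hcz : ContinuousAt R z := (h.continuousOn z hzs).continuousAt hzt
  have : HasDerivAt R (-(R z * R z)) z := by
    rw [hasDerivAt_iff_tendsto_slope]
    have h1 : Filter.Tendsto (fun w => -(R z * R w)) (𝓝[≠] z) (𝓝 (-(R z * R z))) :=
      ((tendsto_const_nhds.mul hcz.tendsto).neg).mono_left nhdsWithin_le_nhds
    refine h1.congr' ?_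
    filter_upwards [nhdsWithin_le_nhds hzt, self_mem_nhdsWithin] with w hw hne
    have hne' : w - z ≠ 0 := sub_ne_zero.2 hne
    rw [slope_def_module, ← neg_sub (R z) (R w), h.res z hzs w hw, smul_neg, smul_smul,
      inv_mul_cancel₀ hne', one_smul]
  exact this.differentiableAt.differentiableWithinAt

theorem mono (h : IsPRes R t K) {s : ℝ} (hs : s ≤ t) : IsPRes R s K :=
  ⟨fun z hz => h.bound z (le_trans hz hs), fun z hz w hw => h.res z (le_trans hz hs) w
    (le_trans hw hs)⟩

theorem continuousOn_csec (h : IsPRes R t K) : ContinuousOn R (csec t) :=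
  h.continuousOn.mono (csec_subset_sector le_rfl)

theorem continuousOn_rays (h : IsPRes R t K) {s : ℝ} (hs : s ≤ t) : ContinuousOn R (rays s) :=
  h.continuousOn.mono fun _ hz => hz.2.le.trans hs

variable [CompleteSpace 𝔸]

theorem cauchy (h : IsPRes R t K) (ht0 : 0 < t) (ht1 : t < π) {z : ℂ} (hz : z ∈ osec t) :
    cint t (fun w => (w - z)⁻¹ • R w) = -R z :=
  cauchy_right (κ := 1 / 2) ht0 ht1 (by norm_num) (by norm_num) h.continuousOn_csec
    (h.differentiableOn ht1.le) (fun _ hw => h.norm_le_rpow hw (by norm_num) (by norm_num)) hz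

end IsPRes

end PseudoResolvent

section Shift

variable {E : Type*} [NormedAddCommGroup E] [NormedSpace ℂ E]

theorem ctrIntegrable_smul {t κ C K : ℝ} (ht0 : 0 ≤ t) (ht1 : t < π) (h0 : 0 < κ) (h1 : κ < 1)
    {f : ℂ → ℂ} (hc : ContinuousOn f (rays t)) (hb : ∀ w ∈ rays t, ‖f w‖ ≤ C * ‖w‖ ^ (-κ))
    {Q : ℂ → E} (hQc : ContinuousOn Q (rays t)) (hQb : ∀ w ∈ rays t, ‖Q w‖ ≤ K / (1 + ‖w‖)) :
    CtrIntegrable t fun w => f w • Q w := by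
  refine ctrIntegrable_of_bound (ν := min κ (1 - κ)) (C := C * K * 2) ht0 ht1
    (lt_min h0 (by linarith)) (hc.smul hQc) fun w hw => ?_
  have hw' := norm_pos_iff.2 hw.1
  have hC := (norm_nonneg _).trans (hb w hw)
  have hK := (norm_nonneg _).trans (hQb w hw)
  rw [norm_smul]
  calc ‖w‖ * (‖f w‖ * ‖Q w‖) ≤ ‖w‖ * ((C * ‖w‖ ^ (-κ)) * (K / (1 + ‖w‖))) := by
        gcongr
        · exact hb w hw
        · exact hQb w hw
    _ = C * K * ((‖w‖ ^ (-κ) * ‖w‖) / (1 + ‖w‖)) := by ring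
    _ = C * K * (‖w‖ ^ (1 - κ) / (1 + ‖w‖)) := by
      rw [← Real.rpow_add_one hw'.ne']; ring_nf
    _ ≤ C * K * (2 * mdec (min κ (1 - κ)) ‖w‖) := by
      have hCK : 0 ≤ C * K := by
        have h3 : 0 ≤ C := nonneg_of_mul_nonneg_left hC (by positivity)
        have h4 : 0 ≤ K := by
          rw [div_eq_mul_inv] at hK
          exact nonneg_of_mul_nonneg_left hK (by positivity)
        positivity
      gcongr
      exact rpow_div_one_add_le h0 h1 hw'
    _ = _ := by ring

variable [CompleteSpace E]

/-- Fubini for a Cauchy transform, followed by Cauchy's formula. -/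
theorem cint_smul_cauchy {t1 t2 κ C K : ℝ} (ht1 : 0 < t1) (h12 : t1 < t2) (ht2 : t2 < π)
    (h0 : 0 < κ) (h1 : κ < 1) {f : ℂ → ℂ} (hc : ContinuousOn f (cleft t1))
    (hd : DifferentiableOn ℂ f (oleft t1)) (hb : ∀ w ∈ cleft t1, ‖f w‖ ≤ C * ‖w‖ ^ (-κ))
    {Q : ℂ → E} (hQc : ContinuousOn Q (rays t2)) (hQb : ∀ w ∈ rays t2, ‖Q w‖ ≤ K / (1 + ‖w‖)) :
    cint t1 (fun z => f z • cint t2 fun w => (w - z)⁻¹ • Q w) =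
      -cint t2 fun w => f w • Q w := by
  have ht1π := h12.trans ht2
  have ht2' := ht1.trans h12
  have hs := sin_half_pos (δ := t2 - t1) (by linarith) (by linarith)
  simp only [← cint_smul]
  rw [cint_swap (ν := min κ (1 - κ) / 2) (C := C * K * (Real.sin ((t2 - t1) / 2))⁻¹ * 4)
    ht1.le ht1π ht2'.le ht2 (half_pos (lt_min h0 (by linarith)))]
  · rw [← neg_one_smul ℂ, ← cint_smul]
    refine cint_congr ht2'.le ht2 fun w hw => ?_
    have hwl : w ∈ oleft t1 := ⟨hw.1, by rw [hw.2]; exact h12⟩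
    have hi := ctrIntegrable_pole ht1.le ht1π h0 h1 (hc.mono (rays_subset_cleft t1))
      (fun w hw => hb w (rays_subset_cleft t1 hw)) hwl.1 hwl.2.ne'
    have e := cint_clm ((ContinuousLinearMap.id ℂ ℂ).smulRight (Q w)) hi
    rw [cauchy_oleft ht1 ht1π h0 h1 hc hd hb hwl] at e
    simp only [ContinuousLinearMap.smulRight_apply, ContinuousLinearMap.id_apply] at e
    rw [← e, ← cint_smul]
    refine cint_congr ht1.le ht1π fun z hz => ?_
    rw [smul_smul, smul_smul, smul_eq_mul, neg_one_mul, ← neg_mul, ← inv_neg, neg_sub, mul_comm]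
  · refine ContinuousOn.smul (((hc.mono (rays_subset_cleft t1))).comp continuousOn_fst
      fun p hp => hp.1) (ContinuousOn.smul (ContinuousOn.inv₀ (by fun_prop) fun p hp => ?_)
      (hQc.comp continuousOn_snd fun p hp => hp.2))
    exact ne_of_mem_rays hp.2 (by rw [hp.1.2]; exact h12.ne)
  · intro z hz w hw
    have hz' := norm_pos_iff.2 hz.1
    have hw' := norm_pos_iff.2 hw.1
    have hC := nonneg_of_mul_nonneg_left ((norm_nonneg _).trans (hb z (rays_subset_cleft _ hz)))
      (by positivity)
    have hK : 0 ≤ K := by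
      have := (norm_nonneg _).trans (hQb w hw)
      rw [div_eq_mul_inv] at this
      exact nonneg_of_mul_nonneg_left this (by positivity)
    have hge : Real.sin ((t2 - t1) / 2) * (‖z‖ + ‖w‖) ≤ ‖w - z‖ := by
      rw [norm_sub_rev]
      exact norm_sub_ge (by linarith) hz.2.le (by rw [hw.2]; linarith)
    rw [norm_smul, norm_smul, norm_inv]
    calc ‖z‖ * ‖w‖ * (‖f z‖ * (‖w - z‖⁻¹ * ‖Q w‖)) ≤ ‖z‖ * ‖w‖ * ((C * ‖z‖ ^ (-κ)) *
          ((Real.sin ((t2 - t1) / 2) * (‖z‖ + ‖w‖))⁻¹ * (K / (1 + ‖w‖)))) := by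
          gcongr
          · exact hb z (rays_subset_cleft _ hz)
          · exact hQb w hw
      _ = C * K * (Real.sin ((t2 - t1) / 2))⁻¹ *
          ((‖z‖ ^ (-κ) * ‖z‖) * ‖w‖ / ((‖z‖ + ‖w‖) * (1 + ‖w‖))) := by field_simp
      _ = C * K * (Real.sin ((t2 - t1) / 2))⁻¹ *
          (‖z‖ ^ (1 - κ) * ‖w‖ / ((‖z‖ + ‖w‖) * (1 + ‖w‖))) := by
        rw [← Real.rpow_add_one hz'.ne']; ring_nf
      _ ≤ C * K * (Real.sin ((t2 - t1) / 2))⁻¹ * (4 * (mdec (min κ (1 - κ) / 2) ‖z‖ *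
          mdec (min κ (1 - κ) / 2) ‖w‖)) := by
        gcongr
        exact double_kernel_le h0 h1 hz' hw'
      _ = _ := by ring

end Shift

section Calculus

variable {𝔸 : Type*} [NormedRing 𝔸] [NormedAlgebra ℂ 𝔸] [CompleteSpace 𝔸]
  {R : ℂ → 𝔸} {t K : ℝ}

/-- The contour integral against a pseudo-resolvent does not depend on the angle. -/
theorem IsPRes.cint_shift (h : IsPRes R t K) {t1 t2 κ C : ℝ} (ht1 : 0 < t1) (h12 : t1 ≤ t2)
    (ht2 : t2 ≤ t) (hπ : t2 < π) (h0 : 0 < κ) (h1 : κ < 1) {f : ℂ → ℂ}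
    (hc : ContinuousOn f (cleft t1)) (hd : DifferentiableOn ℂ f (oleft t1))
    (hb : ∀ w ∈ cleft t1, ‖f w‖ ≤ C * ‖w‖ ^ (-κ)) :
    cint t1 (fun z => f z • R z) = cint t2 (fun z => f z • R z) := by
  rcases h12.eq_or_lt with rfl | h12
  · rfl
  have h2 := h.mono ht2
  have := cint_smul_cauchy ht1 h12 hπ h0 h1 hc hd hb (h2.continuousOn_rays le_rfl)
    (fun w hw => h2.norm_le hw.2.le)
  rw [← neg_inj, ← this, ← neg_one_smul ℂ, ← cint_smul]
  refine cint_congr ht1.le (h12.trans hπ) fun z hz => ?_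
  rw [h2.cauchy (ht1.trans h12) hπ ⟨hz.1, by rw [hz.2]; exact h12⟩, smul_neg, neg_one_smul]

/-- Multiplicativity of the contour calculus. -/
theorem IsPRes.cint_mul (h : IsPRes R t K) {t1 t2 κ C1 C2 C3 : ℝ} (ht1 : 0 < t1) (h12 : t1 < t2)
    (ht2 : t2 ≤ t) (hπ : t2 < π) (h0 : 0 < κ) (h1 : κ < 1) {f g : ℂ → ℂ}
    (hfc : ContinuousOn f (cleft t1)) (hfd : DifferentiableOn ℂ f (oleft t1))
    (hfb : ∀ w ∈ cleft t1, ‖f w‖ ≤ C1 * ‖w‖ ^ (-κ))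
    (hgc : ContinuousOn g (cleft t2)) (hgd : DifferentiableOn ℂ g (oleft t2))
    (hgb : ∀ w ∈ cleft t2, ‖g w‖ ≤ C2 * ‖w‖ ^ (-κ)) (hgb' : ∀ w ∈ cleft t2, ‖g w‖ ≤ C3) :
    cint t1 (fun z => f z • R z) * cint t2 (fun z => g z • R z) =
      cint t2 (fun z => (f z * g z) • R z) := by
  have h2 := h.mono ht2
  have ht2' := ht1.trans h12
  have hgr := hgc.mono (rays_subset_cleft t2)
  have hQc : ContinuousOn (fun w => g w • R w) (rays t2) :=
    hgr.smul (h2.continuousOn_rays le_rfl)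
  have hQb : ∀ w ∈ rays t2, ‖g w • R w‖ ≤ (C3 * K) / (1 + ‖w‖) := by
    intro w hw
    have h3 := hgb' w (rays_subset_cleft t2 hw)
    rw [norm_smul, mul_div_assoc]
    exact mul_le_mul h3 (h2.norm_le hw.2.le) (norm_nonneg _) ((norm_nonneg _).trans h3)
  have hi1 : CtrIntegrable t1 fun z => f z • R z := ctrIntegrable_smul ht1.le (h12.trans hπ) h0 h1
    (hfc.mono (rays_subset_cleft t1)) (fun w hw => hfb w (rays_subset_cleft t1 hw))
    (h2.continuousOn_rays h12.le) (fun w hw => h2.norm_le (hw.2.le.trans h12.le))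
  have hi2 : CtrIntegrable t2 fun z => g z • R z := ctrIntegrable_smul ht2'.le hπ h0 h1
    hgr (fun w hw => hgb w (rays_subset_cleft t2 hw))
    (h2.continuousOn_rays le_rfl) (fun w hw => h2.norm_le hw.2.le)
  have key := cint_smul_cauchy ht1 h12 hπ h0 h1 hfc hfd hfb hQc hQb
  simp only [smul_smul] at key
  rw [← neg_inj, ← key, ← neg_mul]
  have e1 := cint_clm ((ContinuousLinearMap.mul ℂ 𝔸).flip
    (cint t2 fun z => g z • R z)) hi1
  simp only [ContinuousLinearMap.flip_apply, ContinuousLinearMap.mul_apply'] at e1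
  rw [neg_mul, ← e1, ← neg_one_smul ℂ, ← cint_smul]
  refine cint_congr ht1.le (h12.trans hπ) fun z hz => ?_
  rw [smul_mul_assoc, smul_comm]
  congr 1
  have hzs : z ∈ osec t2 := ⟨hz.1, by rw [hz.2]; exact h12⟩
  have hi3 := ctrIntegrable_pole ht2'.le hπ h0 h1 hgr
    (fun w hw => hgb w (rays_subset_cleft t2 hw)) hzs.1 hzs.2.ne
  have e2 := cint_clm (ContinuousLinearMap.mul ℂ 𝔸 (R z)) hi2
  have e3 := cint_clm ((ContinuousLinearMap.id ℂ ℂ).smulRight (R z)) hi3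
  rw [cauchy_oleft_ext ht2' hπ h0 h1 hgc hgd hgb hzs] at e3
  simp only [ContinuousLinearMap.mul_apply', map_zero, ContinuousLinearMap.smulRight_apply,
    ContinuousLinearMap.id_apply] at e2 e3
  have i4 := hi3.clm ((ContinuousLinearMap.id ℂ ℂ).smulRight (R z))
  have i5 := hi2.clm (ContinuousLinearMap.mul ℂ 𝔸 (R z))
  simp only [ContinuousLinearMap.mul_apply', ContinuousLinearMap.smulRight_apply,
    ContinuousLinearMap.id_apply] at i4 i5
  rw [cint_congr ht2'.le hπ (f := fun w => ((w - z)⁻¹ * g w) • R w)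
    (g := fun w => ((w - z)⁻¹ • g w) • R z - R z * g w • R w), cint_sub i4 i5, e3, e2, zero_sub,
    neg_one_smul]
  intro w hw
  have hne : w - z ≠ 0 := ne_of_mem_rays hw hzs.2.ne
  have e4 : ((w - z)⁻¹ • g w) • R z - ((w - z)⁻¹ * g w) • R w = g w • (R z * R w) := by
    rw [smul_eq_mul, ← smul_sub, h2.res z hzs.2.le w hw.2.le, smul_smul]
    congr 1
    field_simp
  rw [mul_smul_comm, ← e4]
  abel

end Calculus

section FunctionalCalculus

theorem integral_comp_exp_univ {E : Type*} [NormedAddCommGroup E] [NormedSpace ℝ E] (g : ℝ → E) :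
    ∫ s : ℝ, Real.exp s • g (Real.exp s) = ∫ r in Ioi (0 : ℝ), g r := by
  rw [← Real.range_exp, ← image_univ]
  simpa [abs_of_pos (Real.exp_pos _)] using (integral_image_eq_integral_abs_deriv_smul
    (s := univ) MeasurableSet.univ (fun x _ => (Real.hasDerivAt_exp x).hasDerivWithinAt)
    Real.exp_injective.injOn g).symm

theorem fCalc_eq_cint {X : Type u} [NormedAddCommGroup X] [NormedSpace ℂ X] [CompleteSpace X]
    {R : ℂ → X →L[ℂ] X} {t : ℝ} {f : ℂ → ℂ} (h : CtrIntegrable t fun z => f z • R z) :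
    fCalc R t f = cint t fun z => f z • R z := by
  rw [cint_eq_rays h, ← integral_add (h.ray true) (h.ray false), fCalc, ← integral_comp_exp_univ,
    ← integral_smul]
  congr 1
  ext1 s
  have e1 : (Real.exp s : ℂ) * Complex.exp (t * Complex.I) = ctrPt t (true, s) := by
    rw [ctrPt_true, Complex.exp_add, Complex.ofReal_exp]
  have e2 : (Real.exp s : ℂ) * Complex.exp (-t * Complex.I) = ctrPt t (false, s) := by
    rw [ctrPt_false, Complex.exp_add, Complex.ofReal_exp]
  rw [ctrWt_true, ctrWt_false, ← e1, ← e2]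
  rw [← Complex.coe_smul, smul_sub, smul_sub, sub_eq_add_neg, ← smul_neg, ← smul_neg, ← neg_smul]
  simp only [smul_smul]
  congr 2 <;> ring

theorem memH0_of_mdec {φ ν C : ℝ} (hφ : 0 ≤ φ) (hν : 0 < ν) {f : ℂ → ℂ}
    (hd : DifferentiableOn ℂ f (oleft φ)) (hb : ∀ z ∈ oleft φ, ‖f z‖ ≤ C * mdec ν ‖z‖) :
    MemH0 φ f := by
  refine ⟨by rwa [← oleft_eq_compl hφ], (|C| + 1) * 2 ^ ν, ν, by positivity, hν, fun z hz => ?_⟩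
  have hz' : z ∈ oleft φ := by rw [oleft_eq_compl hφ]; exact hz
  have hx := norm_pos_iff.2 hz'.1
  refine (hb z hz').trans ?_
  rw [mul_assoc, ← Real.mul_rpow (by norm_num) (by positivity)]
  have : mdec ν ‖z‖ ≤ (2 * (‖z‖ / (1 + ‖z‖ ^ 2))) ^ ν := by
    rcases le_total ‖z‖ 1 with h | h
    · rw [mdec_of_le_one hx h]
      refine Real.rpow_le_rpow hx.le ?_ hν.le
      rw [← mul_div_assoc, le_div_iff₀ (by positivity)]
      nlinarith
    · rw [mdec_of_one_le h, Real.rpow_neg hx.le, ← Real.inv_rpow hx.le]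
      refine Real.rpow_le_rpow (by positivity) ?_ hν.le
      rw [← mul_div_assoc, le_div_iff₀ (by positivity)]
      field_simp
      nlinarith
  exact mul_le_mul (by linarith [le_abs_self C]) this (mdec_nonneg _ _) (by positivity)

end FunctionalCalculus

section PowerFunctions

/-- The power `(-u) ^ p`, holomorphic off the nonnegative real axis. -/
def negPow (p : ℝ) (u : ℂ) : ℂ := (-u) ^ (p : ℂ)

/-- The power `(1 - u) ^ p`, holomorphic off the nonnegative real axis. -/
def onePow (p : ℝ) (u : ℂ) : ℂ := (1 - u) ^ (p : ℂ)

theorem norm_negPow (p : ℝ) (u : ℂ) : ‖negPow p u‖ = ‖u‖ ^ p := by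
  rw [negPow, Complex.norm_cpow_real, norm_neg]

theorem norm_onePow (p : ℝ) (u : ℂ) : ‖onePow p u‖ = ‖1 - u‖ ^ p := by
  rw [onePow, Complex.norm_cpow_real]

theorem neg_mem_slitPlane {u : ℂ} (hu : u ∈ oleft 0) : -u ∈ Complex.slitPlane := by
  rw [Complex.mem_slitPlane_iff_arg]
  refine ⟨fun h => ?_, neg_ne_zero.2 hu.1⟩
  have := abs_arg_neg hu.1
  rw [h, abs_of_pos Real.pi_pos] at this
  linarith [hu.2]

theorem one_sub_mem_slitPlane {u : ℂ} (hu : u ∈ oleft 0) : 1 - u ∈ Complex.slitPlane := by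
  rw [Complex.mem_slitPlane_iff]
  by_contra! h
  have h1 : 0 ≤ u.re := by have := h.1; simp at this; linarith
  have h2 : u.im = 0 := by have := h.2; simpa using this
  have : u.arg = 0 := Complex.arg_eq_zero_iff.2 ⟨h1, h2⟩
  have := hu.2
  simp_all

theorem differentiableOn_negPow (p : ℝ) : DifferentiableOn ℂ (negPow p) (oleft 0) := fun _ hu =>
  ((differentiableAt_id.neg).cpow (differentiableAt_const _)
    (neg_mem_slitPlane hu)).differentiableWithinAt

theorem differentiableOn_onePow (p : ℝ) : DifferentiableOn ℂ (onePow p) (oleft 0) := fun _ hu =>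
  (((differentiableAt_const _).sub differentiableAt_id).cpow (differentiableAt_const _)
    (one_sub_mem_slitPlane hu)).differentiableWithinAt

theorem negPow_add {u : ℂ} (hu : u ≠ 0) (p q : ℝ) :
    negPow p u * negPow q u = negPow (p + q) u := by
  rw [negPow, negPow, negPow, Complex.ofReal_add, Complex.cpow_add _ _ (neg_ne_zero.2 hu)]

theorem negPow_zero (u : ℂ) : negPow 0 u = 1 := by simp [negPow]

theorem negPow_exp_mul {u : ℂ} (hu : u ≠ 0) (p s : ℝ) :
    negPow p ((Real.exp s : ℂ) * u) = (Real.exp (p * s) : ℂ) * negPow p u := by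
  have h : -((Real.exp s : ℂ) * u) = (Real.exp s : ℂ) * -u := by ring
  have h1 : (Real.exp s : ℂ) * -u ≠ 0 :=
    mul_ne_zero (by exact_mod_cast (Real.exp_pos s).ne') (neg_ne_zero.2 hu)
  rw [negPow, negPow, h, Complex.cpow_def_of_ne_zero h1, Complex.cpow_def_of_ne_zero
    (neg_ne_zero.2 hu), Complex.log_ofReal_mul (Real.exp_pos s) (neg_ne_zero.2 hu), Real.log_exp,
    Complex.ofReal_exp, ← Complex.exp_add]
  congr 1
  push_cast
  ring

theorem onePow_mul_neg {u : ℂ} (hu : u ∈ oleft 0) (p : ℝ) :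
    onePow (-p) u * onePow p u = 1 := by
  rw [onePow, onePow, ← Complex.cpow_add _ _ (Complex.slitPlane_ne_zero (one_sub_mem_slitPlane hu))]
  simp

/-- The first factor of the resolvent kernel. -/
def sqFst (u : ℂ) : ℂ := negPow (1 / 4) u * onePow (-(1 / 2)) u

/-- The second factor of the resolvent kernel with pole `e`. -/
def sqSnd (e u : ℂ) : ℂ := negPow (1 / 4) u * onePow (1 / 2) u * (e - u)⁻¹

theorem sqFst_mul_sqSnd {u : ℂ} (hu : u ∈ oleft 0) (e : ℂ) :
    sqFst u * sqSnd e u = negPow (1 / 2) u * (e - u)⁻¹ := by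
  have h1 := onePow_mul_neg hu (1 / 2)
  have h2 := negPow_add hu.1 (1 / 4) (1 / 4)
  rw [show (1 / 4 + 1 / 4 : ℝ) = 1 / 2 by norm_num] at h2
  rw [sqFst, sqSnd, ← h2]
  linear_combination (negPow (1 / 4) u * negPow (1 / 4) u * (e - u)⁻¹) * h1

theorem differentiableOn_sqFst {t : ℝ} (ht : 0 ≤ t) : DifferentiableOn ℂ sqFst (oleft t) :=
  ((differentiableOn_negPow _).mul (differentiableOn_onePow _)).mono (oleft_anti ht)

theorem differentiableOn_sqSnd {t : ℝ} (ht : 0 ≤ t) {e : ℂ} (he : |e.arg| ≤ t) :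
    DifferentiableOn ℂ (sqSnd e) (oleft t) := by
  refine (((differentiableOn_negPow _).mul (differentiableOn_onePow _)).mono
    (oleft_anti ht)).mul (DifferentiableOn.inv (by fun_prop) fun u hu h => ?_)
  rw [sub_eq_zero.1 h] at he
  exact absurd hu.2 (not_lt.2 he)

theorem rpow_quarter_le {x : ℝ} (hx : 0 < x) :
    x ^ (1 / 4 : ℝ) * (1 + x) ^ (-(1 / 2) : ℝ) ≤ mdec (1 / 4) x := by
  rcases le_total x 1 with h | h
  · rw [mdec_of_le_one hx h]
    exact mul_le_of_le_one_right (by positivity)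
      (Real.rpow_le_one_of_one_le_of_nonpos (by linarith) (by norm_num))
  · rw [mdec_of_one_le h]
    calc _ ≤ x ^ (1 / 4 : ℝ) * x ^ (-(1 / 2) : ℝ) := by
          gcongr ?_ * ?_
          exact Real.rpow_le_rpow_of_nonpos hx (by linarith) (by norm_num)
      _ = _ := by rw [← Real.rpow_add hx]; norm_num

theorem norm_sqFst_le {t : ℝ} (h0 : 0 < t) (h1 : t ≤ π) {u : ℂ} (hu : u ∈ cleft t) :
    ‖sqFst u‖ ≤ Real.sin (t / 2) ^ (-(1 / 2) : ℝ) * mdec (1 / 4) ‖u‖ := by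
  have hs := sin_half_pos h0 h1
  have hx := norm_pos_iff.2 hu.1
  have h2 : Real.sin (t / 2) * (1 + ‖u‖) ≤ ‖1 - u‖ := by
    have := norm_sub_ge (u := 1) (v := u) (t := 0) h0 (by simp) (by simpa using hu.2)
    simpa using this
  rw [sqFst, norm_mul, norm_negPow, norm_onePow]
  calc _ ≤ ‖u‖ ^ (1 / 4 : ℝ) * (Real.sin (t / 2) * (1 + ‖u‖)) ^ (-(1 / 2) : ℝ) := by
        gcongr ?_ * ?_
        exact Real.rpow_le_rpow_of_nonpos (by positivity) h2 (by norm_num)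
    _ = Real.sin (t / 2) ^ (-(1 / 2) : ℝ) * (‖u‖ ^ (1 / 4 : ℝ) * (1 + ‖u‖) ^ (-(1 / 2) : ℝ)) := by
      rw [Real.mul_rpow hs.le (by positivity)]; ring
    _ ≤ _ := by
      gcongr
      exact rpow_quarter_le hx

theorem norm_sqSnd_le {t δ : ℝ} (h0 : 0 < δ) (h1 : δ ≤ π) {u e : ℂ} (hu : u ∈ cleft (t + δ))
    (he : ‖e‖ = 1) (het : |e.arg| ≤ t) :
    ‖sqSnd e u‖ ≤ (Real.sin (δ / 2))⁻¹ * mdec (1 / 4) ‖u‖ := by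
  have hs := sin_half_pos h0 h1
  have hx := norm_pos_iff.2 hu.1
  have h2 := norm_sub_ge (u := e) (v := u) h0 het hu.2
  rw [he] at h2
  have h3 : ‖1 - u‖ ≤ 1 + ‖u‖ := (norm_sub_le _ _).trans (by simp)
  rw [sqSnd, norm_mul, norm_mul, norm_negPow, norm_onePow, norm_inv]
  calc _ ≤ ‖u‖ ^ (1 / 4 : ℝ) * (1 + ‖u‖) ^ (1 / 2 : ℝ) *
        (Real.sin (δ / 2) * (1 + ‖u‖))⁻¹ := by gcongr
    _ = (Real.sin (δ / 2))⁻¹ * (‖u‖ ^ (1 / 4 : ℝ) * (1 + ‖u‖) ^ (-(1 / 2) : ℝ)) := by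
      have e1 : (1 + ‖u‖) ^ (-(1 / 2) : ℝ) = (1 + ‖u‖) ^ (1 / 2 : ℝ) * (1 + ‖u‖)⁻¹ := by
        rw [← Real.rpow_neg_one (1 + ‖u‖), ← Real.rpow_add (by positivity)]; norm_num
      rw [e1, mul_inv]; ring
    _ ≤ _ := by
      gcongr
      exact rpow_quarter_le hx

end PowerFunctions

section Discretization

variable {E : Type*} [NormedAddCommGroup E] [NormedSpace ℝ E]

theorem integral_eq_sum_shift {Ψ : ℝ → E} (h : Integrable Ψ) (x : ℝ) (n : ℕ) :
    ∫ t in x..(x + n), Ψ t = ∫ t in (0 : ℝ)..1, ∑ k ∈ Finset.range n, Ψ (t + (x + k)) := by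
  rw [intervalIntegral.integral_finsetSum fun (k : ℕ) _ =>
    (h.comp_add_right (x + k)).intervalIntegrable]
  have := intervalIntegral.sum_integral_adjacent_intervals (f := Ψ) (μ := volume)
    (a := fun k : ℕ => x + k) (n := n) fun k _ => h.intervalIntegrable
  simp only [Nat.cast_zero, add_zero] at this
  rw [← this]
  refine Finset.sum_congr rfl fun k _ => ?_
  rw [intervalIntegral.integral_comp_add_right]
  congr 1
  · ring
  · push_cast; ring

theorem norm_integral_le_of_sum_le {Ψ : ℝ → E} (h : Integrable Ψ) {D : ℝ}
    (hD : ∀ (t : ℝ) (n : ℕ), ‖∑ k ∈ Finset.range n, Ψ (t + k)‖ ≤ D) : ‖∫ t, Ψ t‖ ≤ D := by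
  have h1 : Filter.Tendsto (fun N : ℕ => ∫ t in (-(N : ℝ))..(N : ℝ), Ψ t) Filter.atTop
      (𝓝 (∫ t, Ψ t)) := intervalIntegral_tendsto_integral h
      (Filter.tendsto_neg_atTop_atBot.comp tendsto_natCast_atTop_atTop)
      tendsto_natCast_atTop_atTop
  refine le_of_tendsto h1.norm (Filter.Eventually.of_forall fun N => ?_)
  have e : (N : ℝ) = -(N : ℝ) + ((2 * N : ℕ) : ℝ) := by push_cast; ring
  have e2 := integral_eq_sum_shift h (-(N : ℝ)) (2 * N)
  rw [← e] at e2
  rw [e2]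
  refine (intervalIntegral.norm_integral_le_of_norm_le_const (C := D) fun t _ => ?_).trans
    (by simp)
  simpa only [add_assoc] using hD (t + -(N : ℝ)) (2 * N)

theorem exists_sum_exp_le {σ : ℝ} (hσ : 0 < σ) : ∃ S : ℝ, 0 ≤ S ∧ ∀ (x : ℝ) (n : ℕ),
    ∑ k ∈ Finset.range n, Real.exp (-σ * |x + k|) ≤ S := by
  have hi := integrable_exp_abs hσ
  refine ⟨Real.exp σ * ∫ t : ℝ, Real.exp (-σ * |t|), by positivity, fun x n => ?_⟩
  have h1 : ∑ k ∈ Finset.range n, Real.exp (-σ * |x + k|) ≤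
      ∫ t in (0 : ℝ)..1, ∑ k ∈ Finset.range n, Real.exp σ * Real.exp (-σ * |t + (x + k)|) := by
    have : ∑ k ∈ Finset.range n, Real.exp (-σ * |x + k|) =
        ∫ _ in (0 : ℝ)..1, ∑ k ∈ Finset.range n, Real.exp (-σ * |x + k|) := by simp
    rw [this]
    refine intervalIntegral.integral_mono_on zero_le_one (by simp)
      (Continuous.intervalIntegrable (by fun_prop) _ _) fun t ht => Finset.sum_le_sum fun k _ => ?_
    rw [← Real.exp_add]
    refine Real.exp_le_exp.2 ?_
    have h3 : |t + (x + k)| ≤ 1 + |x + k| :=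
      (abs_add_le _ _).trans (by rw [abs_of_nonneg ht.1]; linarith [ht.2])
    nlinarith
  refine h1.trans ?_
  rw [← integral_eq_sum_shift (hi.const_mul _), ← integral_const_mul,
    intervalIntegral.integral_of_le (by simp)]
  exact setIntegral_le_integral (hi.const_mul _)
    (Filter.Eventually.of_forall fun t => by positivity)

end Discretization

section Randomization

/-- The `i`-th sign of a choice of signs. -/
def sgn {n : ℕ} (s : Fin n → Bool) (i : Fin n) : ℂ := if s i then 1 else -1

theorem norm_sgn {n : ℕ} (s : Fin n → Bool) (i : Fin n) : ‖sgn s i‖ = 1 := by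
  unfold sgn; split_ifs <;> simp

theorem sgn_mul_self {n : ℕ} (s : Fin n → Bool) (i : Fin n) : sgn s i * sgn s i = 1 := by
  unfold sgn; split_ifs <;> simp

theorem sum_sgn_mul {n : ℕ} (i j : Fin n) :
    ∑ s : Fin n → Bool, sgn s i * sgn s j = if i = j then (2 : ℂ) ^ n else 0 := by
  split_ifs with h
  · subst h
    simp [sgn_mul_self]
  · let flip : (Fin n → Bool) → (Fin n → Bool) := fun s => Function.update s i (!s i)
    refine Finset.sum_involution (fun s _ => flip s) ?_ ?_ (by simp) ?_
    · intro s _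
      have h1 : sgn (flip s) i = -sgn s i := by
        unfold sgn flip; cases s i <;> simp
      have h2 : sgn (flip s) j = sgn s j := by
        unfold sgn flip; simp [Function.update_of_ne (Ne.symm h)]
      rw [h1, h2]; ring
    · intro s _ _ h3
      have := congrFun h3 i
      simp [flip] at this
    · intro s _
      simp [flip]

variable {X : Type u} [NormedAddCommGroup X] [NormedSpace ℂ X]

theorem sum_apply_eq_average {n : ℕ} (P : Fin n → X →L[ℂ] X) (y : Fin n → X) :
    (2 : ℂ) ^ n • ∑ k, P k (y k) =
      ∑ s : Fin n → Bool, (∑ j, sgn s j • P j) (∑ k, sgn s k • y k) := by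
  have : ∀ s : Fin n → Bool, (∑ j, sgn s j • P j) (∑ k, sgn s k • y k) =
      ∑ j, ∑ k, (sgn s j * sgn s k) • P j (y k) := by
    intro s
    rw [sum_apply]
    refine Finset.sum_congr rfl fun j _ => ?_
    rw [map_sum]
    refine Finset.sum_congr rfl fun k _ => ?_
    rw [smul_apply, map_smul, smul_smul]
  simp only [this]
  rw [Finset.sum_comm, Finset.smul_sum]
  refine Finset.sum_congr rfl fun j _ => ?_
  rw [Finset.sum_comm]
  simp only [← Finset.sum_smul, sum_sgn_mul, ite_smul, zero_smul, Finset.sum_ite_eq,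
    Finset.mem_univ, if_true]

/-- The randomization estimate behind the operator-valued calculus. -/
theorem norm_sum_mul_mul_le {n : ℕ} {P T Q : Fin n → X →L[ℂ] X} {C1 C2 r : ℝ} (hC1 : 0 ≤ C1)
    (hC2 : 0 ≤ C2) (hr : 0 ≤ r)
    (hP : ∀ s : Fin n → Bool, ‖∑ j, sgn s j • P j‖ ≤ C1)
    (hQ : ∀ s : Fin n → Bool, ‖∑ j, sgn s j • Q j‖ ≤ C2)
    (hT : ∀ y : Fin n → X, ∑ s : Fin n → Bool, ‖∑ i, sgn s i • T i (y i)‖ ^ 2 ≤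
      r ^ 2 * ∑ s : Fin n → Bool, ‖∑ i, sgn s i • y i‖ ^ 2) :
    ‖∑ k, P k * T k * Q k‖ ≤ C1 * r * C2 := by
  refine ContinuousLinearMap.opNorm_le_bound _ (by positivity) fun x => ?_
  set Y : Fin n → X := fun k => T k (Q k x) with hY
  have e : (∑ k, P k * T k * Q k) x = ∑ k, P k (Y k) := by
    simp [hY]
  rw [e]
  have h1 : (2 : ℝ) ^ n * ‖∑ k, P k (Y k)‖ ≤
      C1 * ∑ s : Fin n → Bool, ‖∑ k, sgn s k • Y k‖ := by
    have := congrArg norm (sum_apply_eq_average P Y)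
    rw [norm_smul, norm_pow, Complex.norm_ofNat] at this
    rw [this, Finset.mul_sum]
    refine (norm_sum_le _ _).trans (Finset.sum_le_sum fun s _ => ?_)
    exact ContinuousLinearMap.le_of_opNorm_le _ (hP s) _
  have h2 : (∑ s : Fin n → Bool, ‖∑ k, sgn s k • Y k‖) ^ 2 ≤
      2 ^ n * ∑ s : Fin n → Bool, ‖∑ k, sgn s k • Y k‖ ^ 2 := by
    simpa using sq_sum_le_card_mul_sum_sq (s := (Finset.univ : Finset (Fin n → Bool)))
      (f := fun s => ‖∑ k, sgn s k • Y k‖)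
  have h3 : ∑ s : Fin n → Bool, ‖∑ k, sgn s k • Q k x‖ ^ 2 ≤ 2 ^ n * (C2 * ‖x‖) ^ 2 := by
    calc _ ≤ ∑ _s : Fin n → Bool, (C2 * ‖x‖) ^ 2 := by
          refine Finset.sum_le_sum fun s _ => pow_le_pow_left₀ (norm_nonneg _) ?_ 2
          have := ContinuousLinearMap.le_of_opNorm_le _ (hQ s) x
          simpa [sum_apply] using this
      _ = _ := by simp
  have h4 : (2 ^ n * ‖∑ k, P k (Y k)‖) ^ 2 ≤ (2 ^ n * (C1 * r * C2 * ‖x‖)) ^ 2 := by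
    calc _ ≤ (C1 * ∑ s : Fin n → Bool, ‖∑ k, sgn s k • Y k‖) ^ 2 :=
          pow_le_pow_left₀ (by positivity) h1 2
      _ = C1 ^ 2 * (∑ s : Fin n → Bool, ‖∑ k, sgn s k • Y k‖) ^ 2 := by ring
      _ ≤ C1 ^ 2 * (2 ^ n * (r ^ 2 * (2 ^ n * (C2 * ‖x‖) ^ 2))) := by
        gcongr
        refine h2.trans ?_
        gcongr
        exact (hT fun k => Q k x).trans (by gcongr)
      _ = _ := by ring
  have h5 := (sq_le_sq₀ (by positivity) (by positivity)).1 h4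
  exact le_of_mul_le_mul_left h5 (by positivity)

theorem RBound.sum_le_of_tendsto {C : ℝ} {𝒯 : Set (X →L[ℂ] X)} (h : RBound C 𝒯) {n : ℕ}
    {S : ℝ → Fin n → X →L[ℂ] X} {T : Fin n → X →L[ℂ] X} (hS : ∀ ε > 0, ∀ i, S ε i ∈ 𝒯)
    (hT : ∀ i, Filter.Tendsto (fun ε => S ε i) (𝓝[>] 0) (𝓝 (T i))) (y : Fin n → X) :
    ∑ s : Fin n → Bool, ‖∑ i, sgn s i • T i (y i)‖ ^ 2 ≤
      C ^ 2 * ∑ s : Fin n → Bool, ‖∑ i, sgn s i • y i‖ ^ 2 := by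
  have h1 : Filter.Tendsto (fun ε => ∑ s : Fin n → Bool, ‖∑ i, sgn s i • S ε i (y i)‖ ^ 2)
      (𝓝[>] 0) (𝓝 (∑ s : Fin n → Bool, ‖∑ i, sgn s i • T i (y i)‖ ^ 2)) := by
    refine tendsto_finsetSum _ fun s _ => ((tendsto_finsetSum _ fun i _ => ?_).norm).pow 2
    have := ((ContinuousLinearMap.apply ℂ X (y i)).continuous.tendsto (T i)).comp (hT i)
    exact (this.const_smul (sgn s i))
  refine le_of_tendsto h1 ?_
  filter_upwards [self_mem_nhdsWithin] with ε hε
  exact h n (S ε) y (hS ε hε)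

end Randomization

section InnerIntegral

/-- The class of functions `φ` for which `φ(AB)` is represented by iterated contour integrals. -/
structure IsKW (φ : ℂ → ℂ) (χ M D η : ℝ) : Prop where
  diff : DifferentiableOn ℂ φ (osec χ)
  bdd : ∀ v ∈ osec χ, ‖φ v‖ ≤ M
  decay : ∀ v ∈ osec χ, ‖φ v‖ ≤ D * ‖v‖ ^ (-η)
  M_pos : 0 < M
  D_nonneg : 0 ≤ D
  η_pos : 0 < η
  η_lt : η < 1 / 2

theorem mul_mem_osec {ω τ χ : ℝ} (h : 2 * π - ω - τ < χ) {ζ z : ℂ} (hζ : ζ ∈ cleft ω)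
    (hz : z ∈ cleft τ) : ζ * z ∈ osec χ := by
  refine ⟨mul_ne_zero hζ.1 hz.1, ?_⟩
  have h1 := abs_arg_neg hζ.1
  have h2 := abs_arg_neg hz.1
  have h3 := abs_arg_mul_le (neg_ne_zero.2 hζ.1) (neg_ne_zero.2 hz.1)
  rw [neg_mul_neg] at h3
  have := hζ.2
  have := hz.2
  linarith

theorem norm_mul_rpow_div_le {η K : ℝ} (h0 : 0 < η) (h1 : η < 1) (hK : 0 ≤ K) {x : ℝ}
    (hx : 0 < x) : x * (x ^ (-η) * (K / (1 + x))) ≤ 2 * K * mdec (min η (1 - η)) x := by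
  calc x * (x ^ (-η) * (K / (1 + x))) = K * ((x ^ (-η) * x) / (1 + x)) := by ring
    _ = K * (x ^ (1 - η) / (1 + x)) := by
      rw [← Real.rpow_add_one hx.ne']; ring_nf
    _ ≤ K * (2 * mdec (min η (1 - η)) x) := by
      gcongr
      exact rpow_div_one_add_le h0 h1 hx
    _ = _ := by ring

theorem continuousOn_cint {E : Type*} [NormedAddCommGroup E] [NormedSpace ℂ E] {t ν C : ℝ}
    (h0 : 0 ≤ t) (h1 : t < π) (hν : 0 < ν) {S : Set ℂ} {g : ℂ → ℂ → E}
    (hc : ContinuousOn (Function.uncurry g) (S ×ˢ rays t))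
    (hb : ∀ ζ ∈ S, ∀ z ∈ rays t, ‖z‖ * ‖g ζ z‖ ≤ C * mdec ν ‖z‖) :
    ContinuousOn (fun ζ => cint t (g ζ)) S := by
  have hg : ∀ ζ ∈ S, ContinuousOn (g ζ) (rays t) := fun ζ hζ =>
    hc.comp (f := fun z => (ζ, z)) (by fun_prop) fun z hz => ⟨hζ, hz⟩
  refine continuousOn_of_dominated (bound := fun p : Bool × ℝ => C * Real.exp (-ν * |p.2|))
    (fun ζ hζ => (ctrIntegrable_of_bound h0 h1 hν (hg ζ hζ) (hb ζ hζ)).aestronglyMeasurable)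
    (fun ζ hζ => ae_of_all _ fun p => ?_) ((integrable_ctr_exp hν).const_mul C)
    (ae_of_all _ fun p => ?_)
  · have := hb ζ hζ _ (ctrPt_mem_rays h0 h1 p)
    rw [norm_ctrPt, mdec_exp] at this
    rw [norm_smul]
    refine le_trans ?_ this
    gcongr
    exact (norm_ctrWt_le t p).trans_eq (norm_ctrPt t p)
  · exact continuousOn_const.smul (hc.comp (f := fun ζ => (ζ, ctrPt t p)) (by fun_prop)
      fun ζ hζ => ⟨hζ, ctrPt_mem_rays h0 h1 p⟩)

variable {𝔸 : Type*} [NormedRing 𝔸] [NormedAlgebra ℂ 𝔸]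

/-- The inner integral representing `φ(ζB)`. -/
def innerInt (φ : ℂ → ℂ) (b : ℂ → 𝔸) (τ : ℝ) (ζ : ℂ) : 𝔸 := cint τ fun z => φ (ζ * z) • b z

namespace IsKW

variable {φ : ℂ → ℂ} {χ M D η : ℝ} {b : ℂ → 𝔸} {tb KB : ℝ} {ω τ : ℝ}

theorem norm_le (hφ : IsKW φ χ M D η) (hχ : 2 * π - ω - τ < χ) {ζ z : ℂ} (hζ : ζ ∈ cleft ω)
    (hz : z ∈ cleft τ) : ‖φ (ζ * z)‖ ≤ D * (‖ζ‖ ^ (-η) * ‖z‖ ^ (-η)) := by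
  refine (hφ.decay _ (mul_mem_osec hχ hζ hz)).trans_eq ?_
  rw [norm_mul, Real.mul_rpow (norm_nonneg _) (norm_nonneg _)]

theorem continuousOn_mul (hφ : IsKW φ χ M D η) (hχ : 2 * π - ω - τ < χ) :
    ContinuousOn (fun p : ℂ × ℂ => φ (p.1 * p.2)) (cleft ω ×ˢ cleft τ) :=
  hφ.diff.continuousOn.comp (by fun_prop) fun _ hp => mul_mem_osec hχ hp.1 hp.2

theorem innerInt_bound (hφ : IsKW φ χ M D η) (hχ : 2 * π - ω - τ < χ) (hb : IsPRes b tb KB)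
    (hτ0 : 0 < τ) (hτb : τ ≤ tb) {ζ : ℂ} (hζ : ζ ∈ cleft ω) {z : ℂ}
    (hz : z ∈ rays τ) : ‖z‖ * ‖φ (ζ * z) • b z‖ ≤
      (‖ζ‖ ^ (-η) * (D * (2 * KB))) * mdec η ‖z‖ := by
  have hz' := norm_pos_iff.2 hz.1
  have hK := hb.nonneg (hτ0.le.trans hτb)
  have hη := hφ.η_pos
  have hη2 := hφ.η_lt
  have hD := hφ.D_nonneg
  rw [norm_smul]
  have h1 := norm_mul_rpow_div_le hη (by linarith) hK hz'
  rw [min_eq_left (by linarith)] at h1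
  calc _ ≤ ‖z‖ * ((D * (‖ζ‖ ^ (-η) * ‖z‖ ^ (-η))) * (KB / (1 + ‖z‖))) := by
        gcongr
        · exact hφ.norm_le hχ hζ (rays_subset_cleft _ hz)
        · exact hb.norm_le (hz.2.le.trans hτb)
    _ = ‖ζ‖ ^ (-η) * D * (‖z‖ * (‖z‖ ^ (-η) * (KB / (1 + ‖z‖)))) := by ring
    _ ≤ ‖ζ‖ ^ (-η) * D * (2 * KB * mdec η ‖z‖) := by gcongr
    _ = _ := by ring

theorem norm_innerInt_le (hφ : IsKW φ χ M D η) (hχ : 2 * π - ω - τ < χ) (hb : IsPRes b tb KB)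
    (hτ0 : 0 < τ) (hτπ : τ < π) (hτb : τ ≤ tb) {ζ : ℂ} (hζ : ζ ∈ cleft ω) :
    ‖innerInt φ b τ ζ‖ ≤ (D * (2 * KB) * mdecMass η) * ‖ζ‖ ^ (-η) := by
  refine (norm_cint_le hτ0.le hτπ hφ.η_pos fun z hz =>
    hφ.innerInt_bound hχ hb hτ0 hτb hζ hz).trans_eq ?_
  ring

theorem ctrIntegrable_innerInt (hφ : IsKW φ χ M D η) (hχ : 2 * π - ω - τ < χ)
    (hb : IsPRes b tb KB) (hτ0 : 0 < τ) (hτπ : τ < π) (hτb : τ ≤ tb) {ζ : ℂ} (hζ : ζ ∈ cleft ω) :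
    CtrIntegrable τ fun z => φ (ζ * z) • b z :=
  ctrIntegrable_of_bound hτ0.le hτπ hφ.η_pos
    (((hφ.continuousOn_mul hχ).comp (f := fun z => (ζ, z)) (by fun_prop)
      fun _ hz => ⟨hζ, rays_subset_cleft _ hz⟩).smul (hb.continuousOn_rays hτb))
    fun _ hz => hφ.innerInt_bound hχ hb hτ0 hτb hζ hz

theorem continuousOn_innerInt (hφ : IsKW φ χ M D η) (hχ : 2 * π - ω - τ < χ)
    (hb : IsPRes b tb KB) (hτ0 : 0 < τ) (hτπ : τ < π) (hτb : τ ≤ tb) :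
    ContinuousOn (innerInt φ b τ) (cleft ω) := by
  have hr : ∀ p : ℝ, ContinuousOn (fun ζ : ℂ => ((‖ζ‖ ^ p : ℝ) : ℂ)) (cleft ω) := fun p =>
    Complex.continuous_ofReal.comp_continuousOn
      (continuous_norm.continuousOn.rpow_const fun ζ hζ => Or.inl (norm_ne_zero_iff.2 hζ.1))
  have h1 : ContinuousOn (fun ζ => cint τ fun z => ((‖ζ‖ ^ η : ℝ) : ℂ) • φ (ζ * z) • b z)
      (cleft ω) := by
    refine continuousOn_cint hτ0.le hτπ hφ.η_pos (C := D * (2 * KB)) ?_ fun ζ hζ z hz => ?_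
    · exact ((hr η).comp continuousOn_fst fun p hp => hp.1).smul
        (((hφ.continuousOn_mul hχ).mono (prod_mono le_rfl (rays_subset_cleft τ))).smul
          ((hb.continuousOn_rays hτb).comp continuousOn_snd fun p hp => hp.2))
    · have hζ' := norm_pos_iff.2 hζ.1
      have := hφ.innerInt_bound hχ hb hτ0 hτb hζ hz
      rw [norm_smul, Complex.norm_real, Real.norm_of_nonneg (by positivity)]
      calc _ = ‖ζ‖ ^ η * (‖z‖ * ‖φ (ζ * z) • b z‖) := by ring
        _ ≤ ‖ζ‖ ^ η * ((‖ζ‖ ^ (-η) * (D * (2 * KB))) * mdec η ‖z‖) := by gcongr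
        _ = (‖ζ‖ ^ η * ‖ζ‖ ^ (-η)) * (D * (2 * KB) * mdec η ‖z‖) := by ring
        _ = _ := by rw [← Real.rpow_add hζ']; simp
  refine ((hr (-η)).smul h1).congr fun ζ hζ => ?_
  have hζ' := norm_pos_iff.2 hζ.1
  show innerInt φ b τ ζ =
    ((‖ζ‖ ^ (-η) : ℝ) : ℂ) • cint τ fun z => ((‖ζ‖ ^ η : ℝ) : ℂ) • φ (ζ * z) • b z
  rw [cint_smul, smul_smul, ← Complex.ofReal_mul, ← Real.rpow_add hζ']
  simp [innerInt]

variable [CompleteSpace 𝔸]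

/-- Cauchy's formula for the inner integral, weighted by a square root. -/
theorem cauchy_innerInt (hφ : IsKW φ χ M D η) (hχ : 2 * π - ω - τ < χ) (hb : IsPRes b tb KB)
    (hτ0 : 0 < τ) (hτπ : τ < π) (hτb : τ ≤ tb) (hω0 : 0 < ω) (hωπ : ω < π) {w : ℂ}
    (hw : w ∈ oleft ω) :
    cint ω (fun ζ => ((ζ - w)⁻¹ * negPow (-(1 / 2)) ζ) • innerInt φ b τ ζ) =
      negPow (-(1 / 2)) w • innerInt φ b τ w := by
  have hη := hφ.η_pos
  have hη2 := hφ.η_lt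
  have hD := hφ.D_nonneg
  have hK := hb.nonneg (hτ0.le.trans hτb)
  have hw' := norm_pos_iff.2 hw.1
  obtain ⟨κ0, hκ0, hκ⟩ := exists_norm_sub_ge_rays ω w hw.2.ne'
  have hn0 : ContinuousOn (negPow (-(1 / 2))) (cleft ω) :=
    (differentiableOn_negPow _).continuousOn.mono (cleft_subset_oleft hω0)
  simp only [innerInt, ← cint_smul]
  have hpow : ∀ x : ℝ, 0 < x → x ^ (-(1 / 2) : ℝ) * x ^ (-η) = x ^ (-(1 / 2 + η)) :=
    fun x hx => by rw [← Real.rpow_add hx]; congr 1; ring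
  rw [cint_swap (ν := min η (1 / 2 - η)) (C := D * (2 * KB) / κ0 * (1 + 1 / ‖w‖)) hω0.le hωπ
    hτ0.le hτπ (lt_min hη (by linarith))]
  · refine cint_congr hτ0.le hτπ fun z hz => ?_
    have hf1 : ContinuousOn (fun ζ => negPow (-(1 / 2)) ζ * φ (ζ * z)) (cleft ω) :=
      hn0.mul ((hφ.continuousOn_mul hχ).comp (f := fun ζ => (ζ, z)) (by fun_prop)
        fun _ hζ => ⟨hζ, rays_subset_cleft _ hz⟩)
    have hf2 : DifferentiableOn ℂ (fun ζ => negPow (-(1 / 2)) ζ * φ (ζ * z)) (oleft ω) :=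
      ((differentiableOn_negPow _).mono (oleft_anti hω0.le)).mul
        (hφ.diff.comp (f := fun ζ => ζ * z) (by fun_prop) fun _ hζ =>
          mul_mem_osec hχ (oleft_subset_cleft _ hζ) (rays_subset_cleft _ hz))
    have hf3 : ∀ ζ ∈ cleft ω, ‖negPow (-(1 / 2)) ζ * φ (ζ * z)‖ ≤ M * ‖ζ‖ ^ (-(1 / 2) : ℝ) := by
      intro ζ hζ
      rw [norm_mul, norm_negPow, mul_comm]
      gcongr
      exact hφ.bdd _ (mul_mem_osec hχ hζ (rays_subset_cleft _ hz))
    have hi := ctrIntegrable_pole hω0.le hωπ (by norm_num) (by norm_num)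
      (hf1.mono (rays_subset_cleft ω)) (fun ζ hζ => hf3 ζ (rays_subset_cleft ω hζ)) hw.1 hw.2.ne'
    have e := cint_clm ((ContinuousLinearMap.id ℂ ℂ).smulRight (b z)) hi
    rw [cauchy_oleft hω0 hωπ (by norm_num) (by norm_num) hf1 hf2 hf3 hw] at e
    simp only [ContinuousLinearMap.smulRight_apply, ContinuousLinearMap.id_apply] at e
    rw [smul_smul, ← e]
    refine cint_congr hω0.le hωπ fun ζ _ => ?_
    rw [smul_smul, smul_eq_mul, mul_assoc]
  · refine ContinuousOn.smul (ContinuousOn.mul (ContinuousOn.inv₀ (by fun_prop) fun p hp =>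
      ne_of_mem_rays hp.1 hw.2.ne') (hn0.comp continuousOn_fst fun p hp =>
      rays_subset_cleft _ hp.1)) (((hφ.continuousOn_mul hχ).mono (prod_mono
      (rays_subset_cleft ω) (rays_subset_cleft τ))).smul
      ((hb.continuousOn_rays hτb).comp continuousOn_snd fun p hp => hp.2))
  · intro ζ hζ z hz
    have hζ' := norm_pos_iff.2 hζ.1
    have hz' := norm_pos_iff.2 hz.1
    have h1 : ‖negPow (-(1 / 2)) ζ * φ (ζ * z)‖ ≤
        (D * ‖z‖ ^ (-η)) * ‖ζ‖ ^ (-(1 / 2 + η)) := by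
      rw [norm_mul, norm_negPow, ← hpow _ hζ']
      calc _ ≤ ‖ζ‖ ^ (-(1 / 2) : ℝ) * (D * (‖ζ‖ ^ (-η) * ‖z‖ ^ (-η))) := by
            gcongr
            exact hφ.norm_le hχ (rays_subset_cleft _ hζ) (rays_subset_cleft _ hz)
        _ = _ := by ring
    have h2 := norm_pole_le hκ0 (by linarith) (by linarith) hw.1 hζ.1 h1 (hκ ζ hζ)
    rw [min_eq_right (by linarith), show 1 - (1 / 2 + η) = 1 / 2 - η by ring] at h2
    have h3 := norm_mul_rpow_div_le hη (by linarith) hK hz'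
    rw [min_eq_left (by linarith)] at h3
    have h4 := hb.norm_le (hz.2.le.trans hτb)
    calc ‖ζ‖ * ‖z‖ * ‖((ζ - w)⁻¹ * negPow (-(1 / 2)) ζ) • φ (ζ * z) • b z‖
        = (‖ζ‖ * ‖(ζ - w)⁻¹ • (negPow (-(1 / 2)) ζ * φ (ζ * z))‖) * (‖z‖ * ‖b z‖) := by
          simp only [norm_smul, norm_mul]; ring
      _ ≤ ((D * ‖z‖ ^ (-η)) / κ0 * (1 + 1 / ‖w‖) * mdec (1 / 2 - η) ‖ζ‖) *
          (‖z‖ * (KB / (1 + ‖z‖))) := by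
        gcongr
        exact (mul_nonneg (norm_nonneg _) (norm_nonneg _)).trans h2
      _ = D / κ0 * (1 + 1 / ‖w‖) * (mdec (1 / 2 - η) ‖ζ‖ *
          (‖z‖ * (‖z‖ ^ (-η) * (KB / (1 + ‖z‖))))) := by ring
      _ ≤ D / κ0 * (1 + 1 / ‖w‖) * (mdec (min η (1 / 2 - η)) ‖ζ‖ *
          (2 * KB * mdec (min η (1 / 2 - η)) ‖z‖)) := by
        have h5 := h3.trans (mul_le_mul_of_nonneg_left
          (mdec_anti (min_le_left η (1 / 2 - η))) (by positivity : 0 ≤ 2 * KB))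
        exact mul_le_mul_of_nonneg_left (mul_le_mul (mdec_anti (min_le_right _ _)) h5
          (by positivity) (mdec_nonneg _ _)) (by positivity)
      _ = _ := by ring

end IsKW

end InnerIntegral

section OuterIntegral

variable {𝔸 : Type*} [NormedRing 𝔸] [NormedAlgebra ℂ 𝔸]

theorem norm_sub_inv_le {ω δ : ℝ} (hδ : 0 < δ) (hδπ : δ ≤ π) {ζ w : ℂ} (hζ : ζ ≠ 0)
    (hζω : |ζ.arg| ≤ ω) (hw : ω + δ ≤ |w.arg|) :
    ‖(ζ - w)⁻¹‖ ≤ (Real.sin (δ / 2))⁻¹ * (‖ζ‖ + ‖w‖)⁻¹ := by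
  have hs := sin_half_pos hδ hδπ
  have hz := norm_pos_iff.2 hζ
  rw [norm_inv, ← mul_inv]
  exact inv_anti₀ (by positivity) (norm_sub_ge hδ hζω hw)

theorem norm_negPow_half_mul_le {ω δ : ℝ} (hδ : 0 < δ) (hδπ : δ ≤ π) {ζ w : ℂ} (hζ : ζ ≠ 0)
    (hζω : |ζ.arg| ≤ ω) (hw0 : w ≠ 0) (hw : ω + δ ≤ |w.arg|) :
    ‖negPow (1 / 2) w * (ζ - w)⁻¹‖ ≤ (Real.sin (δ / 2))⁻¹ * ‖w‖ ^ (-(1 / 2) : ℝ) := by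
  have hs := sin_half_pos hδ hδπ
  have hz := norm_pos_iff.2 hζ
  have hw' := norm_pos_iff.2 hw0
  rw [norm_mul, norm_negPow]
  calc _ ≤ ‖w‖ ^ (1 / 2 : ℝ) * ((Real.sin (δ / 2))⁻¹ * (‖ζ‖ + ‖w‖)⁻¹) := by
        gcongr; exact norm_sub_inv_le hδ hδπ hζ hζω hw
    _ ≤ ‖w‖ ^ (1 / 2 : ℝ) * ((Real.sin (δ / 2))⁻¹ * ‖w‖⁻¹) := by
        gcongr; linarith
    _ = _ := by
      rw [show (-(1 / 2) : ℝ) = 1 / 2 - 1 by norm_num, Real.rpow_sub_one hw'.ne']; ring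

theorem ctrIntegrable_half {a : ℂ → 𝔸} {ta KA ω δ : ℝ} (ha : IsPRes a ta KA) (hω : 0 < ω)
    (hδ : 0 < δ) (hta : ω + δ ≤ ta) (hπ : ω + δ < π) {ζ : ℂ} (hζ : ζ ≠ 0) (hζω : |ζ.arg| ≤ ω) :
    CtrIntegrable (ω + δ) fun w => (negPow (1 / 2) w * (ζ - w)⁻¹) • a w := by
  refine ctrIntegrable_smul (by linarith) hπ (κ := 1 / 2) (by norm_num) (by norm_num)
    (C := (Real.sin (δ / 2))⁻¹) (K := KA) ?_ (fun w hw =>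
      norm_negPow_half_mul_le hδ (by linarith) hζ hζω hw.1 hw.2.ge)
    (ha.continuousOn_rays hta) fun w hw => ha.norm_le (hw.2.le.trans hta)
  refine ((differentiableOn_negPow _).continuousOn.mono fun w hw => ⟨hw.1, ?_⟩).mul
    (ContinuousOn.inv₀ (by fun_prop) fun w hw h => ?_)
  · rw [hw.2]; linarith
  · rw [sub_eq_zero.1 h, hw.2] at hζω; linarith

theorem outer_kernel_le {η x y : ℝ} (h0 : 0 < η) (h1 : η < 1 / 2) (hx : 0 < x) (hy : 0 < y) :
    x * y * ((x + y)⁻¹ * x ^ (-(1 / 2) : ℝ) * y ^ (1 / 2 : ℝ) * (x ^ (-η) * (1 + y)⁻¹)) ≤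
      4 * (mdec (min η (1 / 2 - η) / 2) x * mdec (min η (1 / 2 - η) / 2) y) := by
  have hν : 0 < min η (1 / 2 - η) := lt_min h0 (by linarith)
  have e1 := homogeneous_kernel_le (κ := 1 / 2 + η) (by linarith) (by linarith) hx hy
  have e2 := rpow_div_one_add_le h0 (by linarith) hy
  rw [min_eq_right (by linarith), show 1 - (1 / 2 + η) = 1 / 2 - η by ring] at e1
  rw [min_eq_left (by linarith)] at e2
  have e3 : x ^ (1 / 2 - η) = x * x ^ (-(1 / 2) : ℝ) * x ^ (-η) := by
    rw [← Real.rpow_one_add' hx.le (by norm_num), ← Real.rpow_add hx]; congr 1; ring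
  have e4 : y ^ (1 / 2 + η) * y ^ (1 - η) = y * y ^ (1 / 2 : ℝ) := by
    rw [← Real.rpow_add hy, ← Real.rpow_one_add' hy.le (by norm_num)]; congr 1; ring
  calc _ = (x * x ^ (-(1 / 2) : ℝ) * x ^ (-η)) * (y * y ^ (1 / 2 : ℝ)) * (x + y)⁻¹ *
        (1 + y)⁻¹ := by ring
    _ = (x ^ (1 / 2 - η) * y ^ (1 / 2 + η) / (x + y)) * (y ^ (1 - η) / (1 + y)) := by
      rw [← e3, ← e4]; ring
    _ ≤ (2 * mdec (min η (1 / 2 - η)) (x / y)) * (2 * mdec (min η (1 / 2 - η)) y) :=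
      mul_le_mul (e1.trans (mul_le_mul_of_nonneg_left (mdec_anti (min_le_right _ _)) zero_le_two))
        (e2.trans (mul_le_mul_of_nonneg_left (mdec_anti (min_le_left _ _)) zero_le_two))
        (by positivity) (mul_nonneg zero_le_two (mdec_nonneg _ _))
    _ = 4 * (mdec (min η (1 / 2 - η)) (x / y) * mdec (min η (1 / 2 - η)) y) := by ring
    _ ≤ _ := mul_le_mul_of_nonneg_left (mdec_mul_le_half hν.le hx hy) (by norm_num)

/-- The iterated contour integral representing `φ(AB)`. -/
def kwInt (φ : ℂ → ℂ) (a b : ℂ → 𝔸) (t τ : ℝ) : 𝔸 := cint t fun w => innerInt φ b τ w * a w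

variable {φ : ℂ → ℂ} {χ M D η : ℝ} {a b : ℂ → 𝔸} {ta tb KA KB : ℝ} {ω τ δ : ℝ}

variable [CompleteSpace 𝔸] in
theorem IsKW.kwInt_eq (hφ : IsKW φ χ M D η) (hχ : 2 * π - ω - τ < χ) (hb : IsPRes b tb KB)
    (hτ0 : 0 < τ) (hτπ : τ < π) (hτb : τ ≤ tb) (ha : IsPRes a ta KA) (hω : 0 < ω)
    (hδ : 0 < δ) (hta : ω + δ ≤ ta) (hπ : ω + δ < π) :
    (CtrIntegrable ω fun ζ => negPow (-(1 / 2)) ζ • (innerInt φ b τ ζ *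
      cint (ω + δ) fun w => (negPow (1 / 2) w * (ζ - w)⁻¹) • a w)) ∧
    kwInt φ a b (ω + δ) τ = cint ω fun ζ => negPow (-(1 / 2)) ζ • (innerInt φ b τ ζ *
      cint (ω + δ) fun w => (negPow (1 / 2) w * (ζ - w)⁻¹) • a w) := by
  have hη := hφ.η_pos
  have hη2 := hφ.η_lt
  have hD := hφ.D_nonneg
  have hKB := hb.nonneg (hτ0.le.trans hτb)
  have hKA := ha.nonneg ((by linarith : 0 ≤ ω + δ).trans hta)
  have hωδ : 0 < ω + δ := by linarith
  have hωπ : ω < π := by linarith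
  have hs := sin_half_pos hδ (by linarith)
  have hm := mdecMass_nonneg η
  set CΦ := D * (2 * KB) * mdecMass η with hCΦ
  have hΦc := hφ.continuousOn_innerInt hχ hb hτ0 hτπ hτb
  have hΦ : ∀ ζ ∈ cleft ω, ‖innerInt φ b τ ζ‖ ≤ CΦ * ‖ζ‖ ^ (-η) := fun ζ hζ =>
    hφ.norm_innerInt_le hχ hb hτ0 hτπ hτb hζ
  have hnp : ∀ p, ContinuousOn (negPow p) (cleft ω) := fun p =>
    (differentiableOn_negPow _).continuousOn.mono (cleft_subset_oleft hω)
  set G : ℂ → ℂ → 𝔸 := fun ζ w =>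
    ((ζ - w)⁻¹ * negPow (-(1 / 2)) ζ * negPow (1 / 2) w) • (innerInt φ b τ ζ * a w) with hG
  have hsub : rays (ω + δ) ⊆ cleft ω := fun w hw => ⟨hw.1, by rw [hw.2]; linarith⟩
  have hGc : ContinuousOn (Function.uncurry G) (rays ω ×ˢ rays (ω + δ)) := by
    refine ContinuousOn.smul (ContinuousOn.mul (ContinuousOn.mul (ContinuousOn.inv₀ (by fun_prop)
      fun p hp => ne_of_mem_rays hp.1 (by rw [hp.2.2]; linarith))
      ((hnp _).comp continuousOn_fst fun p hp => rays_subset_cleft _ hp.1))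
      ((hnp _).comp continuousOn_snd fun p hp => hsub hp.2)) (ContinuousOn.mul
      (hΦc.comp continuousOn_fst fun p hp => rays_subset_cleft _ hp.1)
      ((ha.continuousOn_rays hta).comp continuousOn_snd fun p hp => hp.2))
  have hGb : ∀ ζ ∈ rays ω, ∀ w ∈ rays (ω + δ), ‖ζ‖ * ‖w‖ * ‖G ζ w‖ ≤
      (4 * ((Real.sin (δ / 2))⁻¹ * CΦ * KA)) *
        (mdec (min η (1 / 2 - η) / 2) ‖ζ‖ * mdec (min η (1 / 2 - η) / 2) ‖w‖) := by
    intro ζ hζ w hw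
    have hζ' := norm_pos_iff.2 hζ.1
    have hw' := norm_pos_iff.2 hw.1
    have h1 := norm_sub_inv_le hδ (by linarith) hζ.1 hζ.2.le hw.2.ge
    have h2 := hΦ ζ (rays_subset_cleft _ hζ)
    have h3 := ha.norm_le (hw.2.le.trans hta)
    rw [hG]
    simp only [norm_smul, norm_mul, norm_negPow]
    calc _ ≤ ‖ζ‖ * ‖w‖ * ((Real.sin (δ / 2))⁻¹ * (‖ζ‖ + ‖w‖)⁻¹ * ‖ζ‖ ^ (-(1 / 2) : ℝ) *
          ‖w‖ ^ (1 / 2 : ℝ) * (CΦ * ‖ζ‖ ^ (-η) * (KA / (1 + ‖w‖)))) := by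
          gcongr
          exact (norm_mul_le _ _).trans (by gcongr)
      _ = ((Real.sin (δ / 2))⁻¹ * CΦ * KA) * (‖ζ‖ * ‖w‖ * ((‖ζ‖ + ‖w‖)⁻¹ *
          ‖ζ‖ ^ (-(1 / 2) : ℝ) * ‖w‖ ^ (1 / 2 : ℝ) * (‖ζ‖ ^ (-η) * (1 + ‖w‖)⁻¹))) := by ring
      _ ≤ ((Real.sin (δ / 2))⁻¹ * CΦ * KA) *
          (4 * (mdec (min η (1 / 2 - η) / 2) ‖ζ‖ * mdec (min η (1 / 2 - η) / 2) ‖w‖)) := by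
        exact mul_le_mul_of_nonneg_left (outer_kernel_le hη hη2 hζ' hw') (by positivity)
      _ = _ := by ring
  have hν : 0 < min η (1 / 2 - η) / 2 := half_pos (lt_min hη (by linarith))
  have hinner : ∀ ζ ∈ rays ω, cint (ω + δ) (G ζ) = negPow (-(1 / 2)) ζ • (innerInt φ b τ ζ *
      cint (ω + δ) fun w => (negPow (1 / 2) w * (ζ - w)⁻¹) • a w) := by
    intro ζ hζ
    have h1 := ctrIntegrable_half ha hω hδ hta hπ hζ.1 hζ.2.le
    have h2 := cint_clm (negPow (-(1 / 2)) ζ • ContinuousLinearMap.mul ℂ 𝔸 (innerInt φ b τ ζ)) h1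
    simp only [smul_apply, ContinuousLinearMap.mul_apply'] at h2
    rw [← h2]
    refine cint_congr hωδ.le hπ fun w _ => ?_
    simp only [hG, mul_smul_comm, smul_smul]
    congr 1; ring
  refine ⟨(ctrIntegrable_cint hω.le hωπ hωδ.le hπ hν hGc hGb).congr hω.le hωπ hinner, ?_⟩
  rw [← cint_congr hω.le hωπ hinner, cint_swap hω.le hωπ hωδ.le hπ hν hGc hGb, kwInt]
  refine cint_congr hωδ.le hπ fun w hw => ?_
  have hwω : w ∈ oleft ω := ⟨hw.1, by rw [hw.2]; linarith⟩
  have h1 : CtrIntegrable ω fun ζ => (ζ - w)⁻¹ • negPow (-(1 / 2)) ζ • innerInt φ b τ ζ := by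
    refine ctrIntegrable_pole hω.le hωπ (κ := 1 / 2 + η) (C := CΦ) (by linarith) (by linarith)
      (((hnp _).smul hΦc).mono (rays_subset_cleft ω)) (fun ζ hζ => ?_) hw.1 hwω.2.ne'
    rw [Pi.smul_apply', norm_smul, norm_negPow]
    have hζ' := norm_pos_iff.2 hζ.1
    calc _ ≤ ‖ζ‖ ^ (-(1 / 2) : ℝ) * (CΦ * ‖ζ‖ ^ (-η)) := by
          gcongr; exact hΦ _ (rays_subset_cleft _ hζ)
      _ = CΦ * (‖ζ‖ ^ (-(1 / 2) : ℝ) * ‖ζ‖ ^ (-η)) := by ring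
      _ = _ := by rw [← Real.rpow_add hζ']; congr 2; ring
  have h2 := cint_clm (negPow (1 / 2) w • (ContinuousLinearMap.mul ℂ 𝔸).flip (a w)) h1
  simp only [smul_apply, ContinuousLinearMap.flip_apply, ContinuousLinearMap.mul_apply',
    smul_smul] at h2
  rw [hφ.cauchy_innerInt hχ hb hτ0 hτπ hτb hω hωπ hwω, smul_mul_assoc, smul_smul,
    negPow_add hw.1, add_neg_cancel, negPow_zero, one_smul] at h2
  rw [← h2]
  refine cint_congr hω.le hωπ fun ζ _ => ?_
  simp only [hG, smul_mul_assoc, smul_smul]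
  congr 1; ring

end OuterIntegral

section Profile

theorem mdec_le_rpow {ν x : ℝ} (hν : 0 ≤ ν) (hx : 0 < x) : mdec ν x ≤ x ^ (-ν) := by
  rcases le_total x 1 with h | h
  · rw [mdec_of_le_one hx h]
    exact Real.rpow_le_rpow_of_exponent_ge hx h (by linarith)
  · rw [mdec_of_one_le h]

theorem mdec_exp_neg_mul (ν s : ℝ) {x : ℝ} (hx : 0 < x) :
    mdec ν (Real.exp (-s) * x) = Real.exp (-ν * |s - Real.log x|) := by
  rw [mdec, Real.log_mul (Real.exp_pos _).ne' hx.ne', Real.log_exp, abs_sub_comm]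
  congr 3; ring

theorem arg_exp_real_mul (s : ℝ) (w : ℂ) : ((Real.exp s : ℂ) * w).arg = w.arg :=
  Complex.arg_real_mul _ (Real.exp_pos s)

theorem exp_real_mul_mem_oleft {t : ℝ} (s : ℝ) {w : ℂ} (hw : w ∈ oleft t) :
    (Real.exp s : ℂ) * w ∈ oleft t :=
  ⟨mul_ne_zero (by exact_mod_cast (Real.exp_pos s).ne') hw.1, by rw [arg_exp_real_mul]; exact hw.2⟩

theorem exp_real_mul_mem_cleft {t : ℝ} (s : ℝ) {w : ℂ} (hw : w ∈ cleft t) :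
    (Real.exp s : ℂ) * w ∈ cleft t :=
  ⟨mul_ne_zero (by exact_mod_cast (Real.exp_pos s).ne') hw.1, by rw [arg_exp_real_mul]; exact hw.2⟩

theorem norm_exp_real_mul (s : ℝ) (w : ℂ) : ‖(Real.exp s : ℂ) * w‖ = Real.exp s * ‖w‖ := by
  rw [norm_mul, Complex.norm_real, Real.norm_of_nonneg (Real.exp_pos s).le]

/-- A profile: a holomorphic function off a sector decaying at `0` and at `∞`. -/
structure IsProfile (H : ℂ → ℂ) (t0 t1 C : ℝ) : Prop where
  pos : 0 ≤ t0
  lt : t0 < t1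
  diff : DifferentiableOn ℂ H (oleft t0)
  bound : ∀ u ∈ cleft t1, ‖H u‖ ≤ C * mdec (1 / 4) ‖u‖
  nonneg : 0 ≤ C

/-- The dilated operators `H(e^{-s}A)`. -/
def dilInt {E : Type*} [NormedAddCommGroup E] [NormedSpace ℂ E] (a : ℂ → E) (H : ℂ → ℂ)
    (t s : ℝ) : E := cint t fun w => H ((Real.exp (-s) : ℂ) * w) • a w

namespace IsProfile

variable {H : ℂ → ℂ} {t0 t1 C : ℝ}

theorem mono (h : IsProfile H t0 t1 C) {t : ℝ} (ht : t1 ≤ t) : IsProfile H t0 t C :=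
  ⟨h.pos, h.lt.trans_le ht, h.diff, fun u hu => h.bound u (cleft_anti ht hu), h.nonneg⟩

theorem differentiableOn (h : IsProfile H t0 t1 C) (s : ℝ) :
    DifferentiableOn ℂ (fun w => H ((Real.exp (-s) : ℂ) * w)) (oleft t0) :=
  h.diff.comp (f := fun w => (Real.exp (-s) : ℂ) * w) (by fun_prop)
    fun _ hw => exp_real_mul_mem_oleft _ hw

theorem continuousOn (h : IsProfile H t0 t1 C) (s : ℝ) :
    ContinuousOn (fun w => H ((Real.exp (-s) : ℂ) * w)) (cleft t1) :=
  (h.differentiableOn s).continuousOn.mono (cleft_subset_oleft h.lt)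

theorem norm_le (h : IsProfile H t0 t1 C) (s : ℝ) {w : ℂ} (hw : w ∈ cleft t1) :
    ‖H ((Real.exp (-s) : ℂ) * w)‖ ≤ C * Real.exp (-(1 / 4) * |s - Real.log ‖w‖|) := by
  refine (h.bound _ (exp_real_mul_mem_cleft _ hw)).trans_eq ?_
  rw [norm_exp_real_mul, mdec_exp_neg_mul _ _ (norm_pos_iff.2 hw.1)]

theorem norm_le_const (h : IsProfile H t0 t1 C) (s : ℝ) {w : ℂ} (hw : w ∈ cleft t1) :
    ‖H ((Real.exp (-s) : ℂ) * w)‖ ≤ C := by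
  refine (h.norm_le s hw).trans (mul_le_of_le_one_right h.nonneg (Real.exp_le_one_iff.2 ?_))
  nlinarith [abs_nonneg (s - Real.log ‖w‖)]

theorem norm_le_mdec (h : IsProfile H t0 t1 C) (s : ℝ) {w : ℂ} (hw : w ∈ cleft t1) :
    ‖H ((Real.exp (-s) : ℂ) * w)‖ ≤ C * Real.exp (|s| / 4) * mdec (1 / 4) ‖w‖ := by
  refine (h.norm_le s hw).trans ?_
  rw [mul_assoc, mdec, ← Real.exp_add]
  gcongr
  · exact h.nonneg
  · have := abs_sub_abs_le_abs_sub (Real.log ‖w‖) s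
    rw [abs_sub_comm] at this
    linarith

theorem norm_le_rpow (h : IsProfile H t0 t1 C) (s : ℝ) {w : ℂ} (hw : w ∈ cleft t1) :
    ‖H ((Real.exp (-s) : ℂ) * w)‖ ≤ C * Real.exp (|s| / 4) * ‖w‖ ^ (-(1 / 4) : ℝ) := by
  refine (h.norm_le_mdec s hw).trans ?_
  have := h.nonneg
  gcongr
  exact mdec_le_rpow (by norm_num) (norm_pos_iff.2 hw.1)

variable {𝔸 : Type*} [NormedRing 𝔸] [NormedAlgebra ℂ 𝔸] {a : ℂ → 𝔸} {ta KA : ℝ}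

theorem ctrIntegrable (h : IsProfile H t0 t1 C) (ha : IsPRes a ta KA) (hta : t1 ≤ ta)
    (hπ : t1 < π) (s : ℝ) :
    CtrIntegrable t1 fun w => H ((Real.exp (-s) : ℂ) * w) • a w :=
  ctrIntegrable_smul (h.pos.trans h.lt.le) hπ (κ := 1 / 4) (by norm_num) (by norm_num)
    ((h.continuousOn s).mono (rays_subset_cleft _))
    (fun _ hw => h.norm_le_rpow s (rays_subset_cleft _ hw)) (ha.continuousOn_rays hta)
    fun _ hw => ha.norm_le (hw.2.le.trans hta)

theorem dilInt_shift [CompleteSpace 𝔸] (h : IsProfile H t0 t1 C) (ha : IsPRes a ta KA) {t : ℝ}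
    (ht : t1 ≤ t) (hta : t ≤ ta) (hπ : t < π) (s : ℝ) : dilInt a H t1 s = dilInt a H t s :=
  ha.cint_shift (h.pos.trans_lt h.lt) ht hta hπ (κ := 1 / 4) (by norm_num) (by norm_num)
    (h.continuousOn s) ((h.differentiableOn s).mono (oleft_anti h.lt.le))
    fun _ hw => h.norm_le_rpow s hw

end IsProfile

theorem cint_finsetSum {E ι : Type*} [NormedAddCommGroup E] [NormedSpace ℂ E] {t : ℝ}
    (S : Finset ι) {g : ι → ℂ → E} (hg : ∀ i ∈ S, CtrIntegrable t (g i)) :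
    cint t (fun z => ∑ i ∈ S, g i z) = ∑ i ∈ S, cint t (g i) := by
  unfold cint
  simp only [Finset.smul_sum]
  exact integral_finsetSum S hg

theorem CtrIntegrable.finsetSum {E ι : Type*} [NormedAddCommGroup E] [NormedSpace ℂ E] {t : ℝ}
    (S : Finset ι) {g : ι → ℂ → E} (hg : ∀ i ∈ S, CtrIntegrable t (g i)) :
    CtrIntegrable t (fun z => ∑ i ∈ S, g i z) := by
  unfold CtrIntegrable
  simp only [Finset.smul_sum]
  exact integrable_finsetSum S hg

variable {X : Type u} [NormedAddCommGroup X] [NormedSpace ℂ X] [CompleteSpace X]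

/-- Unconditional boundedness of `∑ ±H(e^{-j}A)` from the bounded `H^∞`-calculus. -/
theorem exists_norm_sum_dilInt_le {a : ℂ → X →L[ℂ] X} {ta tA KA : ℝ} (ha : IsPRes a ta KA)
    (hA : HasBddHCalc a ta tA) (htA : tA < ta) (hπ : ta < π) : ∃ Cs : ℝ, 0 ≤ Cs ∧
    ∀ (H : ℂ → ℂ) (t0 t1 t C : ℝ), IsProfile H t0 t1 C → t1 ≤ tA → t1 ≤ t → t ≤ ta →
      ∀ (s : ℝ) (n : ℕ) (σ : Fin n → Bool),
        ‖∑ j : Fin n, sgn σ j • dilInt a H t (s + (j : ℕ))‖ ≤ Cs * C := by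
  obtain ⟨Ch, hCh, hA⟩ := hA
  obtain ⟨S, hS, hsum⟩ := exists_sum_exp_le (σ := 1 / 4) (by norm_num)
  refine ⟨Ch * S, by positivity, fun H t0 t1 t C h h1 ht hta s n σ => ?_⟩
  have htpos := h.pos.trans_lt h.lt
  have hta' := h.mono (h1.trans htA.le)
  have e1 : ∀ j : Fin n, dilInt a H t (s + (j : ℕ)) = dilInt a H ta (s + (j : ℕ)) := fun j =>
    (h.mono ht).dilInt_shift ha hta le_rfl hπ _
  set f : ℂ → ℂ := fun w => ∑ j : Fin n, sgn σ j * H ((Real.exp (-(s + (j : ℕ))) : ℂ) * w) with hf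
  have hi : ∀ j : Fin n, CtrIntegrable ta fun w =>
      sgn σ j • H ((Real.exp (-(s + (j : ℕ))) : ℂ) * w) • a w := fun j =>
    (hta'.ctrIntegrable ha le_rfl hπ _).smul _
  have ef : (fun w => f w • a w) = fun w => ∑ j : Fin n,
      sgn σ j • H ((Real.exp (-(s + (j : ℕ))) : ℂ) * w) • a w := by
    ext1 w
    simp only [hf, Finset.sum_smul, smul_smul]
  have e2 : ∑ j : Fin n, sgn σ j • dilInt a H t (s + (j : ℕ)) = fCalc a ta f := by
    have h2 := cint_finsetSum Finset.univ fun j _ => hi j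
    have h3 := CtrIntegrable.finsetSum Finset.univ fun j _ => hi j
    rw [← ef] at h2 h3
    rw [fCalc_eq_cint h3, h2]
    refine Finset.sum_congr rfl fun j _ => ?_
    rw [cint_smul, e1, dilInt]
  have hA0 : 0 ≤ tA := htpos.le.trans h1
  have hfn : ∀ w, ‖f w‖ ≤ ∑ j : Fin n, ‖H ((Real.exp (-(s + (j : ℕ))) : ℂ) * w)‖ := fun w =>
    (norm_sum_le _ _).trans_eq (Finset.sum_congr rfl fun j _ => by rw [norm_mul, norm_sgn, one_mul])
  have hsub : oleft tA ⊆ cleft t1 := (oleft_subset_cleft _).trans (cleft_anti h1)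
  rw [e2, mul_assoc]
  refine hA f (memH0_of_mdec hA0 (ν := 1 / 4)
    (C := ∑ j : Fin n, C * Real.exp (|s + (j : ℕ)| / 4)) (by norm_num) ?_ fun w hw => ?_) _
    fun w hw => ?_
  · exact DifferentiableOn.fun_sum fun j _ => ((h.differentiableOn _).mono
      (oleft_anti (h.lt.le.trans h1))).const_mul _
  · refine (hfn w).trans ?_
    rw [Finset.sum_mul]
    exact Finset.sum_le_sum fun j _ => h.norm_le_mdec _ (hsub hw)
  · have hw' : w ∈ oleft tA := by rw [oleft_eq_compl hA0]; exact hw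
    refine (hfn w).trans ((Finset.sum_le_sum fun j _ => h.norm_le _ (hsub hw')).trans ?_)
    rw [← Finset.mul_sum, mul_comm]
    refine mul_le_mul_of_nonneg_right ?_ h.nonneg
    refine le_trans (le_of_eq ?_) (hsum (s - Real.log ‖w‖) n)
    rw [Finset.sum_range]
    refine Finset.sum_congr rfl fun j _ => ?_
    congr 3
    ring

end Profile

section RBoundedInner

variable {X : Type u} [NormedAddCommGroup X] [NormedSpace ℂ X] [CompleteSpace X]

/-- The regularizing factor `z / (z - ε)`. -/
def regFac (ε : ℝ) (z : ℂ) : ℂ := z / (z - ε)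

theorem sin_mul_add_le_norm_sub {t ε : ℝ} (ht0 : 0 < t) (hε : 0 < ε) {z : ℂ}
    (hz : z ∈ cleft t) : Real.sin (t / 2) * (ε + ‖z‖) ≤ ‖z - ε‖ := by
  have := norm_sub_ge (u := (ε : ℂ)) (v := z) (t := 0) ht0
    (by rw [Complex.arg_ofReal_of_nonneg hε.le, abs_zero]) (by simpa using hz.2)
  rwa [Complex.norm_real, Real.norm_of_nonneg hε.le, norm_sub_rev] at this

theorem norm_regFac_le {t ε : ℝ} (ht0 : 0 < t) (htπ : t ≤ π) (hε : 0 < ε) {z : ℂ}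
    (hz : z ∈ cleft t) : ‖regFac ε z‖ ≤ (Real.sin (t / 2))⁻¹ * (‖z‖ / (‖z‖ + ε)) := by
  have hs := sin_half_pos ht0 htπ
  have hz' := norm_pos_iff.2 hz.1
  have h1 := sin_mul_add_le_norm_sub ht0 hε hz
  rw [regFac, norm_div]
  calc _ ≤ ‖z‖ / (Real.sin (t / 2) * (ε + ‖z‖)) := by gcongr
    _ = _ := by rw [add_comm ε]; field_simp

theorem norm_regFac_le_const {t ε : ℝ} (ht0 : 0 < t) (htπ : t ≤ π) (hε : 0 < ε) {z : ℂ}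
    (hz : z ∈ cleft t) : ‖regFac ε z‖ ≤ (Real.sin (t / 2))⁻¹ := by
  have hs := sin_half_pos ht0 htπ
  refine (norm_regFac_le ht0 htπ hε hz).trans (mul_le_of_le_one_right (by positivity) ?_)
  rw [div_le_one (by positivity)]
  linarith

theorem differentiableOn_regFac {t ε : ℝ} (ht0 : 0 < t) (hε : 0 < ε) :
    DifferentiableOn ℂ (regFac ε) (cleft t) := by
  refine DifferentiableOn.div differentiableOn_id (by fun_prop) fun z hz h => ?_
  have := hz.2
  rw [sub_eq_zero.1 h, Complex.arg_ofReal_of_nonneg hε.le, abs_zero] at this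
  linarith

theorem norm_regFac_sub_one_le {t ε η : ℝ} (ht0 : 0 < t) (htπ : t ≤ π) (hε : 0 < ε)
    (h0 : 0 ≤ η) (h1 : η ≤ 1) {z : ℂ} (hz : z ∈ cleft t) :
    ‖regFac ε z - 1‖ ≤ (Real.sin (t / 2))⁻¹ * (ε ^ η * ‖z‖ ^ (-η)) := by
  have hs := sin_half_pos ht0 htπ
  have hz' := norm_pos_iff.2 hz.1
  have h2 := sin_mul_add_le_norm_sub ht0 hε hz
  have h3 : 0 < ‖z - ε‖ := lt_of_lt_of_le (by positivity) h2
  have h4 : regFac ε z - 1 = ε / (z - ε) := by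
    rw [regFac, div_sub_one (norm_pos_iff.1 h3)]; congr 1; ring
  rw [h4, norm_div, Complex.norm_real, Real.norm_of_nonneg hε.le]
  have h5 : ε ^ (1 - η) * ‖z‖ ^ η ≤ ε + ‖z‖ := by
    calc _ ≤ (ε + ‖z‖) ^ (1 - η) * (ε + ‖z‖) ^ η := by
          gcongr <;> linarith
      _ = _ := by rw [← Real.rpow_add (by positivity)]; simp
  calc _ ≤ ε / (Real.sin (t / 2) * (ε ^ (1 - η) * ‖z‖ ^ η)) := by
        gcongr
        exact le_trans (by gcongr) h2
    _ = _ := by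
      rw [Real.rpow_neg hz'.le, Real.rpow_sub hε, Real.rpow_one]
      field_simp

variable {φ : ℂ → ℂ} {χ M D η : ℝ} {b : ℂ → X →L[ℂ] X} {tB tb KB : ℝ} {ω τ : ℝ}

theorem IsKW.sum_innerInt_le (hφ : IsKW φ χ M D η) (hχ : 2 * π - ω - τ < χ)
    (hb : IsPRes b tb KB) (hτ0 : 0 < τ) (hτB : τ < tB) (hBb : tB < tb) (hbπ : tb < π) {C : ℝ}
    (hR : RBound C {T | ∃ f : ℂ → ℂ, MemH0 tB f ∧ (∀ z ∉ Sector tB, ‖f z‖ ≤ 1) ∧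
      T = fCalc b tb f}) {n : ℕ} (ζ : Fin n → ℂ) (hζ : ∀ i, ζ i ∈ cleft ω) (y : Fin n → X) :
    ∑ s : Fin n → Bool, ‖∑ i, sgn s i • innerInt φ b τ (ζ i) (y i)‖ ^ 2 ≤
      (M * (Real.sin (tB / 2))⁻¹ * C) ^ 2 *
        ∑ s : Fin n → Bool, ‖∑ i, sgn s i • y i‖ ^ 2 := by
  have hη := hφ.η_pos
  have hη2 := hφ.η_lt
  have hD := hφ.D_nonneg
  have hM := hφ.M_pos
  have hB0 : 0 < tB := hτ0.trans hτB
  have hs := sin_half_pos hB0 (by linarith)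
  have hKB := hb.nonneg (hB0.le.trans hBb.le)
  set κ := (Real.sin (tB / 2))⁻¹ with hκ
  have hκ0 : 0 < κ := inv_pos.2 hs
  set m : ℝ := (M * κ)⁻¹ with hm
  have hm0 : 0 < m := by positivity
  have hsubτ : cleft tB ⊆ cleft τ := cleft_anti hτB.le
  have hrays : rays tb ⊆ cleft tB := fun z hz => ⟨hz.1, hBb.le.trans hz.2.ge⟩
  set T : Fin n → X →L[ℂ] X := fun i => (m : ℂ) • innerInt φ b τ (ζ i) with hT
  set g : ℝ → Fin n → ℂ → ℂ := fun ε i z => (m : ℂ) * (regFac ε z * φ (ζ i * z)) with hg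
  set S : ℝ → Fin n → X →L[ℂ] X := fun ε i => fCalc b tb (g ε i) with hS
  have hφd : ∀ i, DifferentiableOn ℂ (fun z => φ (ζ i * z)) (cleft τ) := fun i =>
    hφ.diff.comp (f := fun z => ζ i * z) (by fun_prop) fun _ hz => mul_mem_osec hχ (hζ i) hz
  have hgd : ∀ ε > 0, ∀ i, DifferentiableOn ℂ (g ε i) (cleft tB) := fun ε hε i =>
    ((differentiableOn_regFac hB0 hε).mul ((hφd i).mono hsubτ)).const_mul _
  have hgn : ∀ ε i z, ‖g ε i z‖ = m * (‖regFac ε z‖ * ‖φ (ζ i * z)‖) := fun ε i z => by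
    simp only [hg, norm_mul, Complex.norm_real, Real.norm_of_nonneg hm0.le]
  have hgi : ∀ ε > 0, ∀ i, CtrIntegrable tb fun z => g ε i z • b z := fun ε hε i => by
    refine ctrIntegrable_smul (hB0.le.trans hBb.le) hbπ hη (by linarith)
      ((hgd ε hε i).continuousOn.mono hrays) (C := m * (κ * (D * ‖ζ i‖ ^ (-η)))) (fun z hz => ?_)
      (hb.continuousOn_rays le_rfl) fun z hz => hb.norm_le hz.2.le
    rw [hgn]
    calc _ ≤ m * (κ * (D * (‖ζ i‖ ^ (-η) * ‖z‖ ^ (-η)))) := by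
          gcongr
          · exact norm_regFac_le_const hB0 (by linarith) hε (hrays hz)
          · exact hφ.norm_le hχ (hζ i) (hsubτ (hrays hz))
      _ = _ := by ring
  have h1 : ∀ ε > 0, ∀ i, S ε i ∈ {T | ∃ f : ℂ → ℂ, MemH0 tB f ∧
      (∀ z ∉ Sector tB, ‖f z‖ ≤ 1) ∧ T = fCalc b tb f} := by
    intro ε hε i
    refine ⟨g ε i, memH0_of_mdec hB0.le (ν := min η (1 - η))
      (C := m * (κ * (D * ‖ζ i‖ ^ (-η))) * (1 + 1 / ε)) (lt_min hη (by linarith))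
      ((hgd ε hε i).mono (oleft_subset_cleft _)) fun z hz => ?_, fun z hz => ?_, rfl⟩
    · have hz' := norm_pos_iff.2 hz.1
      have hz2 := oleft_subset_cleft _ hz
      rw [hgn]
      calc _ ≤ m * (κ * (‖z‖ / (‖z‖ + ε)) * (D * (‖ζ i‖ ^ (-η) * ‖z‖ ^ (-η)))) := by
            gcongr
            · exact norm_regFac_le hB0 (by linarith) hε hz2
            · exact hφ.norm_le hχ (hζ i) (hsubτ hz2)
        _ = m * (κ * (D * ‖ζ i‖ ^ (-η))) * (‖z‖ ^ (1 - η) / (‖z‖ + ε)) := by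
          rw [show (1 - η : ℝ) = -η + 1 by ring, Real.rpow_add_one hz'.ne']; ring
        _ ≤ m * (κ * (D * ‖ζ i‖ ^ (-η))) * ((1 + 1 / ε) * mdec (min η (1 - η)) ‖z‖) := by
          gcongr
          exact rpow_div_add_le hη (by linarith) hz' hε
        _ = _ := by ring
    · have hz' : z ∈ oleft tB := by rw [oleft_eq_compl hB0.le]; exact hz
      have hz2 := oleft_subset_cleft _ hz'
      rw [hgn]
      calc _ ≤ m * (κ * M) := by
            gcongr
            · exact norm_regFac_le_const hB0 (by linarith) hε hz2
            · exact hφ.bdd _ (mul_mem_osec hχ (hζ i) (hsubτ hz2))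
        _ = 1 := by rw [hm]; field_simp
  have h2 : ∀ i, Filter.Tendsto (fun ε => S ε i) (𝓝[>] 0) (𝓝 (T i)) := by
    intro i
    have e1 : T i = cint tb fun z => (m : ℂ) • φ (ζ i * z) • b z := by
      rw [cint_smul, hT]
      simp only [innerInt]
      rw [hb.cint_shift hτ0 (hτB.le.trans hBb.le) le_rfl hbπ hη (by linarith)
        (C := D * ‖ζ i‖ ^ (-η)) (hφd i).continuousOn ((hφd i).mono (oleft_subset_cleft _))
        fun z hz => (hφ.norm_le hχ (hζ i) hz).trans_eq (by ring)]
    have hTi : CtrIntegrable tb fun z => (m : ℂ) • φ (ζ i * z) • b z :=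
      (hφ.ctrIntegrable_innerInt (ω := ω) (τ := tb) (by linarith) hb (hB0.trans hBb) hbπ le_rfl
        (hζ i)).smul _
    rw [tendsto_iff_norm_sub_tendsto_zero]
    have h3 : Filter.Tendsto (fun ε : ℝ => m * κ * (D * ‖ζ i‖ ^ (-η)) * (2 * KB) *
        mdecMass (min (2 * η) (1 - 2 * η)) * ε ^ η) (𝓝[>] 0) (𝓝 0) := by
      have : Filter.Tendsto (fun ε : ℝ => ε ^ η) (𝓝[>] 0) (𝓝 0) := by
        have := (Real.continuousAt_rpow_const 0 η (Or.inr hη.le)).tendsto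
        rw [Real.zero_rpow hη.ne'] at this
        exact this.mono_left nhdsWithin_le_nhds
      simpa using this.const_mul (m * κ * (D * ‖ζ i‖ ^ (-η)) * (2 * KB) *
        mdecMass (min (2 * η) (1 - 2 * η)))
    refine squeeze_zero' (Filter.Eventually.of_forall fun _ => norm_nonneg _) ?_ h3
    filter_upwards [self_mem_nhdsWithin] with ε (hε : 0 < ε)
    rw [e1, hS]
    simp only
    rw [fCalc_eq_cint (hgi ε hε i), ← cint_sub (hgi ε hε i) hTi]
    refine (norm_cint_le (C := m * κ * (D * ‖ζ i‖ ^ (-η)) * (2 * KB) * ε ^ η)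
      (hB0.le.trans hBb.le) hbπ (ν := min (2 * η) (1 - 2 * η))
      (lt_min (by linarith) (by linarith)) fun z hz => ?_).trans_eq (by ring)
    have hz' := norm_pos_iff.2 hz.1
    have e2 : g ε i z • b z - (m : ℂ) • φ (ζ i * z) • b z =
        ((m : ℂ) * ((regFac ε z - 1) * φ (ζ i * z))) • b z := by
      simp only [hg, smul_smul, ← sub_smul]
      congr 1; ring
    rw [e2, norm_smul, norm_mul, norm_mul, Complex.norm_real, Real.norm_of_nonneg hm0.le]
    have h4 := norm_mul_rpow_div_le (η := 2 * η) (by linarith) (by linarith) hKB hz'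
    calc _ ≤ ‖z‖ * (m * (κ * (ε ^ η * ‖z‖ ^ (-η)) * (D * (‖ζ i‖ ^ (-η) * ‖z‖ ^ (-η)))) *
          (KB / (1 + ‖z‖))) := by
          gcongr
          · exact norm_regFac_sub_one_le hB0 (by linarith) hε hη.le (by linarith) (hrays hz)
          · exact hφ.norm_le hχ (hζ i) (hsubτ (hrays hz))
          · exact hb.norm_le hz.2.le
      _ = m * κ * (D * ‖ζ i‖ ^ (-η)) * ε ^ η *
          (‖z‖ * (‖z‖ ^ (-η) * ‖z‖ ^ (-η) * (KB / (1 + ‖z‖)))) := by ring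
      _ = m * κ * (D * ‖ζ i‖ ^ (-η)) * ε ^ η *
          (‖z‖ * (‖z‖ ^ (-(2 * η)) * (KB / (1 + ‖z‖)))) := by
        rw [← Real.rpow_add hz']; congr 5; ring
      _ ≤ m * κ * (D * ‖ζ i‖ ^ (-η)) * ε ^ η *
          (2 * KB * mdec (min (2 * η) (1 - 2 * η)) ‖z‖) := by gcongr
      _ = _ := by ring
  have h3 := hR.sum_le_of_tendsto h1 h2 y
  have e3 : ∀ s : Fin n → Bool, ‖∑ i, sgn s i • T i (y i)‖ ^ 2 =
      m ^ 2 * ‖∑ i, sgn s i • innerInt φ b τ (ζ i) (y i)‖ ^ 2 := by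
    intro s
    have : ∑ i, sgn s i • T i (y i) = (m : ℂ) • ∑ i, sgn s i • innerInt φ b τ (ζ i) (y i) := by
      rw [Finset.smul_sum]
      exact Finset.sum_congr rfl fun i _ => by rw [hT, smul_comm]; rfl
    rw [this, norm_smul, Complex.norm_real, Real.norm_of_nonneg hm0.le, mul_pow]
  simp only [e3, ← Finset.mul_sum] at h3
  calc _ = (M * κ) ^ 2 * (m ^ 2 * ∑ s : Fin n → Bool,
        ‖∑ i, sgn s i • innerInt φ b τ (ζ i) (y i)‖ ^ 2) := by
        rw [← mul_assoc, ← mul_pow, hm, mul_inv_cancel₀ (by positivity), one_pow, one_mul]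
    _ ≤ (M * κ) ^ 2 * (C ^ 2 * ∑ s : Fin n → Bool, ‖∑ i, sgn s i • y i‖ ^ 2) := by gcongr
    _ = _ := by ring

end RBoundedInner

theorem isProfile_sqFst {t : ℝ} (h0 : 0 < t) (h1 : t ≤ π) :
    IsProfile sqFst 0 t (Real.sin (t / 2) ^ (-(1 / 2) : ℝ)) where
  pos := le_rfl
  lt := h0
  diff := differentiableOn_sqFst le_rfl
  bound _ hu := norm_sqFst_le h0 h1 hu
  nonneg := Real.rpow_nonneg (sin_half_pos h0 h1).le _

theorem isProfile_sqSnd {ω δ : ℝ} (hω : 0 ≤ ω) (h0 : 0 < δ) (h1 : δ ≤ π) {e : ℂ}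
    (he : ‖e‖ = 1) (het : |e.arg| ≤ ω) :
    IsProfile (sqSnd e) ω (ω + δ) (Real.sin (δ / 2))⁻¹ where
  pos := hω
  lt := by linarith
  diff := differentiableOn_sqSnd hω het
  bound u hu := norm_sqSnd_le h0 h1 hu he het
  nonneg := inv_nonneg.2 (sin_half_pos h0 h1).le

section Factorization

variable {𝔸 : Type*} [NormedRing 𝔸] [NormedAlgebra ℂ 𝔸] [CompleteSpace 𝔸]

theorem cint_half_eq_mul {a : ℂ → 𝔸} {ta KA ω δ : ℝ} (ha : IsPRes a ta KA) (hω : 0 < ω)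
    (hδ : 0 < δ) (hta : ω + 2 * δ ≤ ta) (hπ : ω + 2 * δ < π) {e : ℂ} (he : ‖e‖ = 1)
    (het : |e.arg| ≤ ω) (s : ℝ) :
    (cint (ω + 2 * δ) fun w => (negPow (1 / 2) w * ((Real.exp s : ℂ) * e - w)⁻¹) • a w) =
      (Real.exp (-s / 2) : ℂ) •
        (dilInt a sqFst (ω + δ) s * dilInt a (sqSnd e) (ω + 2 * δ) s) := by
  have p1 := isProfile_sqFst (t := ω + δ) (by linarith) (by linarith)
  have p2 := isProfile_sqSnd hω.le hδ (by linarith) he het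
  have p2' := p2.mono (show ω + δ ≤ ω + 2 * δ by linarith)
  unfold dilInt
  rw [ha.cint_mul (t1 := ω + δ) (by linarith) (by linarith) hta hπ (κ := 1 / 4) (by norm_num)
    (by norm_num) (p1.continuousOn s)
    ((p1.differentiableOn s).mono (oleft_anti (by linarith)))
    (fun w hw => p1.norm_le_rpow s hw) (p2'.continuousOn s)
    ((p2'.differentiableOn s).mono (oleft_anti (by linarith)))
    (fun w hw => p2'.norm_le_rpow s hw) (fun w hw => p2'.norm_le_const s hw), ← cint_smul]
  refine cint_congr (by linarith) hπ fun w hw => ?_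
  have hwl : w ∈ oleft 0 :=
    cleft_subset_oleft (s := 0) (t := ω + 2 * δ) (by linarith) (rays_subset_cleft _ hw)
  set u : ℂ := (Real.exp (-s) : ℂ) * w with hu
  have hul : u ∈ oleft 0 := exp_real_mul_mem_oleft _ hwl
  have hwu : w = (Real.exp s : ℂ) * u := by
    rw [hu, ← mul_assoc, ← Complex.ofReal_mul, ← Real.exp_add]; simp
  rw [sqFst_mul_sqSnd hul, smul_smul]
  congr 1
  conv_lhs => rw [hwu]
  rw [negPow_exp_mul hul.1, ← mul_sub, mul_inv, ← Complex.ofReal_inv, ← Real.exp_neg]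
  have : (Real.exp (-s / 2) : ℂ) = Real.exp (1 / 2 * s) * Real.exp (-s) := by
    rw [← Complex.ofReal_mul, ← Real.exp_add]; congr 2; ring
  rw [this]; ring

theorem norm_commutator_dilInt_le {a : ℂ → 𝔸} {ta KA : ℝ} (ha : IsPRes a ta KA)
    {H : ℂ → ℂ} {t0 t1 C : ℝ} (hH : IsProfile H t0 t1 C) (hta : t1 ≤ ta) (hπ : t1 < π)
    {μ K : ℝ} (hμ0 : 0 < μ) (hμ1 : μ ≤ 1 / 4) (hK : 0 ≤ K) {T : 𝔸}
    (hT : ∀ w ∈ csec ta, ‖w‖ * ‖T * a w - a w * T‖ ≤ K * mdec μ ‖w‖) (s : ℝ) :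
    ‖T * dilInt a H t1 s - dilInt a H t1 s * T‖ ≤
      C * K * mdecMass (μ / 2) * Real.exp (-(μ / 2) * |s|) := by
  have ht1 : 0 ≤ t1 := hH.pos.trans hH.lt.le
  let L : 𝔸 →L[ℂ] 𝔸 := ContinuousLinearMap.mul ℂ 𝔸 T - (ContinuousLinearMap.mul ℂ 𝔸).flip T
  have hL : ∀ x, L x = T * x - x * T := fun x => by simp [L]
  rw [← hL]
  unfold dilInt
  rw [← cint_clm L (hH.ctrIntegrable ha hta hπ s)]
  refine (norm_cint_le (C := C * K * Real.exp (-(μ / 2) * |s|)) (ν := μ / 2) ht1 hπ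
    (by linarith) fun w hw => ?_).trans_eq (by ring)
  have hw0 := norm_pos_iff.2 hw.1
  have h1 := mdec_mul_le_half hμ0.le (Real.exp_pos s) hw0
  rw [mdec_exp (μ / 2) s] at h1
  have h2 : Real.exp (-(1 / 4) * |s - Real.log ‖w‖|) ≤ mdec μ (Real.exp s / ‖w‖) := by
    refine le_trans (le_of_eq ?_) (mdec_anti hμ1)
    unfold mdec
    rw [Real.log_div (Real.exp_pos s).ne' hw0.ne', Real.log_exp]
  have hwc : w ∈ csec ta := ⟨hw.1, hw.2.le.trans hta⟩
  have hC := hH.nonneg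
  rw [map_smul, norm_smul, hL]
  calc _ = ‖H ((Real.exp (-s) : ℂ) * w)‖ * (‖w‖ * ‖T * a w - a w * T‖) := by ring
    _ ≤ C * Real.exp (-(1 / 4) * |s - Real.log ‖w‖|) * (K * mdec μ ‖w‖) := by
        refine mul_le_mul (hH.norm_le s (rays_subset_cleft _ hw)) (hT w hwc) (by positivity)
          (by positivity)
    _ ≤ C * mdec μ (Real.exp s / ‖w‖) * (K * mdec μ ‖w‖) := by
        refine mul_le_mul_of_nonneg_right (mul_le_mul_of_nonneg_left h2 hC)
          (mul_nonneg hK (mdec_nonneg _ _))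
    _ = C * K * (mdec μ (Real.exp s / ‖w‖) * mdec μ ‖w‖) := by ring
    _ ≤ C * K * (Real.exp (-(μ / 2) * |s|) * mdec (μ / 2) ‖w‖) :=
        mul_le_mul_of_nonneg_left h1 (mul_nonneg hC hK)
    _ = _ := by ring

theorem IsKW.norm_commutator_innerInt_le {φ : ℂ → ℂ} {χ M D η : ℝ} {b : ℂ → 𝔸}
    {tb KB ω τ : ℝ} (hφ : IsKW φ χ M D η)
    (hχ : 2 * π - ω - τ < χ) (hb : IsPRes b tb KB) (hτ0 : 0 < τ) (hτπ : τ < π) (hτb : τ ≤ tb)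
    {ζ : ℂ} (hζ : ζ ∈ cleft ω) {μ K : ℝ} (hμ0 : 0 < μ) {T : 𝔸}
    (hT : ∀ z ∈ csec τ, ‖z‖ * ‖b z * T - T * b z‖ ≤ K * mdec μ ‖z‖) :
    ‖innerInt φ b τ ζ * T - T * innerInt φ b τ ζ‖ ≤ M * K * mdecMass μ := by
  let L : 𝔸 →L[ℂ] 𝔸 := (ContinuousLinearMap.mul ℂ 𝔸).flip T - ContinuousLinearMap.mul ℂ 𝔸 T
  have hL : ∀ x, L x = x * T - T * x := fun x => by simp [L]
  rw [← hL]
  unfold innerInt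
  rw [← cint_clm L (hφ.ctrIntegrable_innerInt hχ hb hτ0 hτπ hτb hζ)]
  refine norm_cint_le hτ0.le hτπ hμ0 fun z hz => ?_
  rw [map_smul, norm_smul, hL]
  calc _ = ‖φ (ζ * z)‖ * (‖z‖ * ‖b z * T - T * b z‖) := by ring
    _ ≤ M * (K * mdec μ ‖z‖) :=
        mul_le_mul (hφ.bdd _ (mul_mem_osec hχ hζ (rays_subset_cleft _ hz)))
          (hT z ⟨hz.1, hz.2.le⟩) (by positivity) hφ.M_pos.le
    _ = _ := by ring

end Factorization

section

variable {X : Type u} [NormedAddCommGroup X] [NormedSpace ℂ X] [CompleteSpace X]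

theorem ctrPt_eq_exp_mul (t : ℝ) (i : Bool) (s : ℝ) :
    ctrPt t (i, s) = (Real.exp s : ℂ) * ctrPt t (i, 0) := by
  cases i
  · rw [ctrPt_false, ctrPt_false, Complex.ofReal_exp, ← Complex.exp_add]; congr 1; push_cast; ring
  · rw [ctrPt_true, ctrPt_true, Complex.ofReal_exp, ← Complex.exp_add]; congr 1; push_cast; ring

theorem ctrWt_eq_exp_mul (t : ℝ) (i : Bool) (s : ℝ) :
    ctrWt t (i, s) = (Real.exp s : ℂ) * ctrWt t (i, 0) := by
  cases i
  · rw [ctrWt_false, ctrWt_false, ctrPt_eq_exp_mul t false s]; ring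
  · rw [ctrWt_true, ctrWt_true, ctrPt_eq_exp_mul t true s]; ring

/-- The Kalton–Weis estimate for a pair of families with small commutators. -/
theorem exists_norm_kwInt_le {a b : ℂ → X →L[ℂ] X} {ta tA KA tb tB KB : ℝ}
    (ha : IsPRes a ta KA) (hA : HasBddHCalc a ta tA) (htA : tA < ta) (hta : ta < π)
    (hb : IsPRes b tb KB) (htB : tB < tb) (htb : tb < π) {C0 : ℝ}
    (hR : RBound C0 {T | ∃ f : ℂ → ℂ, MemH0 tB f ∧ (∀ z ∉ Sector tB, ‖f z‖ ≤ 1) ∧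
      T = fCalc b tb f})
    {ω δ τ χ μ K : ℝ} (hω : 0 < ω) (hδ : 0 < δ) (hωδ : ω + 2 * δ = tA) (hτ0 : 0 < τ)
    (hτB : τ < tB) (hχ : 2 * π - ω - τ < χ) (hμ0 : 0 < μ) (hμ1 : μ ≤ 1 / 4) (hK : 0 ≤ K)
    (hcom : ∀ z ∈ csec τ, ∀ w ∈ csec tA, ‖w‖ * ‖z‖ * ‖b z * a w - a w * b z‖ ≤
      K * (mdec μ ‖z‖ * mdec μ ‖w‖)) :
    ∃ C : ℝ, 0 ≤ C ∧ ∀ (φ : ℂ → ℂ) (M D η : ℝ), IsKW φ χ M D η →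
      ‖kwInt φ a b tA τ‖ ≤ C * M := by
  obtain ⟨Cs, hCs, hsum⟩ := exists_norm_sum_dilInt_le ha hA htA hta
  obtain ⟨S, hS, hexp⟩ := exists_sum_exp_le (σ := μ / 2) (by linarith)
  have haA := ha.mono htA.le
  set C1 := Real.sin ((ω + δ) / 2) ^ (-(1 / 2) : ℝ) with hC1
  set C2 := (Real.sin (δ / 2))⁻¹ with hC2
  have p1 : IsProfile sqFst 0 (ω + δ) C1 := isProfile_sqFst (by linarith) (by linarith)
  have hC1n := p1.nonneg
  have hC2n : 0 ≤ C2 := inv_nonneg.2 (sin_half_pos hδ (by linarith)).le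
  have hsB : 0 ≤ (Real.sin (tB / 2))⁻¹ :=
    inv_nonneg.2 (sin_half_pos (hτ0.trans hτB) (by linarith)).le
  have hR' : RBound |C0| {T | ∃ f : ℂ → ℂ, MemH0 tB f ∧ (∀ z ∉ Sector tB, ‖f z‖ ≤ 1) ∧
      T = fCalc b tb f} := by
    intro N Ts x hT
    rw [sq_abs]
    exact hR N Ts x hT
  set Q := C1 * K * mdecMass (μ / 2) * mdecMass μ with hQ
  have hQ0 : 0 ≤ Q := by
    have := mdecMass_nonneg (μ / 2)
    have := mdecMass_nonneg μ
    positivity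
  set D0 := (Cs * C1) * ((Real.sin (tB / 2))⁻¹ * |C0|) * (Cs * C2) + Q * S * (Cs * C2) with hD0
  have hD0n : 0 ≤ D0 := by positivity
  refine ⟨2 * D0, by positivity, fun φ M D η hφ => ?_⟩
  have hM := hφ.M_pos
  obtain ⟨hint, heq⟩ := hφ.kwInt_eq hχ hb hτ0 (by linarith) (by linarith) haA hω
    (δ := 2 * δ) (by linarith) hωδ.le (by linarith)
  rw [← hωδ, heq, cint_eq_rays hint]
  have key : ∀ i : Bool, ‖∫ s : ℝ, ctrWt ω (i, s) • (negPow (-(1 / 2)) (ctrPt ω (i, s)) •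
      (innerInt φ b τ (ctrPt ω (i, s)) * cint (ω + 2 * δ) fun w =>
        (negPow (1 / 2) w * (ctrPt ω (i, s) - w)⁻¹) • a w))‖ ≤ D0 * M := by
    intro i
    set e := ctrPt ω (i, 0) with he
    have hen : ‖e‖ = 1 := by rw [he, norm_ctrPt]; simp
    have hea : |e.arg| = ω := abs_arg_ctrPt hω.le (by linarith) _
    have p2 : IsProfile (sqSnd e) ω (ω + δ) C2 :=
      isProfile_sqSnd hω.le hδ (by linarith) hen hea.le
    set κ := ctrWt ω (i, 0) * negPow (-(1 / 2)) e with hκ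
    have hκ1 : ‖κ‖ ≤ 1 := by
      rw [hκ, norm_mul, norm_negPow, hen, Real.one_rpow, mul_one]
      exact (norm_ctrWt_le _ _).trans_eq hen
    set H1 := fun s => dilInt a sqFst (ω + δ) s with hH1
    set H2 := fun s => dilInt a (sqSnd e) (ω + 2 * δ) s with hH2
    set F := fun s : ℝ => innerInt φ b τ (ctrPt ω (i, s)) with hF
    have hmem : ∀ s, ctrPt ω (i, s) ∈ cleft ω := fun s =>
      rays_subset_cleft _ (ctrPt_mem_rays hω.le (by linarith) _)
    refine norm_integral_le_of_sum_le (hint.ray i) fun t n => ?_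
    have e1 : ∀ s : ℝ, ctrWt ω (i, s) • (negPow (-(1 / 2)) (ctrPt ω (i, s)) •
        (innerInt φ b τ (ctrPt ω (i, s)) * cint (ω + 2 * δ) fun w =>
        (negPow (1 / 2) w * (ctrPt ω (i, s) - w)⁻¹) • a w)) =
        κ • (H1 s * F s * H2 s + (F s * H1 s - H1 s * F s) * H2 s) := by
      intro s
      have e2 := cint_half_eq_mul haA hω hδ hωδ.le (by linarith) hen hea.le s
      rw [he, ← ctrPt_eq_exp_mul] at e2
      rw [e2, ctrWt_eq_exp_mul, ctrPt_eq_exp_mul, ← he,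
        negPow_exp_mul (u := e) (ctrPt_ne_zero _ _), mul_smul_comm, smul_smul, smul_smul]
      have e3 : (Real.exp s : ℂ) * ctrWt ω (i, 0) *
          ((Real.exp (-(1 / 2) * s) : ℂ) * negPow (-(1 / 2)) e * (Real.exp (-s / 2) : ℂ)) = κ := by
        have : (Real.exp s : ℂ) * (Real.exp (-(1 / 2) * s) : ℂ) * (Real.exp (-s / 2) : ℂ) = 1 := by
          rw [← Complex.ofReal_mul, ← Complex.ofReal_mul, ← Real.exp_add, ← Real.exp_add]
          ring_nf
          simp
        rw [hκ]
        linear_combination (ctrWt ω (i, 0) * negPow (-(1 / 2)) e) * this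
      rw [mul_assoc (Real.exp s : ℂ), ← mul_assoc (Real.exp s : ℂ)]
      rw [show F s = innerInt φ b τ ((Real.exp s : ℂ) * e) by rw [hF, he, ← ctrPt_eq_exp_mul]]
      congr 1
      · rw [← e3]; ring
      · simp only [sub_mul, mul_assoc, add_sub_cancel, H1, H2]
    simp_rw [e1]
    rw [← Finset.smul_sum, Finset.sum_add_distrib, norm_smul]
    have hH2n : ∀ s, ‖H2 s‖ ≤ Cs * C2 := by
      intro s
      have := hsum (sqSnd e) ω (ω + δ) (ω + 2 * δ) C2 p2 (by linarith) (by linarith) (by linarith)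
        s 1 (fun _ => true)
      simpa [sgn] using this
    have m1 : ‖∑ k ∈ Finset.range n, H1 (t + k) * F (t + k) * H2 (t + k)‖ ≤
        (Cs * C1) * (M * (Real.sin (tB / 2))⁻¹ * |C0|) * (Cs * C2) := by
      rw [Finset.sum_range fun k : ℕ => H1 (t + k) * F (t + k) * H2 (t + k)]
      exact norm_sum_mul_mul_le (by positivity) (by positivity) (by positivity)
        (fun s => hsum sqFst 0 (ω + δ) (ω + δ) C1 p1 (by linarith) le_rfl (by linarith) t n s)
        (fun s => hsum (sqSnd e) ω (ω + δ) (ω + 2 * δ) C2 p2 (by linarith) (by linarith)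
          (by linarith) t n s)
        fun y => hφ.sum_innerInt_le hχ hb hτ0 hτB htB htb hR' _ (fun j => hmem _) y
    have m2 : ‖∑ k ∈ Finset.range n, (F (t + k) * H1 (t + k) - H1 (t + k) * F (t + k)) *
        H2 (t + k)‖ ≤ M * (Q * S * (Cs * C2)) := by
      refine (norm_sum_le _ _).trans ?_
      calc _ ≤ ∑ k ∈ Finset.range n, (M * Q * (Cs * C2)) * Real.exp (-(μ / 2) * |t + k|) := by
            refine Finset.sum_le_sum fun k _ => (norm_mul_le _ _).trans ?_
            have c1 : ∀ z ∈ csec τ, ‖z‖ * ‖b z * H1 (t + k) - H1 (t + k) * b z‖ ≤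
                (C1 * K * mdecMass (μ / 2) * Real.exp (-(μ / 2) * |t + k|)) * mdec μ ‖z‖ := by
              intro z hz
              have hz0 := norm_pos_iff.2 hz.1
              have := norm_commutator_dilInt_le haA p1 (by linarith) (by linarith) hμ0 hμ1
                (K := K * mdec μ ‖z‖ / ‖z‖) (T := b z)
                (div_nonneg (mul_nonneg hK (mdec_nonneg _ _)) hz0.le) (fun w hw => by
                  rw [div_mul_eq_mul_div, le_div_iff₀ hz0]
                  refine le_trans (le_of_eq ?_) ((hcom z hz w hw).trans_eq ?_) <;> ring) (t + k)
              calc _ ≤ ‖z‖ * (C1 * (K * mdec μ ‖z‖ / ‖z‖) * mdecMass (μ / 2) *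
                    Real.exp (-(μ / 2) * |t + k|)) := by gcongr
                _ = _ := by field_simp
            have c2 := hφ.norm_commutator_innerInt_le hχ hb hτ0 (by linarith) (by linarith)
              (hmem (t + k)) hμ0 c1
            calc _ ≤ (M * (C1 * K * mdecMass (μ / 2) * Real.exp (-(μ / 2) * |t + k|)) *
                  mdecMass μ) * (Cs * C2) := by
                  exact mul_le_mul c2 (hH2n _) (norm_nonneg _) ((norm_nonneg _).trans c2)
              _ = _ := by rw [hQ]; ring
        _ ≤ M * Q * (Cs * C2) * S := by
            rw [← Finset.mul_sum]
            exact mul_le_mul_of_nonneg_left (hexp t n) (by positivity)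
        _ = _ := by ring
    calc _ ≤ 1 * ((Cs * C1) * (M * (Real.sin (tB / 2))⁻¹ * |C0|) * (Cs * C2) +
          M * (Q * S * (Cs * C2))) := by
          refine mul_le_mul hκ1 ((norm_add_le _ _).trans (add_le_add m1 m2)) (norm_nonneg _)
            zero_le_one
      _ = _ := by rw [hD0]; ring
  refine (norm_add_le _ _).trans ((add_le_add (key true) (key false)).trans_eq (by ring))

end

section

variable {𝔸 : Type*} [NormedRing 𝔸] [NormedAlgebra ℂ 𝔸]

/-- A pair of pseudo-resolvents together with the transformed pseudo-resolvent
`L μ = A (B + μ)⁻¹ A⁻¹`, subject to the Da Prato–Grisvard commutator estimate. -/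
structure IsDPG (a b L : ℂ → 𝔸) (tA tB N α β : ℝ) : Prop where
  tA_pos : 0 < tA
  tA_lt : tA < π
  tB_pos : 0 < tB
  tB_lt : tB < π
  α_nonneg : 0 ≤ α
  β_pos : 0 < β
  add_lt : α + β < 1
  resA : IsPRes a tA N
  resB : IsPRes b tB N
  resL : IsPRes L tB N
  intertwine : ∀ μ ∈ Sector tB, b μ * a 0 = a 0 * L μ
  diff_le : ∀ w ∈ Sector tA, ∀ μ ∈ Sector tB, ‖(L μ - b μ) * (1 - w • a w)‖ ≤
    N / ((1 + ‖w‖ ^ (1 - α)) * (1 + ‖μ‖ ^ (1 + β)))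

theorem zero_mem_sector {t : ℝ} (ht : 0 ≤ t) : (0 : ℂ) ∈ Sector t := by
  simpa [Sector] using ht

theorem mul_neg_inv_arg_le {l ζ : ℂ} (hl : l ≠ 0) (hζ : ζ ≠ 0) :
    |(l * (-ζ)⁻¹).arg| ≤ |l.arg| + (π - |ζ.arg|) := by
  refine (abs_arg_mul_le hl (inv_ne_zero (neg_ne_zero.2 hζ))).trans ?_
  rw [abs_arg_inv, abs_arg_neg hζ]

theorem product_identity {A0 Az B0 Bm Lm : 𝔸} {l ζ μ : ℂ} (hl : l ≠ 0) (hζ : ζ ≠ 0)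
    (hζ1 : ζ + 1 ≠ 0) (hμ : l = -(ζ * μ)) (h1 : B0 - Bm = μ • (B0 * Bm))
    (h2 : A0 - Az = ζ • (A0 * Az)) (h3 : Bm * A0 = A0 * Lm) :
    (1 + l • (B0 * A0)) * (-ζ⁻¹ • (Bm * Az)) =
      (ζ + 1)⁻¹ • (B0 * (A0 - 1) * Az) + (ζ + 1)⁻¹ • (μ • ((B0 + l⁻¹ • 1) * Bm * A0)) -
        (B0 * A0) * ((ζ⁻¹ * μ) • (Lm - Bm)) +
        (B0 * A0) * ((ζ⁻¹ * μ) • ((Lm - Bm) * (1 - ζ • Az))) := by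
  have hμ0 : μ ≠ 0 := by rintro rfl; simp [hμ] at hl
  have e1 : μ • (B0 * (Bm * A0)) = B0 * A0 - Bm * A0 := by
    rw [← mul_assoc, ← smul_mul_assoc, ← h1, sub_mul]
  have e2 : ζ • (B0 * (A0 * Az)) = B0 * A0 - B0 * Az := by
    rw [← mul_smul_comm, ← h2, mul_sub]
  have e3 : (ζ * μ) • (B0 * (Bm * (A0 * Az))) =
      B0 * A0 - B0 * Az - (Bm * A0 - Bm * Az) := by
    have : (ζ * μ) • (B0 * (Bm * (A0 * Az))) = (μ • (B0 * Bm)) * (ζ • (A0 * Az)) := by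
      rw [smul_mul_smul_comm, mul_comm ζ, mul_assoc]
    rw [this, ← h1, ← h2]; noncomm_ring
  have e4 : B0 * (A0 * (Lm * Az)) = B0 * (Bm * (A0 * Az)) := by
    rw [← mul_assoc A0, ← h3, mul_assoc]
  have e5 : (ζ + 1)⁻¹ • (B0 * (A0 - 1) * Az) + (ζ + 1)⁻¹ • (μ • ((B0 + l⁻¹ • 1) * Bm * A0)) =
      ζ⁻¹ • (B0 * A0 - B0 * Az - Bm * A0) := by
    have h : ζ • (B0 * (A0 - 1) * Az + μ • ((B0 + l⁻¹ • 1) * Bm * A0)) =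
        (ζ + 1) • (B0 * A0 - B0 * Az - Bm * A0) := by
      have hc : μ * l⁻¹ = -ζ⁻¹ := by rw [hμ]; field_simp
      have : μ • ((B0 + l⁻¹ • 1) * Bm * A0) = B0 * A0 - Bm * A0 - ζ⁻¹ • (Bm * A0) := by
        rw [← e1, add_mul, add_mul, smul_add, smul_mul_assoc, smul_mul_assoc, one_mul, smul_smul,
          hc, neg_smul, mul_assoc, sub_eq_add_neg]
      rw [this, mul_sub, mul_one, sub_mul, mul_assoc, smul_add, smul_sub, e2, smul_sub,
        smul_smul, mul_inv_cancel₀ hζ, one_smul]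
      module
    rw [← smul_add, inv_smul_eq_iff₀ hζ1, smul_comm, ← h, inv_smul_smul₀ hζ]
  rw [e5]
  have e6 : l • (B0 * (A0 * (Bm * Az))) = -(B0 * A0 - B0 * Az - (Bm * A0 - Bm * Az)) -
      l • (B0 * (A0 * ((Lm - Bm) * Az))) := by
    rw [sub_mul, mul_sub, mul_sub, e4, ← e3, hμ]; module
  have e7 : (1 + l • (B0 * A0)) * (-ζ⁻¹ • (Bm * Az)) =
      -ζ⁻¹ • (Bm * Az + l • (B0 * (A0 * (Bm * Az)))) := by
    rw [mul_smul_comm, add_mul, one_mul, smul_mul_assoc, mul_assoc]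
  rw [e7, e6]
  have e8 : (B0 * A0) * ((ζ⁻¹ * μ) • ((Lm - Bm) * (1 - ζ • Az))) =
      (B0 * A0) * ((ζ⁻¹ * μ) • (Lm - Bm)) + (ζ⁻¹ * l) • (B0 * (A0 * ((Lm - Bm) * Az))) := by
    rw [mul_sub, mul_one, smul_sub, mul_sub, mul_smul_comm ζ, smul_smul, mul_smul_comm,
      mul_smul_comm, hμ]
    simp only [mul_assoc]
    have : ζ⁻¹ * -(ζ * μ) = -(ζ⁻¹ * μ * ζ) := by ring
    rw [this]
    module
  rw [e8]
  module

end

theorem differentiableOn_mul_neg_inv (l : ℂ) (t : ℝ) :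
    DifferentiableOn ℂ (fun ζ => l * (-ζ)⁻¹) (cleft t) := fun _ hζ =>
  (((differentiableAt_id.neg).inv (neg_ne_zero.2 hζ.1)).const_mul l).differentiableWithinAt

theorem norm_mul_neg_inv (l ζ : ℂ) : ‖l * (-ζ)⁻¹‖ = ‖l‖ / ‖ζ‖ := by
  rw [norm_mul, norm_inv, norm_neg, div_eq_mul_inv]

theorem div_one_add_rpow_le {β x : ℝ} (hx : 0 < x) :
    x / (1 + x ^ (1 + β)) ≤ x ^ (-β) := by
  have : 0 < x ^ (1 + β) := Real.rpow_pos_of_pos hx _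
  rw [div_le_iff₀ (by linarith), mul_add, ← Real.rpow_add hx]
  have h : -β + (1 + β) = 1 := by ring
  rw [h, Real.rpow_one]
  have := Real.rpow_pos_of_pos hx (-β)
  linarith

theorem div_one_add_rpow_le' {β x : ℝ} (hβ : 0 < β) (hx : 0 < x) :
    x / (1 + x ^ (1 + β)) ≤ x ^ (1 - β) := by
  have h1 : 0 < x ^ (1 + β) := Real.rpow_pos_of_pos hx _
  have h2 := Real.rpow_pos_of_pos hx (1 - β)
  rw [div_le_iff₀ (by linarith), mul_add, ← Real.rpow_add hx, mul_one]
  have h : 1 - β + (1 + β) = (2 : ℕ) := by push_cast; ring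
  rw [h, Real.rpow_natCast]
  rcases le_total x 1 with h | h
  · have : x ≤ x ^ (1 - β) := by
      nth_rewrite 1 [← Real.rpow_one x]
      exact Real.rpow_le_rpow_of_exponent_ge hx h (by linarith)
    nlinarith
  · nlinarith

theorem rpow_div_one_add_rpow_le {β γ x : ℝ} (hx : 0 < x) :
    x ^ β / (1 + x ^ γ) ≤ mdec (min β (γ - β)) x := by
  have h1 := Real.rpow_pos_of_pos hx γ
  have h2 := Real.rpow_pos_of_pos hx β
  rcases le_total x 1 with h | h
  · rw [mdec_of_le_one hx h]
    calc _ ≤ x ^ β := div_le_self h2.le (by linarith)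
      _ ≤ _ := Real.rpow_le_rpow_of_exponent_ge hx h (min_le_left _ _)
  · rw [mdec_of_one_le h]
    calc _ ≤ x ^ β / x ^ γ := by gcongr; linarith
      _ = x ^ (-(γ - β)) := by rw [← Real.rpow_sub hx]; congr 1; ring
      _ ≤ _ := Real.rpow_le_rpow_of_exponent_le h (neg_le_neg (min_le_right _ _))

section DPG

variable {𝔸 : Type*} [NormedRing 𝔸] [NormedAlgebra ℂ 𝔸]

/-- The Da Prato–Grisvard approximation of the resolvent of the product. -/
def dpgInt (a b : ℂ → 𝔸) (t : ℝ) (l : ℂ) : 𝔸 :=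
  cint t fun ζ => -ζ⁻¹ • (b (l * (-ζ)⁻¹) * a ζ)

/-- The error of the Da Prato–Grisvard approximation. -/
def dpgErr (a b L : ℂ → 𝔸) (t : ℝ) (l : ℂ) : 𝔸 :=
  cint t fun ζ => (ζ⁻¹ * (l * (-ζ)⁻¹)) •
    ((L (l * (-ζ)⁻¹) - b (l * (-ζ)⁻¹)) * (1 - ζ • a ζ))

namespace IsDPG

variable {a b L : ℂ → 𝔸} {tA tB N α β : ℝ} {l : ℂ}

theorem mem_osec (hl : l ≠ 0) (hlt : |l.arg| + (π - tA) < tB) {ζ : ℂ} (hζ : ζ ∈ cleft tA) :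
    l * (-ζ)⁻¹ ∈ osec tB := by
  refine ⟨mul_ne_zero hl (inv_ne_zero (neg_ne_zero.2 hζ.1)), ?_⟩
  have := mul_neg_inv_arg_le hl hζ.1
  have := hζ.2
  linarith

theorem continuousOn_comp (hl : l ≠ 0) (hlt : |l.arg| + (π - tA) < tB) {R : ℂ → 𝔸}
    (hR : IsPRes R tB N) : ContinuousOn (fun ζ => R (l * (-ζ)⁻¹)) (cleft tA) :=
  hR.continuousOn_csec.comp (differentiableOn_mul_neg_inv l tA).continuousOn
    fun _ hζ => osec_subset_csec _ (mem_osec hl hlt hζ)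

theorem differentiableOn_comp (hl : l ≠ 0) (hlt : |l.arg| + (π - tA) < tB) (hB : tB ≤ π)
    {R : ℂ → 𝔸} (hR : IsPRes R tB N) :
    DifferentiableOn ℂ (fun ζ => R (l * (-ζ)⁻¹)) (cleft tA) :=
  (hR.differentiableOn hB).comp (differentiableOn_mul_neg_inv l tA)
    fun _ hζ => mem_osec hl hlt hζ

theorem N_nonneg (h : IsDPG a b L tA tB N α β) : 0 ≤ N := h.resA.nonneg h.tA_pos.le

theorem dpgInt_bound (h : IsDPG a b L tA tB N α β) (hl : l ≠ 0)
    (hlt : |l.arg| + (π - tA) < tB) {κ : ℝ} (hκ0 : 0 < κ) (hκ1 : κ < 1)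
    {ζ : ℂ} (hζ : ζ ∈ rays tA) :
    ‖ζ‖ * ‖-ζ⁻¹ • (b (l * (-ζ)⁻¹) * a ζ)‖ ≤
      2 * N ^ 2 * ‖l‖ ^ (-κ) * mdec (min κ (1 - κ)) ‖ζ‖ := by
  have hN := h.N_nonneg
  have hz := norm_pos_iff.2 hζ.1
  have hln := norm_pos_iff.2 hl
  have hm := osec_subset_csec _ (mem_osec hl hlt (rays_subset_cleft _ hζ))
  have h1 := h.resB.norm_le_rpow hm hκ0.le hκ1.le
  have h2 := h.resA.norm_le (z := ζ) hζ.2.le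
  rw [norm_mul_neg_inv, Real.div_rpow hln.le hz.le] at h1
  rw [norm_smul, norm_neg, norm_inv, mul_inv_cancel_left₀ hz.ne']
  refine (norm_mul_le _ _).trans ?_
  have h3 := rpow_div_one_add_le (κ := 1 - κ) (by linarith) (by linarith) hz
  rw [sub_sub_cancel, min_comm] at h3
  calc _ ≤ N * (‖l‖ ^ (-κ) / ‖ζ‖ ^ (-κ)) * (N / (1 + ‖ζ‖)) := by gcongr
    _ = N ^ 2 * ‖l‖ ^ (-κ) * (‖ζ‖ ^ κ / (1 + ‖ζ‖)) := by
        rw [Real.rpow_neg hz.le κ, div_inv_eq_mul]; ring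
    _ ≤ N ^ 2 * ‖l‖ ^ (-κ) * (2 * mdec (min κ (1 - κ)) ‖ζ‖) := by gcongr
    _ = _ := by ring

theorem ctrIntegrable_dpgInt (h : IsDPG a b L tA tB N α β) (hl : l ≠ 0)
    (hlt : |l.arg| + (π - tA) < tB) :
    CtrIntegrable tA fun ζ => -ζ⁻¹ • (b (l * (-ζ)⁻¹) * a ζ) := by
  refine ctrIntegrable_of_bound h.tA_pos.le h.tA_lt (ν := min (1 / 2) (1 - 1 / 2)) (by norm_num)
    ?_ fun ζ hζ => h.dpgInt_bound hl hlt (κ := 1 / 2) (by norm_num) (by norm_num) hζ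
  exact ((continuousOn_id.inv₀ fun _ hz => hz.1).neg).smul
    (((continuousOn_comp hl hlt h.resB).mono (rays_subset_cleft _)).mul
      (h.resA.continuousOn_rays le_rfl))

theorem norm_dpgInt_le (h : IsDPG a b L tA tB N α β) (hl : l ≠ 0)
    (hlt : |l.arg| + (π - tA) < tB) {κ : ℝ} (hκ0 : 0 < κ) (hκ1 : κ < 1) :
    ‖dpgInt a b tA l‖ ≤ 2 * N ^ 2 * ‖l‖ ^ (-κ) * mdecMass (min κ (1 - κ)) :=
  norm_cint_le h.tA_pos.le h.tA_lt (lt_min hκ0 (by linarith))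
    fun _ hζ => h.dpgInt_bound hl hlt hκ0 hκ1 hζ

theorem dpgErr_bound (h : IsDPG a b L tA tB N α β) (hl : l ≠ 0)
    (hlt : |l.arg| + (π - tA) < tB) {ζ : ℂ} (hζ : ζ ∈ rays tA) :
    ‖ζ‖ * ‖(ζ⁻¹ * (l * (-ζ)⁻¹)) • ((L (l * (-ζ)⁻¹) - b (l * (-ζ)⁻¹)) * (1 - ζ • a ζ))‖ ≤
      N * ‖l‖ ^ (-β) * mdec (min β (1 - α - β)) ‖ζ‖ := by
  have hN := h.N_nonneg
  have hz := norm_pos_iff.2 hζ.1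
  have hln := norm_pos_iff.2 hl
  have hm := osec_subset_csec _ (mem_osec hl hlt (rays_subset_cleft _ hζ))
  have h1 := h.diff_le ζ hζ.2.le _ hm.2
  have hp := div_one_add_rpow_le (β := β) (norm_pos_iff.2 hm.1)
  rw [norm_smul, norm_mul ζ⁻¹, norm_inv ζ, mul_assoc ‖ζ‖⁻¹, mul_inv_cancel_left₀ hz.ne']
  have hw := Real.rpow_pos_of_pos hz (1 - α)
  have hmp := Real.rpow_pos_of_pos (norm_pos_iff.2 hm.1) (1 + β)
  calc _ ≤ ‖l * (-ζ)⁻¹‖ * (N / ((1 + ‖ζ‖ ^ (1 - α)) * (1 + ‖l * (-ζ)⁻¹‖ ^ (1 + β)))) := by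
        gcongr
    _ = N / (1 + ‖ζ‖ ^ (1 - α)) * (‖l * (-ζ)⁻¹‖ / (1 + ‖l * (-ζ)⁻¹‖ ^ (1 + β))) := by
        field_simp
    _ ≤ N / (1 + ‖ζ‖ ^ (1 - α)) * ‖l * (-ζ)⁻¹‖ ^ (-β) := by gcongr
    _ = N * ‖l‖ ^ (-β) * (‖ζ‖ ^ β / (1 + ‖ζ‖ ^ (1 - α))) := by
        rw [norm_mul_neg_inv, Real.div_rpow hln.le hz.le, Real.rpow_neg hz.le β, div_inv_eq_mul]
        ring
    _ ≤ _ := by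
        gcongr
        exact rpow_div_one_add_rpow_le hz

theorem min_pos (h : IsDPG a b L tA tB N α β) : 0 < min β (1 - α - β) :=
  lt_min h.β_pos (by linarith [h.add_lt])

theorem ctrIntegrable_dpgErr (h : IsDPG a b L tA tB N α β) (hl : l ≠ 0)
    (hlt : |l.arg| + (π - tA) < tB) :
    CtrIntegrable tA fun ζ => (ζ⁻¹ * (l * (-ζ)⁻¹)) •
      ((L (l * (-ζ)⁻¹) - b (l * (-ζ)⁻¹)) * (1 - ζ • a ζ)) := by
  refine ctrIntegrable_of_bound h.tA_pos.le h.tA_lt h.min_pos ?_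
    fun ζ hζ => h.dpgErr_bound hl hlt hζ
  exact ((continuousOn_id.inv₀ fun _ hz => hz.1).mul
      ((differentiableOn_mul_neg_inv l tA).continuousOn.mono (rays_subset_cleft _))).smul
    ((((continuousOn_comp hl hlt h.resL).sub (continuousOn_comp hl hlt h.resB)).mono
      (rays_subset_cleft _)).mul (continuousOn_const.sub (continuousOn_id.smul
        (h.resA.continuousOn_rays le_rfl))))

theorem norm_dpgErr_le (h : IsDPG a b L tA tB N α β) (hl : l ≠ 0)
    (hlt : |l.arg| + (π - tA) < tB) :
    ‖dpgErr a b L tA l‖ ≤ N * ‖l‖ ^ (-β) * mdecMass (min β (1 - α - β)) :=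
  norm_cint_le h.tA_pos.le h.tA_lt h.min_pos fun _ hζ => h.dpgErr_bound hl hlt hζ

end IsDPG

end DPG

namespace IsDPG

variable {𝔸 : Type*} [NormedRing 𝔸] [NormedAlgebra ℂ 𝔸]
variable {a b L : ℂ → 𝔸} {tA tB N α β : ℝ} {l : ℂ}

theorem norm_diff_le (h : IsDPG a b L tA tB N α β) {μ : ℂ} (hμ : μ ∈ Sector tB) :
    ‖L μ - b μ‖ ≤ N / (1 + ‖μ‖ ^ (1 + β)) := by
  have h1 := h.diff_le 0 (zero_mem_sector h.tA_pos.le) μ hμ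
  have : 1 - α ≠ 0 := by linarith [h.add_lt, h.β_pos]
  simpa [Real.zero_rpow this] using h1

theorem neg_one_mem_oleft (h : IsDPG a b L tA tB N α β) : (-1 : ℂ) ∈ oleft tA :=
  ⟨by norm_num, by rw [Complex.arg_neg_one, abs_of_pos Real.pi_pos]; exact h.tA_lt⟩

theorem one_mem_osec (h : IsDPG a b L tA tB N α β) : (1 : ℂ) ∈ osec tA :=
  ⟨one_ne_zero, by simpa using h.tA_pos⟩

theorem norm_first_le (h : IsDPG a b L tA tB N α β) {ζ : ℂ} (hζ : ζ ∈ csec tA) (T : 𝔸) :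
    ‖T * a ζ‖ ≤ ‖T‖ * N * ‖ζ‖ ^ (-(1 / 2) : ℝ) := by
  refine (norm_mul_le _ _).trans ?_
  rw [mul_assoc]
  exact mul_le_mul_of_nonneg_left (h.resA.norm_le_rpow hζ (by norm_num) (by norm_num))
    (norm_nonneg _)

theorem norm_second_le (h : IsDPG a b L tA tB N α β) (hl : l ≠ 0)
    (hlt : |l.arg| + (π - tA) < tB) {ζ : ℂ} (hζ : ζ ∈ cleft tA) (T S : 𝔸) :
    ‖(l * (-ζ)⁻¹) • (T * b (l * (-ζ)⁻¹) * S)‖ ≤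
      ‖T‖ * ‖S‖ * N * ‖l‖ ^ (1 / 2 : ℝ) * ‖ζ‖ ^ (-(1 / 2) : ℝ) := by
  have hN := h.N_nonneg
  have hz := norm_pos_iff.2 hζ.1
  have hm := osec_subset_csec _ (mem_osec hl hlt hζ)
  have hm0 := norm_pos_iff.2 hm.1
  have h1 := h.resB.norm_le_rpow hm (κ := 1 / 2) (by norm_num) (by norm_num)
  rw [norm_smul]
  calc _ ≤ ‖l * (-ζ)⁻¹‖ * (‖T‖ * (N * ‖l * (-ζ)⁻¹‖ ^ (-(1 / 2) : ℝ)) * ‖S‖) := by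
        refine mul_le_mul_of_nonneg_left ((norm_mul_le _ _).trans ?_) (norm_nonneg _)
        refine mul_le_mul_of_nonneg_right ((norm_mul_le _ _).trans ?_) (norm_nonneg _)
        exact mul_le_mul_of_nonneg_left h1 (norm_nonneg _)
    _ = ‖T‖ * ‖S‖ * N * (‖l * (-ζ)⁻¹‖ ^ (1 : ℝ) * ‖l * (-ζ)⁻¹‖ ^ (-(1 / 2) : ℝ)) := by
        rw [Real.rpow_one]; ring
    _ = ‖T‖ * ‖S‖ * N * ‖l‖ ^ (1 / 2 : ℝ) * ‖ζ‖ ^ (-(1 / 2) : ℝ) := by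
        rw [← Real.rpow_add hm0, norm_mul_neg_inv, Real.div_rpow (norm_nonneg _) hz.le,
          Real.rpow_neg hz.le]
        norm_num
        ring

theorem norm_third_le (h : IsDPG a b L tA tB N α β) (hl : l ≠ 0)
    (hlt : |l.arg| + (π - tA) < tB) {ζ : ℂ} (hζ : ζ ∈ cleft tA) :
    ‖((ζ - 1) * ζ⁻¹ * (l * (-ζ)⁻¹)) • (L (l * (-ζ)⁻¹) - b (l * (-ζ)⁻¹))‖ ≤
      N * (‖l‖ ^ (1 - β) + ‖l‖ ^ (-β)) * ‖ζ‖ ^ (-(1 - β)) := by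
  have hN := h.N_nonneg
  have hz := norm_pos_iff.2 hζ.1
  have hln := norm_pos_iff.2 hl
  have hm := osec_subset_csec _ (mem_osec hl hlt hζ)
  have hm0 := norm_pos_iff.2 hm.1
  have hp := div_one_add_rpow_le (β := β) hm0
  have hp' := div_one_add_rpow_le' h.β_pos hm0
  have h1 := h.norm_diff_le hm.2
  have h2 : ‖(ζ - 1) * ζ⁻¹‖ ≤ 1 + ‖ζ‖⁻¹ := by
    rw [sub_mul, mul_inv_cancel₀ hζ.1, one_mul, ← norm_inv]
    exact (norm_sub_le _ _).trans (by simp)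
  rw [norm_smul, norm_mul ((ζ - 1) * ζ⁻¹)]
  calc _ ≤ (1 + ‖ζ‖⁻¹) * ‖l * (-ζ)⁻¹‖ * (N / (1 + ‖l * (-ζ)⁻¹‖ ^ (1 + β))) := by gcongr
    _ = N * (‖l * (-ζ)⁻¹‖ / (1 + ‖l * (-ζ)⁻¹‖ ^ (1 + β)) +
        ‖ζ‖⁻¹ * (‖l * (-ζ)⁻¹‖ / (1 + ‖l * (-ζ)⁻¹‖ ^ (1 + β)))) := by ring
    _ ≤ N * (‖l * (-ζ)⁻¹‖ ^ (1 - β) + ‖ζ‖⁻¹ * ‖l * (-ζ)⁻¹‖ ^ (-β)) := by gcongr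
    _ = _ := by
        rw [norm_mul_neg_inv, Real.div_rpow hln.le hz.le, Real.div_rpow hln.le hz.le,
          Real.rpow_neg hz.le (1 - β), Real.rpow_neg hz.le β, Real.rpow_sub hz, Real.rpow_one]
        have := (Real.rpow_pos_of_pos hz β).ne'
        field_simp

theorem ctrIntegrable_first (h : IsDPG a b L tA tB N α β) (T : 𝔸) :
    CtrIntegrable tA fun ζ => (ζ + 1)⁻¹ • (T * a ζ) := by
  have := ctrIntegrable_pole h.tA_pos.le h.tA_lt (κ := 1 / 2) (by norm_num) (by norm_num)
    (continuousOn_const.mul (h.resA.continuousOn_rays le_rfl))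
    (fun w hw => h.norm_first_le (rays_subset_csec _ hw) T) (z := -1) (by norm_num)
    h.neg_one_mem_oleft.2.ne'
  simpa only [sub_neg_eq_add, Pi.mul_apply, Pi.smul_apply'] using this

theorem ctrIntegrable_second (h : IsDPG a b L tA tB N α β) (hl : l ≠ 0)
    (hlt : |l.arg| + (π - tA) < tB) (T S : 𝔸) :
    CtrIntegrable tA fun ζ => (ζ + 1)⁻¹ • ((l * (-ζ)⁻¹) • (T * b (l * (-ζ)⁻¹) * S)) := by
  have := ctrIntegrable_pole h.tA_pos.le h.tA_lt (κ := 1 / 2) (by norm_num) (by norm_num)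
    (((differentiableOn_mul_neg_inv l tA).continuousOn.smul ((continuousOn_const.mul
      (continuousOn_comp hl hlt h.resB)).mul continuousOn_const)).mono (rays_subset_cleft _))
    (fun w hw => h.norm_second_le hl hlt (rays_subset_cleft _ hw) T S) (z := -1) (by norm_num)
    h.neg_one_mem_oleft.2.ne'
  simpa only [sub_neg_eq_add, Pi.mul_apply, Pi.smul_apply'] using this

theorem differentiableOn_third (h : IsDPG a b L tA tB N α β) (hl : l ≠ 0)
    (hlt : |l.arg| + (π - tA) < tB) : DifferentiableOn ℂ
      (fun ζ => ((ζ - 1) * ζ⁻¹ * (l * (-ζ)⁻¹)) • (L (l * (-ζ)⁻¹) - b (l * (-ζ)⁻¹)))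
      (cleft tA) :=
  (((differentiableOn_id.sub_const 1).mul (differentiableOn_id.inv fun _ hz => hz.1)).mul
    (differentiableOn_mul_neg_inv l tA)).smul
    ((differentiableOn_comp hl hlt h.tB_lt.le h.resL).sub
      (differentiableOn_comp hl hlt h.tB_lt.le h.resB))

theorem third_eq (h : IsDPG a b L tA tB N α β) {ζ : ℂ} (hζ : ζ ∈ rays tA) :
    (ζ - 1)⁻¹ • (((ζ - 1) * ζ⁻¹ * (l * (-ζ)⁻¹)) • (L (l * (-ζ)⁻¹) - b (l * (-ζ)⁻¹))) =
      (ζ⁻¹ * (l * (-ζ)⁻¹)) • (L (l * (-ζ)⁻¹) - b (l * (-ζ)⁻¹)) := by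
  have : ζ - 1 ≠ 0 := ne_of_mem_rays hζ h.one_mem_osec.2.ne
  rw [smul_smul]
  congr 1
  field_simp

theorem ctrIntegrable_third (h : IsDPG a b L tA tB N α β) (hl : l ≠ 0)
    (hlt : |l.arg| + (π - tA) < tB) :
    CtrIntegrable tA fun ζ => (ζ⁻¹ * (l * (-ζ)⁻¹)) • (L (l * (-ζ)⁻¹) - b (l * (-ζ)⁻¹)) :=
  (ctrIntegrable_pole h.tA_pos.le h.tA_lt (κ := 1 - β)
    (by linarith [h.add_lt, h.α_nonneg]) (by linarith [h.β_pos])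
    ((h.differentiableOn_third hl hlt).continuousOn.mono (rays_subset_cleft _))
    (fun w hw => h.norm_third_le hl hlt (rays_subset_cleft _ hw)) (z := 1) one_ne_zero
    h.one_mem_osec.2.ne).congr h.tA_pos.le h.tA_lt fun _ hζ => h.third_eq hζ

variable [CompleteSpace 𝔸]

theorem cint_first (h : IsDPG a b L tA tB N α β) (T : 𝔸) :
    cint tA (fun ζ => (ζ + 1)⁻¹ • (T * a ζ)) = 0 := by
  have := cauchy_right_ext h.tA_pos.le h.tA_lt (κ := 1 / 2) (by norm_num) (by norm_num)
    (continuousOn_const.mul h.resA.continuousOn_csec)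
    ((h.resA.differentiableOn h.tA_lt.le).const_mul T)
    (fun w hw => h.norm_first_le hw T) (z := -1) (by norm_num) h.neg_one_mem_oleft.2
  simpa only [sub_neg_eq_add, Pi.mul_apply, Pi.smul_apply'] using this

theorem cint_second (h : IsDPG a b L tA tB N α β) (hl : l ≠ 0)
    (hlt : |l.arg| + (π - tA) < tB) (T S : 𝔸) :
    cint tA (fun ζ => (ζ + 1)⁻¹ • ((l * (-ζ)⁻¹) • (T * b (l * (-ζ)⁻¹) * S))) =
      l • (T * b l * S) := by
  have hd := (differentiableOn_mul_neg_inv l tA).smul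
    (((differentiableOn_comp hl hlt h.tB_lt.le h.resB).const_mul T).mul_const S)
  have := cauchy_oleft h.tA_pos h.tA_lt (κ := 1 / 2) (by norm_num) (by norm_num)
    hd.continuousOn (hd.mono (oleft_subset_cleft _))
    (fun w hw => h.norm_second_le hl hlt hw T S) h.neg_one_mem_oleft
  simpa using this

theorem cint_third (h : IsDPG a b L tA tB N α β) (hl : l ≠ 0)
    (hlt : |l.arg| + (π - tA) < tB) :
    cint tA (fun ζ => (ζ⁻¹ * (l * (-ζ)⁻¹)) • (L (l * (-ζ)⁻¹) - b (l * (-ζ)⁻¹))) = 0 := by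
  have hd := h.differentiableOn_third hl hlt
  rw [← cauchy_oleft_ext h.tA_pos h.tA_lt (κ := 1 - β) (by linarith [h.add_lt, h.α_nonneg])
    (by linarith [h.β_pos]) hd.continuousOn (hd.mono (oleft_subset_cleft _))
    (fun w hw => h.norm_third_le hl hlt hw) h.one_mem_osec]
  exact cint_congr h.tA_pos.le h.tA_lt fun _ hζ => (h.third_eq hζ).symm

/-- The Da Prato–Grisvard identity. -/
theorem mul_dpgInt (h : IsDPG a b L tA tB N α β) (hl : l ≠ 0)
    (hlt : |l.arg| + (π - tA) < tB) :
    (1 + l • (b 0 * a 0)) * dpgInt a b tA l = (b 0 * a 0) * (1 + dpgErr a b L tA l) := by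
  have hA0 := zero_mem_sector h.tA_pos.le
  have hB0 := zero_mem_sector h.tB_pos.le
  have hlB : l ∈ Sector tB := by
    have h1 := h.tA_lt
    show |l.arg| ≤ tB
    linarith
  have i1 := h.ctrIntegrable_first (b 0 * (a 0 - 1))
  have i2 := h.ctrIntegrable_second hl hlt (b 0 + l⁻¹ • 1) (a 0)
  have i3 := h.ctrIntegrable_third hl hlt
  have i4 := h.ctrIntegrable_dpgErr hl hlt
  have c3 := cint_clm (ContinuousLinearMap.mul ℂ 𝔸 (b 0 * a 0)) i3
  have c4 := cint_clm (ContinuousLinearMap.mul ℂ 𝔸 (b 0 * a 0)) i4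
  have i3' := i3.clm (ContinuousLinearMap.mul ℂ 𝔸 (b 0 * a 0))
  have i4' := i4.clm (ContinuousLinearMap.mul ℂ 𝔸 (b 0 * a 0))
  have c0 := cint_clm (ContinuousLinearMap.mul ℂ 𝔸 (1 + l • (b 0 * a 0)))
    (h.ctrIntegrable_dpgInt hl hlt)
  simp only [ContinuousLinearMap.mul_apply'] at c0 c3 c4 i3' i4'
  rw [dpgInt, ← c0]
  have hpt : ∀ ζ ∈ rays tA, (1 + l • (b 0 * a 0)) * (-ζ⁻¹ • (b (l * (-ζ)⁻¹) * a ζ)) =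
      (ζ + 1)⁻¹ • (b 0 * (a 0 - 1) * a ζ) +
        (ζ + 1)⁻¹ • ((l * (-ζ)⁻¹) • ((b 0 + l⁻¹ • 1) * b (l * (-ζ)⁻¹) * a 0)) -
        (b 0 * a 0) * ((ζ⁻¹ * (l * (-ζ)⁻¹)) • (L (l * (-ζ)⁻¹) - b (l * (-ζ)⁻¹))) +
        (b 0 * a 0) * ((ζ⁻¹ * (l * (-ζ)⁻¹)) •
          ((L (l * (-ζ)⁻¹) - b (l * (-ζ)⁻¹)) * (1 - ζ • a ζ))) := by
    intro ζ hζ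
    have hm := (osec_subset_csec _ (mem_osec hl hlt (rays_subset_cleft _ hζ))).2
    refine product_identity hl hζ.1 ?_ ?_ ?_ ?_ (h.intertwine _ hm)
    · have := ne_of_mem_rays hζ h.neg_one_mem_oleft.2.ne'
      rwa [sub_neg_eq_add] at this
    · have := hζ.1
      field_simp
    · simpa using h.resB.res 0 hB0 _ hm
    · simpa using h.resA.res 0 hA0 ζ hζ.2.le
  rw [cint_congr h.tA_pos.le h.tA_lt hpt, cint_add ((i1.add i2).sub i3') i4',
    cint_sub (i1.add i2) i3', cint_add i1 i2, c3, c4, h.cint_first, h.cint_second hl hlt,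
    h.cint_third hl hlt, mul_zero, sub_zero, zero_add, mul_add, mul_one, ← dpgErr]
  congr 1
  have e1 := h.resB.res 0 hB0 l hlB
  rw [sub_zero] at e1
  rw [add_mul, add_mul, smul_add, ← smul_mul_assoc, ← e1, smul_mul_assoc, one_mul,
    smul_mul_assoc, smul_inv_smul₀ hl, sub_mul, sub_add_cancel]

end IsDPG

theorem abs_arg_add_ofReal_le (z : ℂ) {s : ℝ} (hs : 0 ≤ s) : |(z + s).arg| ≤ |z.arg| := by
  rcases eq_or_ne (z + s) 0 with h0 | h0
  · rw [h0, Complex.arg_zero, abs_zero]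
    exact abs_nonneg _
  rcases eq_or_ne z 0 with rfl | hz
  · simp [Complex.arg_ofReal_of_nonneg hs]
  have hzp := norm_pos_iff.2 hz
  have hp := norm_pos_iff.2 h0
  by_contra! hlt
  have hc := Real.cos_lt_cos_of_nonneg_of_le_pi (abs_nonneg z.arg) (Complex.abs_arg_le_pi _) hlt
  rw [Real.cos_abs, Real.cos_abs, Complex.cos_arg h0, Complex.cos_arg hz, div_lt_div_iff₀ hp hzp]
    at hc
  have h1 : ‖z + s‖ ≤ ‖z‖ + s := by
    refine (norm_add_le _ _).trans ?_
    rw [Complex.norm_real, Real.norm_of_nonneg hs]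
  have h2 : ‖z‖ ≤ ‖z + s‖ + s := by
    have := norm_sub_le (z + s) s
    rwa [add_sub_cancel_right, Complex.norm_real, Real.norm_of_nonneg hs] at this
  have h3 := Complex.abs_re_le_norm z
  rw [abs_le] at h3
  simp only [Complex.add_re, Complex.ofReal_re] at hc
  rcases le_total 0 z.re with hr | hr <;> nlinarith

theorem add_ofReal_mem_sector {t : ℝ} {z : ℂ} (hz : z ∈ Sector t) {s : ℝ} (hs : 0 ≤ s) :
    z + s ∈ Sector t :=
  (abs_arg_add_ofReal_le z hs).trans hz

theorem norm_add_ofReal_ge {t : ℝ} (ht : t < π) {z : ℂ} (hz : z ∈ Sector t) {s : ℝ}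
    (hs : 0 ≤ s) : Real.sin ((π - t) / 2) * (‖z‖ + s) ≤ ‖z + s‖ := by
  rcases hs.eq_or_lt with rfl | hs'
  · simpa using mul_le_of_le_one_left (norm_nonneg z) (Real.sin_le_one _)
  · have hz' : |z.arg| ≤ t := hz
    have := norm_add_ge (u := z) (v := s) (δ := π - t) (by linarith) (by exact_mod_cast hs'.ne')
      (by rw [Complex.arg_ofReal_of_nonneg hs, abs_zero]; linarith)
    rwa [Complex.norm_real, Real.norm_of_nonneg hs] at this

section Homotopy

variable {𝔸 : Type*} [NormedRing 𝔸]

theorem norm_le_of_mul_eq_one {x y : 𝔸} (hx : ‖x‖ ≤ 1 / 2) (h : (1 + x) * y = 1) :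
    ‖y‖ ≤ 2 * ‖(1 : 𝔸)‖ := by
  have h1 : y = 1 - x * y := by rw [← h]; noncomm_ring
  have h2 : ‖y‖ ≤ ‖(1 : 𝔸)‖ + 1 / 2 * ‖y‖ := by
    conv_lhs => rw [h1]
    refine (norm_sub_le _ _).trans (add_le_add le_rfl ((norm_mul_le _ _).trans ?_))
    gcongr
  linarith

variable [CompleteSpace 𝔸]

theorem isUnit_one_add {x : 𝔸} (hx : ‖x‖ < 1) : IsUnit (1 + x) := by
  simpa using isUnit_one_sub_of_norm_lt_one (x := -x) (by rwa [norm_neg])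

/-- Invertibility propagates along a Lipschitz path all of whose points have a right inverse
with a uniform bound. -/
theorem isUnit_of_lipschitz_path {U V : ℝ → 𝔸} {K C s0 : ℝ} (hK : 0 ≤ K) (hC : 0 ≤ C)
    (hUV : ∀ s, 0 ≤ s → U s * V s = 1) (hV : ∀ s, 0 ≤ s → ‖V s‖ ≤ C)
    (hU : ∀ s, 0 ≤ s → ∀ t, 0 ≤ t → ‖U s - U t‖ ≤ K * |s - t|) (hs0 : 0 ≤ s0)
    (h : IsUnit (U s0)) : IsUnit (U 0) := by
  obtain ⟨n, hn⟩ := exists_nat_gt (C * (K * s0))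
  have hn0 : (0 : ℝ) < n := lt_of_le_of_lt (by positivity) hn
  have key : ∀ k : ℕ, k ≤ n → IsUnit (U (s0 * (n - k) / n)) := by
    intro k
    induction k with
    | zero => intro _; simpa [hn0.ne'] using h
    | succ k ih =>
      intro hk
      have hk' : ((k : ℝ) + 1) ≤ n := by exact_mod_cast hk
      have hs : 0 ≤ s0 * (n - k) / n := by
        have : (0 : ℝ) ≤ n - k := by linarith
        positivity
      have ht : 0 ≤ s0 * (n - ((k + 1 : ℕ) : ℝ)) / n := by
        have : (0 : ℝ) ≤ n - ((k + 1 : ℕ) : ℝ) := by push_cast; linarith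
        positivity
      set s := s0 * (n - k) / n
      set t := s0 * (n - ((k + 1 : ℕ) : ℝ)) / n
      have hst : s - t = s0 / n := by
        simp only [s, t]; push_cast; field_simp; ring
      have hd := hU t ht s hs
      rw [abs_sub_comm, hst, abs_of_nonneg (by positivity)] at hd
      have e : U t = U s * (1 + V s * (U t - U s)) := by
        rw [mul_add, mul_one, ← mul_assoc, hUV s hs, one_mul, add_sub_cancel]
      rw [e]
      refine (ih (by lia)).mul (isUnit_one_add ((norm_mul_le _ _).trans_lt ?_))
      calc _ ≤ C * (K * (s0 / n)) := by
            gcongr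
            exact hV s hs
        _ = C * (K * s0) / n := by ring
        _ < 1 := (div_lt_one hn0).2 hn
  simpa using key n le_rfl

end Homotopy

namespace IsDPG

variable {𝔸 : Type*} [NormedRing 𝔸] [NormedAlgebra ℂ 𝔸]
variable {a b L : ℂ → 𝔸} {tA tB N α β : ℝ} {l : ℂ}

theorem sin_pos (h : IsDPG a b L tA tB N α β) : 0 < Real.sin ((π - tB) / 2) :=
  sin_half_pos (by linarith [h.tB_lt]) (by linarith [h.tB_pos])

theorem shift_pres {R : ℂ → 𝔸} (h : IsDPG a b L tA tB N α β) (hR : IsPRes R tB N) {s : ℝ}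
    (hs : 0 ≤ s) :
    IsPRes (fun μ => R (μ + s)) tB (N * (Real.sin ((π - tB) / 2) ^ 2)⁻¹) := by
  have hk := h.sin_pos
  have hk1 := Real.sin_le_one ((π - tB) / 2)
  refine ⟨fun z hz => ?_, fun z hz w hw => ?_⟩
  · have h1 := hR.bound _ (add_ofReal_mem_sector hz hs)
    have h2 := norm_add_ofReal_ge h.tB_lt hz hs
    set κ := Real.sin ((π - tB) / 2)
    rw [← div_eq_mul_inv, le_div_iff₀ (by positivity)]
    calc _ = κ ^ 2 * (1 + ‖z‖) * ‖R (z + s)‖ := by ring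
      _ ≤ (1 + ‖z + s‖) * ‖R (z + s)‖ := by
          gcongr
          have : κ * ‖z‖ ≤ ‖z + s‖ := by nlinarith
          have h3 : κ * κ ≤ κ * 1 := by gcongr
          have := norm_nonneg z
          nlinarith
      _ ≤ N := h1
  · have := hR.res _ (add_ofReal_mem_sector hz hs) _ (add_ofReal_mem_sector hw hs)
    rwa [add_sub_add_right_eq_sub] at this

theorem shift (h : IsDPG a b L tA tB N α β) {s : ℝ} (hs : 0 ≤ s) :
    IsDPG a (fun μ => b (μ + s)) (fun μ => L (μ + s)) tA tB
      (N * (Real.sin ((π - tB) / 2) ^ 2)⁻¹) α β := by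
  have hk := h.sin_pos
  have hk1 := Real.sin_le_one ((π - tB) / 2)
  have hN := h.N_nonneg
  refine ⟨h.tA_pos, h.tA_lt, h.tB_pos, h.tB_lt, h.α_nonneg, h.β_pos, h.add_lt,
    ⟨fun z hz => (h.resA.bound z hz).trans ?_, h.resA.res⟩, h.shift_pres h.resB hs,
    h.shift_pres h.resL hs, fun μ hμ => h.intertwine _ (add_ofReal_mem_sector hμ hs),
    fun w hw μ hμ => (h.diff_le w hw _ (add_ofReal_mem_sector hμ hs)).trans ?_⟩
  · exact le_mul_of_one_le_right hN ((one_le_inv₀ (by positivity)).2 (pow_le_one₀ hk.le hk1))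
  · have h2 := norm_add_ofReal_ge h.tB_lt hμ hs
    set κ := Real.sin ((π - tB) / 2)
    have h3 : κ * ‖μ‖ ≤ ‖μ + s‖ := by nlinarith
    have hβ := h.β_pos
    have hβ1 : 1 + β ≤ 2 := by linarith [h.add_lt, h.α_nonneg]
    have h4 : κ ^ 2 * (1 + ‖μ‖ ^ (1 + β)) ≤ 1 + ‖μ + s‖ ^ (1 + β) := by
      have h5 : κ ^ 2 ≤ κ ^ (1 + β) := by
        rw [← Real.rpow_natCast]
        exact Real.rpow_le_rpow_of_exponent_ge hk hk1 (by exact_mod_cast hβ1)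
      have h6 : κ ^ (1 + β) * ‖μ‖ ^ (1 + β) ≤ ‖μ + s‖ ^ (1 + β) := by
        rw [← Real.mul_rpow hk.le (norm_nonneg _)]
        exact Real.rpow_le_rpow (by positivity) h3 (by linarith)
      have h7 : κ ^ 2 * ‖μ‖ ^ (1 + β) ≤ κ ^ (1 + β) * ‖μ‖ ^ (1 + β) := by gcongr
      have h8 : κ ^ 2 ≤ 1 := pow_le_one₀ hk.le hk1
      linarith
    rw [← div_eq_mul_inv, div_div]
    refine div_le_div_of_nonneg_left hN (by positivity) ?_
    calc κ ^ 2 * ((1 + ‖w‖ ^ (1 - α)) * (1 + ‖μ‖ ^ (1 + β)))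
        = (1 + ‖w‖ ^ (1 - α)) * (κ ^ 2 * (1 + ‖μ‖ ^ (1 + β))) := by ring
      _ ≤ _ := by gcongr

theorem exists_err_le (tA tB α : ℝ) (hN : 0 ≤ N) (hβ : 0 < β) : ∃ c0 : ℝ, 0 < c0 ∧
    ∀ {a b L : ℂ → 𝔸}, IsDPG a b L tA tB N α β → ∀ l : ℂ, c0 ≤ ‖l‖ →
      |l.arg| + (π - tA) < tB → ‖dpgErr a b L tA l‖ ≤ 1 / 2 := by
  set m := mdecMass (min β (1 - α - β))
  have hm : 0 ≤ m := mdecMass_nonneg _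
  set q := 2 * N * m + 1
  have hq : 0 < q := by positivity
  refine ⟨q ^ β⁻¹, by positivity, fun h l hl hlt => ?_⟩
  have hl0 : l ≠ 0 := norm_pos_iff.1 (lt_of_lt_of_le (by positivity) hl)
  refine (h.norm_dpgErr_le hl0 hlt).trans ?_
  have h1 : q ≤ ‖l‖ ^ β := by
    calc q = (q ^ β⁻¹) ^ β := by rw [← Real.rpow_mul hq.le, inv_mul_cancel₀ hβ.ne', Real.rpow_one]
      _ ≤ _ := by gcongr
  rw [Real.rpow_neg (norm_nonneg _)]
  calc N * (‖l‖ ^ β)⁻¹ * m ≤ N * q⁻¹ * m := by gcongr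
    _ ≤ 1 / 2 := by
      rw [mul_right_comm, ← div_eq_mul_inv, div_le_iff₀ hq]
      simp only [q]
      linarith

variable [CompleteSpace 𝔸]

theorem exists_right_inverse (h : IsDPG a b L tA tB N α β) (hl : l ≠ 0)
    (hlt : |l.arg| + (π - tA) < tB) (hE : ‖dpgErr a b L tA l‖ ≤ 1 / 2) :
    ∃ V : 𝔸, (1 + l • (b 0 * a 0)) * V = 1 ∧ ‖V‖ ≤ ‖(1 : 𝔸)‖ +
      ‖l‖ * (2 * N ^ 2 * ‖l‖ ^ (-(1 / 2) : ℝ) * mdecMass (min (1 / 2) (1 - 1 / 2)) *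
        (2 * ‖(1 : 𝔸)‖)) := by
  obtain ⟨u, hu⟩ := isUnit_one_add (x := dpgErr a b L tA l) (by linarith)
  have hJ : (1 + dpgErr a b L tA l) * ↑u⁻¹ = 1 := by rw [← hu, Units.mul_inv]
  have hn := norm_le_of_mul_eq_one hE hJ
  have hX := h.norm_dpgInt_le hl hlt (κ := 1 / 2) (by norm_num) (by norm_num)
  refine ⟨1 - l • (dpgInt a b tA l * ↑u⁻¹), ?_, ?_⟩
  · rw [mul_sub, mul_one, mul_smul_comm, ← mul_assoc, h.mul_dpgInt hl hlt, mul_assoc, hJ, mul_one,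
      add_sub_cancel_right]
  · refine (norm_sub_le _ _).trans ?_
    rw [norm_smul]
    gcongr
    exact (norm_mul_le _ _).trans
      (mul_le_mul hX hn (norm_nonneg _) ((norm_nonneg _).trans hX))

theorem exists_isUnit (h : IsDPG a b L tA tB N α β) : ∃ c0 : ℝ, 0 < c0 ∧ ∀ l : ℂ, c0 ≤ ‖l‖ →
    |l.arg| + (π - tA) < tB →
      ‖dpgErr a b L tA l‖ ≤ 1 / 2 ∧ IsUnit (1 + l • (b 0 * a 0)) := by
  have hN := h.N_nonneg
  have hN' : 0 ≤ N * (Real.sin ((π - tB) / 2) ^ 2)⁻¹ := by positivity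
  obtain ⟨c1, hc1, hE1⟩ := exists_err_le (𝔸 := 𝔸) tA tB α hN h.β_pos
  obtain ⟨c2, hc2, hE2⟩ := exists_err_le (𝔸 := 𝔸) tA tB α hN' h.β_pos
  refine ⟨max c1 c2, lt_max_of_lt_left hc1, fun l hl hlt =>
    ⟨hE1 h l ((le_max_left _ _).trans hl) hlt, ?_⟩⟩
  have hl0 : l ≠ 0 := norm_pos_iff.1 (lt_of_lt_of_le (lt_max_of_lt_left hc1) hl)
  have hV : ∀ s : ℝ, 0 ≤ s → _ := fun s hs => (h.shift hs).exists_right_inverse hl0 hlt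
    (hE2 (h.shift hs) l ((le_max_right _ _).trans hl) hlt)
  choose! V hV1 hV2 using hV
  have hs : ∀ s : ℝ, 0 ≤ s → (s : ℂ) ∈ Sector tB := fun s hs => by
    simpa using add_ofReal_mem_sector (zero_mem_sector h.tB_pos.le) hs
  have ha0 := h.resA.norm_le_const (zero_mem_sector h.tA_pos.le)
  have hU : ∀ s, 0 ≤ s → ∀ t, 0 ≤ t → ‖(1 + l • (b (0 + (s : ℝ)) * a 0)) -
      (1 + l • (b (0 + (t : ℝ)) * a 0))‖ ≤ ‖l‖ * (N * N * N) * |s - t| := by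
    intro s h0s t h0t
    rw [zero_add, zero_add, add_sub_add_left_eq_sub, ← smul_sub, ← sub_mul, h.resB.res _ (hs s h0s)
      _ (hs t h0t), norm_smul, abs_sub_comm]
    have h1 : ‖(b s * b t)‖ ≤ N * N := (norm_mul_le _ _).trans (mul_le_mul
      (h.resB.norm_le_const (hs s h0s)) (h.resB.norm_le_const (hs t h0t)) (norm_nonneg _) hN)
    have h2 : ‖((t : ℂ) - s) • (b s * b t) * a 0‖ ≤ |t - s| * (N * N) * N := by
      refine (norm_mul_le _ _).trans (mul_le_mul ?_ ha0 (norm_nonneg _) (by positivity))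
      rw [norm_smul, ← Complex.ofReal_sub, Complex.norm_real, Real.norm_eq_abs]
      gcongr
    calc _ ≤ ‖l‖ * (|t - s| * (N * N) * N) := by gcongr
      _ = _ := by ring
  have hs0 : 0 ≤ ‖l‖ * (N * N) := by positivity
  have := isUnit_of_lipschitz_path (U := fun s => 1 + l • (b (0 + (s : ℝ)) * a 0)) (by positivity)
    ((norm_nonneg _).trans (hV2 0 le_rfl)) hV1 hV2 hU hs0 ?_
  · simpa using this
  · refine isUnit_one_add ?_
    rw [zero_add, norm_smul]
    have h1 := h.resB.norm_le (hs _ hs0)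
    rw [Complex.norm_real, Real.norm_of_nonneg hs0] at h1
    calc _ ≤ ‖l‖ * (N / (1 + ‖l‖ * (N * N)) * N) := by
          gcongr
          exact (norm_mul_le _ _).trans (mul_le_mul h1 ha0 (norm_nonneg _) (by positivity))
      _ = ‖l‖ * (N * N) / (1 + ‖l‖ * (N * N)) := by ring
      _ < 1 := by
          rw [div_lt_one (by positivity)]
          linarith

end IsDPG

/-- Compatible angles for representing the Da Prato–Grisvard integral as a double contour
integral. -/
structure IsRep {𝔸 : Type*} [NormedRing 𝔸] [NormedAlgebra ℂ 𝔸] (a b : ℂ → 𝔸)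
    (tA tB τ χ ψ δ N : ℝ) : Prop where
  tA_pos : 0 < tA
  tA_lt : tA < π
  τ_pos : 0 < τ
  τ_lt : τ < tB
  tB_lt : tB < π
  χ_gt : 2 * π - tA - τ < χ
  sum_le : χ + ψ + δ ≤ π
  δ_pos : 0 < δ
  ψ_pos : 0 < ψ
  resA : IsPRes a tA N
  resB : IsPRes b tB N

namespace IsRep

variable {𝔸 : Type*} [NormedRing 𝔸] [NormedAlgebra ℂ 𝔸] {a b : ℂ → 𝔸}
  {tA tB τ χ ψ δ N : ℝ} {l : ℂ}

theorem arg_lt (h : IsRep a b tA tB τ χ ψ δ N) (hψ : |l.arg| ≤ ψ) :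
    |l.arg| + (π - tA) < τ := by
  linarith [h.χ_gt, h.sum_le, h.δ_pos]

theorem χ_pos (h : IsRep a b tA tB τ χ ψ δ N) : 0 < χ := by
  linarith [h.χ_gt, h.tA_lt, h.τ_lt, h.tB_lt]

theorem sin_pos (h : IsRep a b tA tB τ χ ψ δ N) : 0 < Real.sin (δ / 2) :=
  sin_half_pos h.δ_pos (by linarith [h.χ_pos, h.sum_le, h.ψ_pos])

theorem N_nonneg (h : IsRep a b tA tB τ χ ψ δ N) : 0 ≤ N := h.resA.nonneg h.tA_pos.le

theorem norm_add_pole_ge (h : IsRep a b tA tB τ χ ψ δ N) (hψ : |l.arg| ≤ ψ) {v : ℂ}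
    (hv : v ∈ osec χ) : Real.sin (δ / 2) * (‖l‖ + ‖v‖) ≤ ‖l + v‖ :=
  norm_add_ge h.δ_pos hv.1 (by linarith [hv.2, h.sum_le])

theorem add_ne_zero (h : IsRep a b tA tB τ χ ψ δ N) (hψ : |l.arg| ≤ ψ) {v : ℂ}
    (hv : v ∈ osec χ) : l + v ≠ 0 := by
  have h1 := h.norm_add_pole_ge hψ hv
  have := h.sin_pos
  have := norm_pos_iff.2 hv.1
  exact norm_pos_iff.1 (lt_of_lt_of_le (by positivity) h1)

theorem mul_mem (h : IsRep a b tA tB τ χ ψ δ N) {ζ z : ℂ} (hζ : ζ ∈ rays tA) (hz : z ∈ rays τ) :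
    ζ * z ∈ osec χ :=
  mul_mem_osec h.χ_gt (rays_subset_cleft _ hζ) (rays_subset_cleft _ hz)

theorem innerInt_pole [CompleteSpace 𝔸] (h : IsRep a b tA tB τ χ ψ δ N) (hl : l ≠ 0)
    (hψ : |l.arg| ≤ ψ) {ζ : ℂ} (hζ : ζ ∈ rays tA) :
    innerInt (fun v => (l + v)⁻¹) b τ ζ = -ζ⁻¹ • b (l * (-ζ)⁻¹) := by
  have hm := IsDPG.mem_osec hl (h.arg_lt hψ) (rays_subset_cleft _ hζ)
  have hτπ := h.τ_lt.trans h.tB_lt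
  have := (h.resB.mono h.τ_lt.le).cauchy h.τ_pos hτπ hm
  rw [innerInt, neg_smul, ← smul_neg, ← this, ← cint_smul]
  refine cint_congr h.τ_pos.le hτπ fun z _ => ?_
  rw [smul_smul, ← mul_inv]
  congr 2
  have := hζ.1
  field_simp
  ring

theorem dpgInt_eq_kwInt [CompleteSpace 𝔸] (h : IsRep a b tA tB τ χ ψ δ N) (hl : l ≠ 0)
    (hψ : |l.arg| ≤ ψ) : dpgInt a b tA l = kwInt (fun v => (l + v)⁻¹) a b tA τ :=
  cint_congr h.tA_pos.le h.tA_lt fun ζ hζ => by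
    rw [h.innerInt_pole hl hψ hζ, smul_mul_assoc]

theorem smul_dpgInt_eq_kwInt [CompleteSpace 𝔸] (h : IsRep a b tA tB τ χ ψ δ N) (hl : l ≠ 0)
    (hψ : |l.arg| ≤ ψ) : l • dpgInt a b tA l = kwInt (fun v => l * (l + v)⁻¹) a b tA τ := by
  rw [h.dpgInt_eq_kwInt hl hψ, kwInt, kwInt, ← cint_smul]
  congr 1
  ext ζ
  rw [innerInt, innerInt, ← smul_mul_assoc, ← cint_smul]
  simp only [smul_smul]

theorem isKW_pole (h : IsRep a b tA tB τ χ ψ δ N) (hl : l ≠ 0) (hψ : |l.arg| ≤ ψ) :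
    IsKW (fun v => l * (l + v)⁻¹) χ (Real.sin (δ / 2))⁻¹
      ((Real.sin (δ / 2))⁻¹ * ‖l‖ ^ (1 / 4 : ℝ)) (1 / 4) := by
  have hk := h.sin_pos
  have hln := norm_pos_iff.2 hl
  have hb : ∀ v ∈ osec χ, ‖l * (l + v)⁻¹‖ ≤ (Real.sin (δ / 2))⁻¹ * (‖l‖ / (‖l‖ + ‖v‖)) := by
    intro v hv
    have h1 := h.norm_add_pole_ge hψ hv
    have h2 := norm_pos_iff.2 hv.1
    rw [norm_mul, norm_inv]
    calc _ ≤ ‖l‖ * (Real.sin (δ / 2) * (‖l‖ + ‖v‖))⁻¹ := by gcongr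
      _ = _ := by rw [mul_inv]; ring
  refine ⟨fun v hv => ?_, fun v hv => ?_, fun v hv => ?_, by positivity, by positivity,
    by norm_num, by norm_num⟩
  · exact (((differentiableAt_id.const_add l).inv (h.add_ne_zero hψ hv)).const_mul
      l).differentiableWithinAt
  · refine (hb v hv).trans (mul_le_of_le_one_right (by positivity) ?_)
    exact div_le_one_of_le₀ (by linarith [norm_nonneg v]) (by positivity)
  · refine (hb v hv).trans ?_
    have h2 := norm_pos_iff.2 hv.1
    rw [mul_assoc]
    refine mul_le_mul_of_nonneg_left ?_ (by positivity)
    rw [Real.rpow_neg h2.le, ← div_eq_mul_inv, div_le_div_iff₀ (by positivity) (by positivity)]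
    have e : ∀ x : ℝ, 0 < x → x = x ^ (1 / 4 : ℝ) * x ^ (3 / 4 : ℝ) := fun x hx => by
      rw [← Real.rpow_add hx]; norm_num
    calc ‖l‖ * ‖v‖ ^ (1 / 4 : ℝ) = ‖l‖ ^ (1 / 4 : ℝ) * (‖v‖ ^ (1 / 4 : ℝ) * ‖l‖ ^ (3 / 4 : ℝ)) := by
          conv_lhs => rw [e _ hln]
          ring
      _ ≤ ‖l‖ ^ (1 / 4 : ℝ) *
          ((‖l‖ + ‖v‖) ^ (1 / 4 : ℝ) * (‖l‖ + ‖v‖) ^ (3 / 4 : ℝ)) := by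
          gcongr <;> linarith
      _ = _ := by rw [← e _ (by positivity)]

variable {f : ℂ → ℂ} {κ Cf c : ℝ}

theorem ψ_lt (h : IsRep a b tA tB τ χ ψ δ N) : ψ < π := by
  linarith [h.χ_pos, h.δ_pos, h.sum_le]

theorem sin_pos' (h : IsRep a b tA tB τ χ ψ δ N) : 0 < Real.sin ((π - ψ) / 2) :=
  sin_half_pos (by linarith [h.ψ_lt]) (by linarith [h.ψ_pos])

theorem add_const_ne_zero (h : IsRep a b tA tB τ χ ψ δ N) (hc : 0 < c) {z : ℂ}
    (hz : z ∈ Sector ψ) : z + c ≠ 0 := by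
  have h1 := norm_add_ofReal_ge h.ψ_lt hz hc.le
  have := h.sin_pos'
  exact norm_pos_iff.1 (lt_of_lt_of_le (by positivity) h1)

theorem neg_sub_mem_oleft (h : IsRep a b tA tB τ χ ψ δ N) (hc : 0 < c) {v : ℂ}
    (hv : v ∈ osec χ) : -c - v ∈ oleft (ψ + δ) := by
  have h0 : v + c ≠ 0 := by
    have := h.add_ne_zero (l := c) (by simpa [Complex.arg_ofReal_of_nonneg hc.le] using h.ψ_pos.le)
      hv
    rwa [add_comm]
  have h1 := abs_arg_add_ofReal_le v hc.le
  have e : -(c : ℂ) - v = -(v + c) := by ring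
  rw [e]
  refine ⟨neg_ne_zero.2 h0, ?_⟩
  rw [abs_arg_neg h0]
  linarith [hv.2, h.sum_le]

theorem isKW_shift (h : IsRep a b tA tB τ χ ψ δ N) (hc : 0 < c)
    (hd : DifferentiableOn ℂ f (oleft (ψ + δ))) {M : ℝ} (hM : 0 < M)
    (hfM : ∀ w ∈ oleft (ψ + δ), ‖f w‖ ≤ M) (hκ0 : 0 < κ) (hκ1 : κ < 1 / 2) (hCf : 0 ≤ Cf)
    (hfb : ∀ w ∈ oleft (ψ + δ), ‖f w‖ ≤ Cf * ‖w‖ ^ (-κ)) :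
    IsKW (fun v => f (-c - v)) χ M (Cf * Real.sin (δ / 2) ^ (-κ)) κ := by
  have hk := h.sin_pos
  refine ⟨?_, fun v hv => hfM _ (h.neg_sub_mem_oleft hc hv), fun v hv => ?_, hM, by positivity,
    hκ0, hκ1⟩
  · exact hd.comp (differentiableOn_id.const_sub (-(c : ℂ)))
      fun v hv => h.neg_sub_mem_oleft hc hv
  · have h1 := h.neg_sub_mem_oleft hc hv
    have h2 := h.norm_add_pole_ge (l := c)
      (by simpa [Complex.arg_ofReal_of_nonneg hc.le] using h.ψ_pos.le) hv
    have h3 := norm_pos_iff.2 hv.1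
    refine (hfb _ h1).trans ?_
    rw [mul_assoc, ← Real.mul_rpow hk.le h3.le]
    refine mul_le_mul_of_nonneg_left (Real.rpow_le_rpow_of_nonpos (by positivity) ?_
      (by linarith)) hCf
    have e : -(c : ℂ) - v = -(c + v) := by ring
    rw [e, norm_neg]
    refine le_trans ?_ h2
    gcongr
    linarith [norm_nonneg (c : ℂ)]

end IsRep

namespace IsRep

variable {𝔸 : Type*} [NormedRing 𝔸] [NormedAlgebra ℂ 𝔸] {a b : ℂ → 𝔸}
  {tA tB τ χ ψ δ N : ℝ} {f : ℂ → ℂ} {κ Cf c : ℝ}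

theorem double_kernel_bound {k κ C1 C2 x y u v w : ℝ} (hk : 0 < k) (h0 : 0 < κ) (h1 : κ < 1)
    (hx : 0 < x) (hy : 0 < y) (hC1 : 0 ≤ C1) (hC2 : 0 ≤ C2) (hu : u ≤ C1 * x ^ (-κ))
    (hv0 : 0 ≤ v) (hw0 : 0 ≤ w)
    (hv : v ≤ (k * (x + y))⁻¹) (hw : w ≤ C2 / (1 + y)) :
    x * y * (u * (v * w)) ≤ 4 * C1 * C2 / k *
      (mdec (min κ (1 - κ) / 2) x * mdec (min κ (1 - κ) / 2) y) := by
  calc x * y * (u * (v * w)) ≤ x * y * (C1 * x ^ (-κ) * ((k * (x + y))⁻¹ * (C2 / (1 + y)))) := by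
        gcongr
    _ = C1 * C2 / k * (x ^ (1 - κ) * y / ((x + y) * (1 + y))) := by
        rw [Real.rpow_sub hx, Real.rpow_one, Real.rpow_neg hx.le]
        have := (Real.rpow_pos_of_pos hx κ).ne'
        field_simp
    _ ≤ C1 * C2 / k * (4 * (mdec (min κ (1 - κ) / 2) x * mdec (min κ (1 - κ) / 2) y)) :=
        mul_le_mul_of_nonneg_left (double_kernel_le h0 h1 hx hy) (by positivity)
    _ = _ := by ring

theorem norm_add_const_ge (h : IsRep a b tA tB τ χ ψ δ N) (hc : 0 ≤ c) {z : ℂ}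
    (hz : z ∈ Sector ψ) : Real.sin ((π - ψ) / 2) * ‖z‖ ≤ ‖z + c‖ := by
  refine le_trans ?_ (norm_add_ofReal_ge h.ψ_lt hz hc)
  have := h.sin_pos'
  gcongr
  linarith

theorem outer_bound (h : IsRep a b tA tB τ χ ψ δ N) (hc : 0 < c) (hκ0 : 0 < κ) (hκ1 : κ < 1)
    (hCf : 0 ≤ Cf) (hfb : ∀ w ∈ rays ψ, ‖f w‖ ≤ Cf * ‖w‖ ^ (-κ)) {z : ℂ} (hz : z ∈ rays ψ)
    {ζ : ℂ} (hζ : ζ ∈ rays tA) :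
    ‖z‖ * ‖ζ‖ * ‖f z • (-ζ⁻¹ • (b ((z + c) * (-ζ)⁻¹) * a ζ))‖ ≤
      4 * Cf * (N * N) / Real.sin ((π - ψ) / 2) *
        (mdec (min κ (1 - κ) / 2) ‖z‖ * mdec (min κ (1 - κ) / 2) ‖ζ‖) := by
  have hzp := norm_pos_iff.2 hz.1
  have hζp := norm_pos_iff.2 hζ.1
  have hN := h.N_nonneg
  have hk := h.sin_pos'
  have hk1 := Real.sin_le_one ((π - ψ) / 2)
  have hzs : z ∈ Sector ψ := hz.2.le
  have hne := h.add_const_ne_zero hc hzs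
  have hge := h.norm_add_const_ge hc.le hzs
  have hm := osec_subset_csec _ (IsDPG.mem_osec hne
    (h.arg_lt (add_ofReal_mem_sector hzs hc.le)) (rays_subset_cleft _ hζ))
  have hb := h.resB.norm_le (csec_subset_sector h.τ_lt.le hm)
  have ha := h.resA.norm_le (z := ζ) hζ.2.le
  rw [norm_mul_neg_inv] at hb
  set k := Real.sin ((π - ψ) / 2)
  rw [norm_smul, norm_smul, norm_neg, norm_inv]
  refine le_trans ?_ (double_kernel_bound hk hκ0 hκ1 hzp hζp hCf (mul_nonneg hN hN) (hfb z hz)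
    (v := (k * (‖z‖ + ‖ζ‖))⁻¹) (w := N * N / (1 + ‖ζ‖)) (by positivity) (by positivity) le_rfl
    le_rfl)
  have h1 : ‖ζ‖⁻¹ * (N / (1 + ‖z + c‖ / ‖ζ‖)) ≤ (k * (‖z‖ + ‖ζ‖))⁻¹ * N := by
    have e : ‖ζ‖⁻¹ * (N / (1 + ‖z + c‖ / ‖ζ‖)) = (‖ζ‖ + ‖z + c‖)⁻¹ * N := by
      field_simp
    rw [e]
    gcongr
    nlinarith
  have h2 : ‖ζ‖⁻¹ * ‖b ((z + c) * (-ζ)⁻¹) * a ζ‖ ≤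
      (k * (‖z‖ + ‖ζ‖))⁻¹ * (N * N / (1 + ‖ζ‖)) := by
    calc _ ≤ ‖ζ‖⁻¹ * (N / (1 + ‖z + c‖ / ‖ζ‖) * (N / (1 + ‖ζ‖))) := by
          gcongr
          exact (norm_mul_le _ _).trans (mul_le_mul hb ha (norm_nonneg _) (by positivity))
      _ = (‖ζ‖⁻¹ * (N / (1 + ‖z + c‖ / ‖ζ‖))) * (N / (1 + ‖ζ‖)) := by ring
      _ ≤ (k * (‖z‖ + ‖ζ‖))⁻¹ * N * (N / (1 + ‖ζ‖)) := by gcongr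
      _ = _ := by ring
  gcongr

theorem inner_bound (h : IsRep a b tA tB τ χ ψ δ N) (hc : 0 < c) (hκ0 : 0 < κ) (hκ1 : κ < 1)
    (hCf : 0 ≤ Cf) (hfb : ∀ w ∈ rays ψ, ‖f w‖ ≤ Cf * ‖w‖ ^ (-κ)) {ζ : ℂ} (hζ : ζ ∈ rays tA)
    {w : ℂ} (hw : w ∈ rays ψ) {z : ℂ} (hz : z ∈ rays τ) :
    ‖w‖ * ‖z‖ * ‖f w • ((w + c + ζ * z)⁻¹ • b z)‖ ≤
      4 * Cf * N / (Real.sin (δ / 2) * min (Real.sin ((π - ψ) / 2)) ‖ζ‖) *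
        (mdec (min κ (1 - κ) / 2) ‖w‖ * mdec (min κ (1 - κ) / 2) ‖z‖) := by
  have hzp := norm_pos_iff.2 hz.1
  have hwp := norm_pos_iff.2 hw.1
  have hζp := norm_pos_iff.2 hζ.1
  have hN := h.N_nonneg
  have hk := h.sin_pos
  have hk' := h.sin_pos'
  have hws : w ∈ Sector ψ := hw.2.le
  have hge := h.norm_add_const_ge hc.le hws
  have hp := h.norm_add_pole_ge (add_ofReal_mem_sector hws hc.le) (h.mul_mem hζ hz)
  rw [norm_smul, norm_smul]
  refine double_kernel_bound (by positivity) hκ0 hκ1 hwp hzp hCf hN (hfb w hw) (norm_nonneg _)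
    (norm_nonneg _) ?_ (h.resB.norm_le (hz.2.le.trans h.τ_lt.le))
  rw [norm_inv]
  refine inv_anti₀ (by positivity) (le_trans ?_ hp)
  rw [mul_assoc, norm_mul]
  gcongr
  have h1 := mul_le_mul_of_nonneg_right (min_le_left (Real.sin ((π - ψ) / 2)) ‖ζ‖) hwp.le
  have h2 := mul_le_mul_of_nonneg_right (min_le_right (Real.sin ((π - ψ) / 2)) ‖ζ‖) hzp.le
  linarith

theorem continuousOn_outer (h : IsRep a b tA tB τ χ ψ δ N) (hc : 0 < c)
    (hfc : ContinuousOn f (rays ψ)) :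
    ContinuousOn (Function.uncurry fun z ζ => f z • (-ζ⁻¹ • (b ((z + c) * (-ζ)⁻¹) * a ζ)))
      (rays ψ ×ˢ rays tA) := by
  have h2 : ContinuousOn (fun p : ℂ × ℂ => p.2⁻¹) (rays ψ ×ˢ rays tA) :=
    continuousOn_snd.inv₀ fun p hp => hp.2.1
  have h3 : ContinuousOn (fun p : ℂ × ℂ => (-p.2)⁻¹) (rays ψ ×ˢ rays tA) :=
    continuousOn_snd.neg.inv₀ fun p hp => neg_ne_zero.2 hp.2.1
  refine (hfc.comp continuousOn_fst fun p hp => hp.1).smul (h2.neg.smul (ContinuousOn.mul ?_ ?_))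
  · refine h.resB.continuousOn.comp ((continuousOn_fst.add continuousOn_const).mul h3) ?_
    intro p hp
    have hzs : p.1 ∈ Sector ψ := hp.1.2.le
    exact csec_subset_sector h.τ_lt.le (osec_subset_csec _ (IsDPG.mem_osec
      (h.add_const_ne_zero hc hzs) (h.arg_lt (add_ofReal_mem_sector hzs hc.le))
      (rays_subset_cleft _ hp.2)))
  · exact (h.resA.continuousOn_rays le_rfl).comp continuousOn_snd fun p hp => hp.2

theorem continuousOn_inner (h : IsRep a b tA tB τ χ ψ δ N) (hc : 0 < c)
    (hfc : ContinuousOn f (rays ψ)) {ζ : ℂ} (hζ : ζ ∈ rays tA) :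
    ContinuousOn (Function.uncurry fun w z => f w • ((w + c + ζ * z)⁻¹ • b z))
      (rays ψ ×ˢ rays τ) := by
  refine (hfc.comp continuousOn_fst fun p hp => hp.1).smul (ContinuousOn.smul ?_ ?_)
  · refine ContinuousOn.inv₀ (by fun_prop) fun p hp => ?_
    exact h.add_ne_zero (add_ofReal_mem_sector (hp.1.2.le : p.1 ∈ Sector ψ) hc.le)
      (h.mul_mem hζ hp.2)
  · exact (h.resB.continuousOn_rays h.τ_lt.le).comp continuousOn_snd fun p hp => hp.2

variable [CompleteSpace 𝔸]

theorem cint_inner (h : IsRep a b tA tB τ χ ψ δ N) (hc : 0 < c) (hκ0 : 0 < κ) (hκ1 : κ < 1)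
    (hfc : ContinuousOn f (cleft ψ)) (hfd : DifferentiableOn ℂ f (oleft ψ))
    (hfb : ∀ w ∈ cleft ψ, ‖f w‖ ≤ Cf * ‖w‖ ^ (-κ)) {ζ : ℂ} (hζ : ζ ∈ rays tA)
    {z : ℂ} (hz : z ∈ rays τ) :
    cint ψ (fun w => f w • ((w + c + ζ * z)⁻¹ • b z)) = f (-c - ζ * z) • b z := by
  have hm := oleft_anti (by linarith [h.δ_pos] : ψ ≤ ψ + δ)
    (h.neg_sub_mem_oleft hc (h.mul_mem hζ hz))
  rw [← cauchy_oleft (f := fun w => f w • b z) (C := Cf * ‖b z‖) h.ψ_pos h.ψ_lt hκ0 hκ1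
    (hfc.smul continuousOn_const) (hfd.smul_const _) (fun w hw => ?_) hm]
  · congr 1
    ext w
    have e : w - (-c - ζ * z) = w + c + ζ * z := by ring
    rw [e, smul_smul, smul_smul, mul_comm]
  · rw [norm_smul, mul_right_comm]
    exact mul_le_mul_of_nonneg_right (hfb w hw) (norm_nonneg _)

theorem cint_smul_dpgInt (h : IsRep a b tA tB τ χ ψ δ N) (hc : 0 < c) (hκ0 : 0 < κ)
    (hκ1 : κ < 1) (hCf : 0 ≤ Cf)
    (hfc : ContinuousOn f (cleft ψ)) (hfd : DifferentiableOn ℂ f (oleft ψ))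
    (hfb : ∀ w ∈ cleft ψ, ‖f w‖ ≤ Cf * ‖w‖ ^ (-κ)) :
    cint ψ (fun z => f z • dpgInt a b tA (z + c)) = kwInt (fun v => f (-c - v)) a b tA τ := by
  have hν : 0 < min κ (1 - κ) / 2 := by
    have := lt_min hκ0 (sub_pos.2 hκ1)
    positivity
  have hfc' := hfc.mono (rays_subset_cleft ψ)
  have hfb' : ∀ w ∈ rays ψ, ‖f w‖ ≤ Cf * ‖w‖ ^ (-κ) :=
    fun w hw => hfb w (rays_subset_cleft _ hw)
  have hτπ := h.τ_lt.trans h.tB_lt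
  simp only [dpgInt, ← cint_smul]
  rw [cint_swap h.ψ_pos.le h.ψ_lt h.tA_pos.le h.tA_lt hν (h.continuousOn_outer hc hfc')
    fun z hz ζ hζ => h.outer_bound hc hκ0 hκ1 hCf hfb' hz hζ]
  refine cint_congr h.tA_pos.le h.tA_lt fun ζ hζ => ?_
  have hic := h.continuousOn_inner hc hfc' hζ
  have hib := fun w hw z hz => h.inner_bound hc hκ0 hκ1 hCf hfb' hζ (w := w) hw (z := z) hz
  have hI := ctrIntegrable_cint h.ψ_pos.le h.ψ_lt h.τ_pos.le hτπ hν hic hib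
  have e := cint_clm ((ContinuousLinearMap.mul ℂ 𝔸).flip (a ζ)) hI
  simp only [ContinuousLinearMap.flip_apply, ContinuousLinearMap.mul_apply'] at e
  rw [cint_swap h.ψ_pos.le h.ψ_lt h.τ_pos.le hτπ hν hic hib,
    cint_congr h.τ_pos.le hτπ fun z hz => h.cint_inner hc hκ0 hκ1 hfc hfd hfb hζ hz] at e
  rw [innerInt, ← e]
  refine cint_congr h.ψ_pos.le h.ψ_lt fun z hz => ?_
  have hzs : z ∈ Sector ψ := hz.2.le
  rw [← smul_mul_assoc, ← h.innerInt_pole (h.add_const_ne_zero hc hzs)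
    (add_ofReal_mem_sector hzs hc.le) hζ, ← smul_mul_assoc, innerInt, ← cint_smul]

end IsRep

section Product

variable {𝔸 : Type*} [NormedRing 𝔸] [NormedAlgebra ℂ 𝔸]

/-- The resolvent `(AB + l)⁻¹`, expressed through `(AB)⁻¹ = B⁻¹ A⁻¹`. -/
def prodRes (a b : ℂ → 𝔸) (l : ℂ) : 𝔸 := b 0 * a 0 * Ring.inverse (1 + l • (b 0 * a 0))

variable {a b L : ℂ → 𝔸} {tA tB N α β τ χ ψ δ : ℝ}

theorem prodRes_mul_cancel {l : ℂ} (hu : IsUnit (1 + l • (b 0 * a 0))) :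
    prodRes a b l * (1 + l • (b 0 * a 0)) = b 0 * a 0 := by
  rw [prodRes, mul_assoc, Ring.inverse_mul_cancel _ hu, mul_one]

theorem mul_prodRes_cancel {l : ℂ} (hu : IsUnit (1 + l • (b 0 * a 0))) :
    (1 + l • (b 0 * a 0)) * prodRes a b l = b 0 * a 0 := by
  have hc : (1 + l • (b 0 * a 0)) * (b 0 * a 0) = b 0 * a 0 * (1 + l • (b 0 * a 0)) := by
    rw [add_mul, mul_add, one_mul, mul_one, smul_mul_assoc, mul_smul_comm]
  rw [prodRes, ← mul_assoc, hc, mul_assoc, Ring.mul_inverse_cancel _ hu, mul_one]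

theorem prodRes_sub {z w : ℂ} (hz : IsUnit (1 + z • (b 0 * a 0)))
    (hw : IsUnit (1 + w • (b 0 * a 0))) :
    prodRes a b z - prodRes a b w = (w - z) • (prodRes a b z * prodRes a b w) := by
  have h1 : prodRes a b z * (1 + w • (b 0 * a 0)) * Ring.inverse (1 + w • (b 0 * a 0)) =
      prodRes a b z := by
    rw [mul_assoc, Ring.mul_inverse_cancel _ hw, mul_one]
  have h2 : b 0 * a 0 * Ring.inverse (1 + w • (b 0 * a 0)) =
      prodRes a b z * (1 + z • (b 0 * a 0)) * Ring.inverse (1 + w • (b 0 * a 0)) := by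
    rw [prodRes_mul_cancel hz]
  conv_lhs => rw [← h1]
  rw [show prodRes a b w = b 0 * a 0 * Ring.inverse (1 + w • (b 0 * a 0)) from rfl, h2,
    ← sub_mul, ← mul_sub, add_sub_add_left_eq_sub, ← sub_smul, ← h2, mul_smul_comm,
    smul_mul_assoc]
  simp only [mul_assoc]

namespace IsDPG

theorem prodRes_mul_one_add [CompleteSpace 𝔸] (h : IsDPG a b L tA tB N α β) {l : ℂ} (hl : l ≠ 0)
    (hlt : |l.arg| + (π - tA) < tB) (hu : IsUnit (1 + l • (b 0 * a 0))) :
    prodRes a b l * (1 + dpgErr a b L tA l) = dpgInt a b tA l := by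
  have e := h.mul_dpgInt hl hlt
  refine hu.mul_left_cancel ?_
  rw [e, ← mul_assoc, mul_prodRes_cancel hu]

/-- Comparison of the resolvent of the product with its Da Prato–Grisvard approximation. -/
theorem prodRes_bounds [CompleteSpace 𝔸] (h : IsDPG a b L tA tB N α β) {l : ℂ} (hl : l ≠ 0)
    (hlt : |l.arg| + (π - tA) < tB) (hu : IsUnit (1 + l • (b 0 * a 0)))
    (hE : ‖dpgErr a b L tA l‖ ≤ 1 / 2) :
    ‖prodRes a b l‖ ≤ ‖dpgInt a b tA l‖ * (2 * ‖(1 : 𝔸)‖) ∧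
    ‖prodRes a b l - dpgInt a b tA l‖ ≤
      ‖dpgInt a b tA l‖ * (‖dpgErr a b L tA l‖ * (2 * ‖(1 : 𝔸)‖)) := by
  set E := dpgErr a b L tA l
  set S := dpgInt a b tA l
  have hj : (1 + E) * Ring.inverse (1 + E) = 1 :=
    Ring.mul_inverse_cancel _ (isUnit_one_add (by linarith))
  set J := Ring.inverse (1 + E)
  have hJ := norm_le_of_mul_eq_one hE hj
  have hR : prodRes a b l = S * J := by
    rw [show S = prodRes a b l * (1 + E) from (h.prodRes_mul_one_add hl hlt hu).symm, mul_assoc,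
      hj, mul_one]
  have hd : prodRes a b l - S = -(S * (E * J)) := by
    have e : J = 1 - E * J := by rw [← hj]; noncomm_ring
    conv_lhs => rw [hR, e]
    noncomm_ring
  constructor
  · rw [hR]
    exact (norm_mul_le _ _).trans (by gcongr)
  · rw [hd, norm_neg]
    refine (norm_mul_le _ _).trans ?_
    gcongr
    exact (norm_mul_le _ _).trans (by gcongr)

end IsDPG

/-- The data under which the resolvent of `AB + c` is controlled on a sector. -/
structure IsProdRes (a b L : ℂ → 𝔸) (tA tB N α β τ χ ψ δ CK c k : ℝ) : Prop where
  dpg : IsDPG a b L tA tB N α β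
  rep : IsRep a b tA tB τ χ ψ δ N
  CK_nonneg : 0 ≤ CK
  kw : ∀ (φ : ℂ → ℂ) (M D η : ℝ), IsKW φ χ M D η → ‖kwInt φ a b tA τ‖ ≤ CK * M
  c_pos : 0 < c
  k_pos : 0 < k
  norm_ge : ∀ z ∈ Sector ψ, k * (1 + ‖z‖) ≤ ‖z + c‖
  unit : ∀ z ∈ Sector ψ, IsUnit (1 + (z + c) • (b 0 * a 0))
  err : ∀ z ∈ Sector ψ, ‖dpgErr a b L tA (z + c)‖ ≤ 1 / 2

theorem IsDPG.exists_isProdRes [CompleteSpace 𝔸] (h : IsDPG a b L tA tB N α β)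
    (hr : IsRep a b tA tB τ χ ψ δ N) {CK : ℝ} (hCK : 0 ≤ CK)
    (hkw : ∀ (φ : ℂ → ℂ) (M D η : ℝ), IsKW φ χ M D η → ‖kwInt φ a b tA τ‖ ≤ CK * M) :
    ∃ c k : ℝ, IsProdRes a b L tA tB N α β τ χ ψ δ CK c k := by
  obtain ⟨c0, hc0, hc⟩ := h.exists_isUnit
  have hk := hr.sin_pos'
  set k := Real.sin ((π - ψ) / 2) with hkdef
  set c := max 1 (c0 / k)
  have hc1 : 1 ≤ c := le_max_left _ _
  have hck : c0 ≤ k * c := by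
    rw [mul_comm, ← div_le_iff₀ hk]
    exact le_max_right _ _
  have hcp : 0 < c := by linarith
  have hge : ∀ z ∈ Sector ψ, k * (‖z‖ + c) ≤ ‖z + c‖ :=
    fun z hz => norm_add_ofReal_ge hr.ψ_lt hz hcp.le
  have hmain := fun z (hz : z ∈ Sector ψ) => hc (z + c) (by
    have := hge z hz
    have := mul_nonneg hk.le (norm_nonneg z)
    linarith) ((hr.arg_lt (add_ofReal_mem_sector hz hcp.le)).trans hr.τ_lt)
  refine ⟨c, k, h, hr, hCK, hkw, hcp, hk, fun z hz => (hge z hz).trans' ?_,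
    fun z hz => (hmain z hz).2, fun z hz => (hmain z hz).1⟩
  rw [add_comm]
  gcongr

namespace IsProdRes

variable {CK c k : ℝ}

theorem ne_zero (h : IsProdRes a b L tA tB N α β τ χ ψ δ CK c k) {z : ℂ} (hz : z ∈ Sector ψ) :
    z + c ≠ 0 := h.rep.add_const_ne_zero h.c_pos hz

theorem mem (h : IsProdRes a b L tA tB N α β τ χ ψ δ CK c k) {z : ℂ} (hz : z ∈ Sector ψ) :
    z + c ∈ Sector ψ := add_ofReal_mem_sector hz h.c_pos.le

theorem arg_lt (h : IsProdRes a b L tA tB N α β τ χ ψ δ CK c k) {z : ℂ} (hz : z ∈ Sector ψ) :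
    |(z + c).arg| + (π - tA) < tB := (h.rep.arg_lt (h.mem hz)).trans h.rep.τ_lt

theorem norm_dpgInt_le [CompleteSpace 𝔸] (h : IsProdRes a b L tA tB N α β τ χ ψ δ CK c k)
    {z : ℂ} (hz : z ∈ Sector ψ) :
    ‖dpgInt a b tA (z + c)‖ ≤ CK * (Real.sin (δ / 2))⁻¹ / ‖z + c‖ := by
  have hp := norm_pos_iff.2 (h.ne_zero hz)
  rw [le_div_iff₀ hp, mul_comm, ← norm_smul,
    h.rep.smul_dpgInt_eq_kwInt (h.ne_zero hz) (h.mem hz)]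
  exact h.kw _ _ _ _ (h.rep.isKW_pole (h.ne_zero hz) (h.mem hz))

theorem isPRes [CompleteSpace 𝔸] (h : IsProdRes a b L tA tB N α β τ χ ψ δ CK c k) :
    IsPRes (fun z => prodRes a b (z + c)) ψ
      (CK * (Real.sin (δ / 2))⁻¹ / k * (2 * ‖(1 : 𝔸)‖)) := by
  constructor
  · intro z hz
    have hb := (h.dpg.prodRes_bounds (h.ne_zero hz) (h.arg_lt hz) (h.unit z hz) (h.err z hz)).1
    have hs := h.norm_dpgInt_le hz
    have hp := norm_pos_iff.2 (h.ne_zero hz)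
    have hk := h.k_pos
    have hC := mul_nonneg h.CK_nonneg (inv_nonneg.2 h.rep.sin_pos.le)
    have hg := h.norm_ge z hz
    have h1 : (1 + ‖z‖) * ‖dpgInt a b tA (z + c)‖ ≤ CK * (Real.sin (δ / 2))⁻¹ / k := by
      calc (1 + ‖z‖) * ‖dpgInt a b tA (z + c)‖
          ≤ (‖z + c‖ / k) * (CK * (Real.sin (δ / 2))⁻¹ / ‖z + c‖) := by
            gcongr
            rw [le_div_iff₀ hk]
            linarith
        _ = _ := by field_simp
    calc (1 + ‖z‖) * ‖prodRes a b (z + c)‖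
        ≤ (1 + ‖z‖) * (‖dpgInt a b tA (z + c)‖ * (2 * ‖(1 : 𝔸)‖)) := by gcongr
      _ = (1 + ‖z‖) * ‖dpgInt a b tA (z + c)‖ * (2 * ‖(1 : 𝔸)‖) := by ring
      _ ≤ _ := by gcongr
  · intro z hz w hw
    rw [prodRes_sub (h.unit z hz) (h.unit w hw), add_sub_add_right_eq_sub]

theorem exists_norm_sub_le [CompleteSpace 𝔸] (h : IsProdRes a b L tA tB N α β τ χ ψ δ CK c k) :
    ∃ C : ℝ, 0 ≤ C ∧ ∀ z ∈ rays ψ,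
      ‖z‖ * ‖prodRes a b (z + c) - dpgInt a b tA (z + c)‖ ≤ C * mdec (min 1 β) ‖z‖ := by
  have hk := h.k_pos
  have hN := h.dpg.N_nonneg
  have hβ := h.dpg.β_pos
  have hC := mul_nonneg h.CK_nonneg (inv_nonneg.2 h.rep.sin_pos.le)
  have hm := mdecMass_nonneg (min β (1 - α - β))
  set C1 := CK * (Real.sin (δ / 2))⁻¹
  set C2 := N * mdecMass (min β (1 - α - β))
  have hC2 : 0 ≤ C2 := mul_nonneg hN hm
  refine ⟨C1 * C2 * (2 * ‖(1 : 𝔸)‖) * (2 / k ^ (1 + β)), by positivity, fun z hz => ?_⟩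
  have hzs : z ∈ Sector ψ := hz.2.le
  have hzp := norm_pos_iff.2 hz.1
  have hp := norm_pos_iff.2 (h.ne_zero hzs)
  have hs := h.norm_dpgInt_le hzs
  have he : ‖dpgErr a b L tA (z + c)‖ ≤ C2 * ‖z + c‖ ^ (-β) := by
    refine (h.dpg.norm_dpgErr_le (h.ne_zero hzs) (h.arg_lt hzs)).trans_eq ?_
    ring
  have hb := (h.dpg.prodRes_bounds (h.ne_zero hzs) (h.arg_lt hzs) (h.unit z hzs)
    (h.err z hzs)).2
  have hg := h.norm_ge z hzs
  have h1 : k ^ (1 + β) * ((1 + ‖z‖ ^ (1 + β)) / 2) ≤ ‖z + c‖ ^ (1 + β) := by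
    have e1 : 1 ≤ (1 + ‖z‖) ^ (1 + β) := Real.one_le_rpow (by linarith) (by linarith)
    have e2 : ‖z‖ ^ (1 + β) ≤ (1 + ‖z‖) ^ (1 + β) :=
      Real.rpow_le_rpow hzp.le (by linarith) (by linarith)
    calc _ ≤ k ^ (1 + β) * (1 + ‖z‖) ^ (1 + β) := by gcongr; linarith
      _ = (k * (1 + ‖z‖)) ^ (1 + β) := (Real.mul_rpow hk.le (by positivity)).symm
      _ ≤ _ := Real.rpow_le_rpow (by positivity) hg (by linarith)
  have h2 : ‖z‖ / (1 + ‖z‖ ^ (1 + β)) ≤ mdec (min 1 β) ‖z‖ := by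
    have := rpow_div_one_add_rpow_le (β := 1) (γ := 1 + β) hzp
    rwa [Real.rpow_one, add_sub_cancel_left] at this
  calc ‖z‖ * ‖prodRes a b (z + c) - dpgInt a b tA (z + c)‖
      ≤ ‖z‖ * (C1 / ‖z + c‖ * (C2 * ‖z + c‖ ^ (-β) * (2 * ‖(1 : 𝔸)‖))) := by
        gcongr
        exact hb.trans (by gcongr)
    _ = C1 * C2 * (2 * ‖(1 : 𝔸)‖) * (‖z‖ / ‖z + c‖ ^ (1 + β)) := by
        rw [Real.rpow_add hp, Real.rpow_one, Real.rpow_neg hp.le]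
        field_simp
    _ ≤ C1 * C2 * (2 * ‖(1 : 𝔸)‖) * (‖z‖ / (k ^ (1 + β) * ((1 + ‖z‖ ^ (1 + β)) / 2))) := by
        gcongr
    _ = C1 * C2 * (2 * ‖(1 : 𝔸)‖) * (2 / k ^ (1 + β)) * (‖z‖ / (1 + ‖z‖ ^ (1 + β))) := by
        field_simp
    _ ≤ _ := by gcongr

theorem ctrIntegrable_smul_dpgInt (h : IsProdRes a b L tA tB N α β τ χ ψ δ CK c k) {f : ℂ → ℂ}
    {κ Cf : ℝ} (hκ0 : 0 < κ) (hκ1 : κ < 1) (hCf : 0 ≤ Cf) (hfc : ContinuousOn f (rays ψ))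
    (hfb : ∀ w ∈ rays ψ, ‖f w‖ ≤ Cf * ‖w‖ ^ (-κ)) :
    CtrIntegrable ψ fun z => f z • dpgInt a b tA (z + c) := by
  have hν : 0 < min κ (1 - κ) / 2 := by
    have := lt_min hκ0 (sub_pos.2 hκ1)
    positivity
  simp only [dpgInt, ← cint_smul]
  exact ctrIntegrable_cint h.rep.ψ_pos.le h.rep.ψ_lt h.rep.tA_pos.le h.rep.tA_lt hν
    (h.rep.continuousOn_outer h.c_pos hfc)
    fun z hz ζ hζ => h.rep.outer_bound h.c_pos hκ0 hκ1 hCf hfb hz hζ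

end IsProdRes

theorem MemH0.exists_rpow {θ : ℝ} {f : ℂ → ℂ} (hf : MemH0 θ f) (hθ : 0 ≤ θ) :
    ∃ κ Cf : ℝ, 0 < κ ∧ κ < 1 / 2 ∧ 0 ≤ Cf ∧ ∀ w ∈ oleft θ, ‖f w‖ ≤ Cf * ‖w‖ ^ (-κ) := by
  obtain ⟨-, C, η, hC, hη, hb⟩ := hf
  have hκ : 0 < min η (1 / 4) := lt_min hη (by norm_num)
  refine ⟨min η (1 / 4), C, hκ, (min_le_right _ _).trans_lt (by norm_num),
    hC.le, fun w hw => ?_⟩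
  have hp := norm_pos_iff.2 hw.1
  refine (hb w (by rwa [oleft_eq_compl hθ] at hw)).trans ?_
  gcongr
  calc (‖w‖ / (1 + ‖w‖ ^ 2)) ^ η ≤ (‖w‖ / (1 + ‖w‖ ^ 2)) ^ min η (1 / 4) := by
        refine Real.rpow_le_rpow_of_exponent_ge (by positivity) ?_ (min_le_left _ _)
        rw [div_le_one (by positivity)]
        nlinarith [sq_nonneg (‖w‖ - 1)]
    _ ≤ ‖w‖⁻¹ ^ min η (1 / 4) := by
        refine Real.rpow_le_rpow (by positivity) ?_ hκ.le
        rw [div_le_iff₀ (by positivity), mul_add, mul_one, sq, inv_mul_cancel_left₀ hp.ne']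
        have := inv_pos.2 hp
        linarith
    _ = _ := by rw [Real.inv_rpow hp.le, Real.rpow_neg hp.le]

end Product

section Operator

variable {X : Type u} [NormedAddCommGroup X] [NormedSpace ℂ X] [CompleteSpace X]

theorem IsProdRes.hasBddHCalc {a b L : ℂ → X →L[ℂ] X} {tA tB N α β τ χ ψ δ CK c k θ : ℝ}
    (h : IsProdRes a b L tA tB N α β τ χ ψ δ CK c k) (hθ : 0 ≤ θ) (hψ : θ < ψ) :
    HasBddHCalc (fun z => prodRes a b (z + c)) ψ θ := by
  obtain ⟨C1, hC1, hsub⟩ := h.exists_norm_sub_le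
  have hm := mdecMass_nonneg (min 1 β)
  have hCK := h.CK_nonneg
  have hβ : 0 < min 1 β := lt_min one_pos h.dpg.β_pos
  have hψ0 := h.rep.ψ_pos
  have hψπ := h.rep.ψ_lt
  refine ⟨CK + C1 * mdecMass (min 1 β) + 1, by positivity, fun f hf M hM => ?_⟩
  obtain ⟨κ, Cf, hκ0, hκ1, hCf, hfb⟩ := hf.exists_rpow hθ
  have hfd : DifferentiableOn ℂ f (oleft θ) := by rw [oleft_eq_compl hθ]; exact hf.1
  rw [show (∀ z ∉ Sector θ, ‖f z‖ ≤ M) ↔ ∀ z ∈ oleft θ, ‖f z‖ ≤ M by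
    rw [oleft_eq_compl hθ]; rfl] at hM
  have hM0 : 0 ≤ M := (norm_nonneg _).trans (hM (-1) ⟨by simp, by
    rw [Complex.arg_neg_one, abs_of_pos Real.pi_pos]; linarith⟩)
  have hδ := h.rep.δ_pos
  have hsub1 : oleft (ψ + δ) ⊆ oleft θ := oleft_anti (by linarith)
  have hsub2 : cleft ψ ⊆ oleft θ := cleft_subset_oleft hψ
  have hsub3 := rays_subset_cleft ψ
  have hκ1' : κ < 1 := by linarith
  have hfc := hfd.continuousOn
  have hI1 := h.ctrIntegrable_smul_dpgInt hκ0 hκ1' hCf (hfc.mono (hsub3.trans hsub2))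
    fun w hw => hfb w (hsub2 (hsub3 hw))
  have hI2 : CtrIntegrable ψ fun z => f z • prodRes a b (z + c) :=
    ctrIntegrable_smul hψ0.le hψπ hκ0 hκ1' (hfc.mono (hsub3.trans hsub2))
      (fun w hw => hfb w (hsub2 (hsub3 hw))) (h.isPRes.continuousOn_rays le_rfl)
      fun w hw => h.isPRes.norm_le hw.2.le
  rw [fCalc_eq_cint hI2]
  have h1 : ‖cint ψ (fun z => f z • prodRes a b (z + c)) -
      cint ψ (fun z => f z • dpgInt a b tA (z + c))‖ ≤ (M * C1) * mdecMass (min 1 β) := by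
    rw [← cint_sub hI2 hI1]
    refine norm_cint_le hψ0.le hψπ hβ fun z hz => ?_
    rw [← smul_sub, norm_smul]
    calc _ = ‖f z‖ * (‖z‖ * ‖prodRes a b (z + c) - dpgInt a b tA (z + c)‖) := by ring
      _ ≤ M * (C1 * mdec (min 1 β) ‖z‖) :=
        mul_le_mul (hM z (hsub2 (hsub3 hz))) (hsub z hz) (by positivity) hM0
      _ = _ := by ring
  have h2 : ‖cint ψ (fun z => f z • dpgInt a b tA (z + c))‖ ≤ CK * M := by
    rw [h.rep.cint_smul_dpgInt h.c_pos hκ0 hκ1' hCf (hfc.mono hsub2)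
      (hfd.mono ((oleft_subset_cleft ψ).trans hsub2)) fun w hw => hfb w (hsub2 hw)]
    refine le_of_forall_pos_le_add fun ε hε => ?_
    have hp : 0 < CK + 1 := by positivity
    have := h.kw _ _ _ _ (h.rep.isKW_shift (M := M + ε / (CK + 1)) h.c_pos (hfd.mono hsub1)
      (by positivity) (fun w hw => (hM w (hsub1 hw)).trans (by
        have : 0 ≤ ε / (CK + 1) := by positivity
        linarith)) hκ0 hκ1 hCf fun w hw => hfb w (hsub1 hw))
    refine this.trans ?_
    rw [mul_add, mul_div_assoc']
    gcongr
    rw [div_le_iff₀ hp]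
    nlinarith
  have h3 := norm_le_norm_add_norm_sub (cint ψ (fun z => f z • dpgInt a b tA (z + c)))
    (cint ψ (fun z => f z • prodRes a b (z + c)))
  rw [norm_sub_rev] at h3
  nlinarith

end Operator

section Operator

variable {X : Type u} [NormedAddCommGroup X] [NormedSpace ℂ X]

theorem IsResolventAt.apply_eq {A : X →ₗ.[ℂ] X} {l : ℂ} {R : X →L[ℂ] X} (h : IsResolventAt A l R)
    {x : X} (hx : R x ∈ A.domain) : A ⟨R x, hx⟩ = x - l • R x := by
  obtain ⟨_, h2⟩ := h.1 x
  exact eq_sub_of_add_eq h2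

theorem IsResolventAt.mem {A : X →ₗ.[ℂ] X} {l : ℂ} {R : X →L[ℂ] X} (h : IsResolventAt A l R)
    (x : X) : R x ∈ A.domain := (h.1 x).1

theorem isPRes_of_isResolventAt {A : X →ₗ.[ℂ] X} {R : ℂ → X →L[ℂ] X} {t K : ℝ}
    (h : ∀ l ∈ Sector t, IsResolventAt A l (R l) ∧ (1 + ‖l‖) * ‖R l‖ ≤ K) : IsPRes R t K := by
  refine ⟨fun z hz => (h z hz).2, fun z hz w hw => ?_⟩
  ext x
  obtain ⟨hd, he⟩ := (h w hw).1.1 x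
  have h1 := (h z hz).1.2 ⟨R w x, hd⟩
  have h2 : A ⟨R w x, hd⟩ + z • R w x = x + (z - w) • R w x := by
    rw [eq_sub_of_add_eq he]
    module
  simp only [h2, map_add, map_smul] at h1
  change R z x - R w x = (w - z) • R z (R w x)
  rw [eq_sub_of_add_eq h1]
  module

theorem real_mul_mem_sector {t r : ℝ} {z : ℂ} (ht : 0 ≤ t) (hz : z ∈ Sector t) (hr : 0 ≤ r) :
    (r : ℂ) * z ∈ Sector t := by
  rcases hr.eq_or_lt with rfl | hr
  · simpa using zero_mem_sector ht
  · change |((r : ℂ) * z).arg| ≤ t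
    rwa [Complex.arg_real_mul _ hr]

/-- The hypotheses on a pair of operators, in terms of their resolvents. -/
structure IsCommPair (A : X →ₗ.[ℂ] X) (a b : ℂ → X →L[ℂ] X) (tA tB KA KB C α β : ℝ) : Prop where
  tA_nonneg : 0 ≤ tA
  tB_nonneg : 0 ≤ tB
  α_nonneg : 0 ≤ α
  β_pos : 0 < β
  add_lt : α + β < 1
  C_nonneg : 0 ≤ C
  resolvent : ∀ l ∈ Sector tA, IsResolventAt A l (a l)
  resA : IsPRes a tA KA
  resB : IsPRes b tB KB
  comm_le : ∀ l ∈ Sector tA, ∀ μ ∈ Sector tB, ∀ x : X, ∀ h : b μ (a l x) ∈ A.domain,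
    ‖A ⟨b μ (a l x), h⟩ - b μ (x - l • a l x)‖ ≤
      C / ((1 + ‖l‖ ^ (1 - α)) * (1 + ‖μ‖ ^ (1 + β))) * ‖x‖

namespace IsCommPair

variable {A : X →ₗ.[ℂ] X} {a b : ℂ → X →L[ℂ] X} {tA tB KA KB C α β : ℝ} {μ : ℂ}
  {L : X →L[ℂ] X}

theorem zero_resolvent (h : IsCommPair A a b tA tB KA KB C α β) : IsResolventAt A 0 (a 0) :=
  h.resolvent 0 (zero_mem_sector h.tA_nonneg)

theorem apply_zero (h : IsCommPair A a b tA tB KA KB C α β) {x : X} (hx : a 0 x ∈ A.domain) :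
    A ⟨a 0 x, hx⟩ = x := by
  rw [h.zero_resolvent.apply_eq, zero_smul, sub_zero]

theorem zero_apply (h : IsCommPair A a b tA tB KA KB C α β) {u : X} (hu : u ∈ A.domain) :
    a 0 (A ⟨u, hu⟩) = u := by
  have := h.zero_resolvent.2 ⟨u, hu⟩
  rwa [zero_smul, add_zero] at this

theorem zero_injective (h : IsCommPair A a b tA tB KA KB C α β) : Function.Injective (a 0) := by
  intro x y hxy
  rw [← h.apply_zero (h.zero_resolvent.mem x), ← h.apply_zero (h.zero_resolvent.mem y)]
  simp only [hxy]

theorem mul_left_cancel (h : IsCommPair A a b tA tB KA KB C α β) {S T : X →L[ℂ] X}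
    (hST : a 0 * S = a 0 * T) : S = T := by
  ext x
  exact h.zero_injective (DFunLike.congr_fun hST x)

theorem resA_eq (h : IsCommPair A a b tA tB KA KB C α β) {l : ℂ} (hl : l ∈ Sector tA) :
    a l = a 0 * (1 - l • a l) := by
  have h0 := zero_mem_sector h.tA_nonneg
  have e := h.resA.res 0 h0 l hl
  rw [sub_zero] at e
  rw [mul_sub, mul_one, mul_smul_comm, ← e, sub_sub_cancel]

theorem diff_le (h : IsCommPair A a b tA tB KA KB C α β) (hμ : μ ∈ Sector tB)
    (hL : b μ * a 0 = a 0 * L) {l : ℂ} (hl : l ∈ Sector tA) :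
    ‖(L - b μ) * (1 - l • a l)‖ ≤ C / ((1 + ‖l‖ ^ (1 - α)) * (1 + ‖μ‖ ^ (1 + β))) := by
  have hC := h.C_nonneg
  refine ContinuousLinearMap.opNorm_le_bound _ (by positivity) fun x => ?_
  have e : b μ (a l x) = a 0 (L (x - l • a l x)) := by
    have e1 : b μ * a l = a 0 * (L * (1 - l • a l)) := by
      rw [← mul_assoc, ← hL, mul_assoc, ← h.resA_eq hl]
    exact DFunLike.congr_fun e1 x
  have hm : b μ (a l x) ∈ A.domain := by
    rw [e]
    exact h.zero_resolvent.mem _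
  have hA : A ⟨b μ (a l x), hm⟩ = L (x - l • a l x) := by
    simp only [e]
    exact h.apply_zero _
  have := h.comm_le l hl μ hμ x hm
  rwa [hA] at this

theorem norm_diff_le (h : IsCommPair A a b tA tB KA KB C α β) (hμ : μ ∈ Sector tB)
    (hL : b μ * a 0 = a 0 * L) : ‖L - b μ‖ ≤ C / (1 + ‖μ‖ ^ (1 + β)) := by
  have := h.diff_le hμ hL (zero_mem_sector h.tA_nonneg)
  have hα : 1 - α ≠ 0 := by linarith [h.add_lt, h.β_pos]
  rwa [zero_smul, sub_zero, mul_one, norm_zero, Real.zero_rpow hα, add_zero, one_mul] at this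

theorem one_add_mul_norm_le (h : IsCommPair A a b tA tB KA KB C α β) (hμ : μ ∈ Sector tB)
    (hL : b μ * a 0 = a 0 * L) : (1 + ‖μ‖) * ‖L‖ ≤ KB + 2 * C := by
  have h1 := h.norm_diff_le hμ hL
  have h2 := h.resB.bound μ hμ
  have hC := h.C_nonneg
  have hβ := h.β_pos
  have h3 : ‖L‖ ≤ ‖b μ‖ + C / (1 + ‖μ‖ ^ (1 + β)) := by
    linarith [norm_le_norm_add_norm_sub (b μ) L, norm_sub_rev (b μ) L]
  have h4 : 1 + ‖μ‖ ≤ 2 * (1 + ‖μ‖ ^ (1 + β)) := by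
    have h0 : 0 ≤ ‖μ‖ ^ (1 + β) := by positivity
    rcases le_total ‖μ‖ 1 with h5 | h5
    · linarith
    · have : ‖μ‖ ^ (1 : ℝ) ≤ ‖μ‖ ^ (1 + β) :=
        Real.rpow_le_rpow_of_exponent_le h5 (by linarith)
      rw [Real.rpow_one] at this
      linarith
  calc (1 + ‖μ‖) * ‖L‖ ≤ (1 + ‖μ‖) * (‖b μ‖ + C / (1 + ‖μ‖ ^ (1 + β))) := by gcongr
    _ = (1 + ‖μ‖) * ‖b μ‖ + (1 + ‖μ‖) * (C / (1 + ‖μ‖ ^ (1 + β))) := by ring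
    _ ≤ KB + 2 * (1 + ‖μ‖ ^ (1 + β)) * (C / (1 + ‖μ‖ ^ (1 + β))) := by gcongr
    _ = _ := by
        have : 1 + ‖μ‖ ^ (1 + β) ≠ 0 := by positivity
        field_simp

theorem exists_intertwine (h : IsCommPair A a b tA tB KA KB C α β) (hμ : μ ∈ Sector tB)
    (hinv : ∀ u ∈ A.domain, b μ u ∈ A.domain) : ∃ L : X →L[ℂ] X, b μ * a 0 = a 0 * L := by
  have hm : ∀ x, b μ (a 0 x) ∈ A.domain := fun x => hinv _ (h.zero_resolvent.mem x)
  let f : X →ₗ[ℂ] X := A.toFun.comp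
    ((b μ * a 0 : X →L[ℂ] X).toLinearMap.codRestrict A.domain hm)
  have hf : ∀ x, f x = A ⟨b μ (a 0 x), hm x⟩ := fun x => rfl
  let c := C / ((1 + ‖(0 : ℂ)‖ ^ (1 - α)) * (1 + ‖μ‖ ^ (1 + β)))
  refine ⟨f.mkContinuous (‖b μ‖ + c) fun x => ?_, ?_⟩
  · have h1 := h.comm_le 0 (zero_mem_sector h.tA_nonneg) μ hμ x (hm x)
    rw [zero_smul, sub_zero, ← hf] at h1
    have h2 := (b μ).le_opNorm x
    have h3 := norm_le_norm_add_norm_sub (b μ x) (f x)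
    rw [norm_sub_rev] at h3
    rw [add_mul]
    linarith
  · ext x
    exact (h.zero_apply (hm x)).symm

theorem exists_intertwine_of_near [CompleteSpace X] (h : IsCommPair A a b tA tB KA KB C α β)
    (hμ : μ ∈ Sector tB) (hL : ∃ L : X →L[ℂ] X, b μ * a 0 = a 0 * L) {ν : ℂ}
    (hν : ν ∈ Sector tB) (hd : ‖ν - μ‖ * (KB + 2 * C) < 1) :
    ∃ L : X →L[ℂ] X, b ν * a 0 = a 0 * L := by
  obtain ⟨L, hL⟩ := hL
  have hn : ‖(ν - μ) • L‖ < 1 := by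
    rw [norm_smul]
    refine lt_of_le_of_lt (mul_le_mul_of_nonneg_left ?_ (norm_nonneg _)) hd
    refine le_trans ?_ (h.one_add_mul_norm_le hμ hL)
    nlinarith [norm_nonneg μ, norm_nonneg L]
  have hu := isUnit_one_add hn
  refine ⟨L * Ring.inverse (1 + (ν - μ) • L), ?_⟩
  have e1 : b ν * (1 + (ν - μ) • b μ) = b μ := by
    have e := h.resB.res μ hμ ν hν
    rw [h.resB.comm hμ hν] at e
    rw [mul_add, mul_one, mul_smul_comm, ← e, add_sub_cancel]
  have e2 : b ν * a 0 * (1 + (ν - μ) • L) = a 0 * L := by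
    rw [← hL]
    conv_rhs => rw [← e1]
    rw [mul_assoc, mul_assoc, mul_add, add_mul, mul_one, one_mul, mul_smul_comm,
      smul_mul_assoc, hL]
  rw [← mul_assoc, ← e2, mul_assoc, Ring.mul_inverse_cancel _ hu, mul_one]

theorem exists_intertwine_iff_zero [CompleteSpace X] (h : IsCommPair A a b tA tB KA KB C α β)
    (hμ : μ ∈ Sector tB) : (∃ L : X →L[ℂ] X, b 0 * a 0 = a 0 * L) ↔
      ∃ L : X →L[ℂ] X, b μ * a 0 = a 0 * L := by
  obtain ⟨n, hn⟩ := exists_nat_gt (‖μ‖ * (KB + 2 * C))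
  have hM : 0 ≤ KB + 2 * C := by
    have := h.resB.nonneg h.tB_nonneg
    have := h.C_nonneg
    positivity
  have hnp : (0 : ℝ) < n := lt_of_le_of_lt (by positivity) hn
  set p : ℕ → ℂ := fun k => ((k / n : ℝ) : ℂ) * μ with hp
  have hps : ∀ k, p k ∈ Sector tB :=
    fun k => real_mul_mem_sector h.tB_nonneg hμ (by positivity)
  have hpd : ∀ k, ‖p (k + 1) - p k‖ * (KB + 2 * C) < 1 := fun k => by
    have e : p (k + 1) - p k = ((1 / n : ℝ) : ℂ) * μ := by
      simp only [hp]
      push_cast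
      ring
    rw [e, norm_mul, Complex.norm_real, Real.norm_of_nonneg (by positivity), mul_assoc,
      one_div, inv_mul_lt_iff₀ hnp, mul_one]
    exact hn
  have hk : ∀ k, (∃ L : X →L[ℂ] X, b 0 * a 0 = a 0 * L) ↔
      ∃ L : X →L[ℂ] X, b (p k) * a 0 = a 0 * L := by
    intro k
    induction k with
    | zero => simp [hp]
    | succ k ih =>
      rw [ih]
      refine ⟨fun hL => h.exists_intertwine_of_near (hps k) hL (hps _) (hpd k),
        fun hL => h.exists_intertwine_of_near (hps _) hL (hps k) ?_⟩
      rw [norm_sub_rev]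
      exact hpd k
  have e : p n = μ := by
    simp only [hp]
    rw [div_self hnp.ne', Complex.ofReal_one, one_mul]
  rw [hk n, e]

theorem exists_isDPG [CompleteSpace X] (h : IsCommPair A a b tA tB KA KB C α β) (hA0 : 0 < tA)
    (hAπ : tA < π) (hB0 : 0 < tB) (hBπ : tB < π)
    (hdom : ∃ μ ∈ Sector tB, ∀ u ∈ A.domain, b μ u ∈ A.domain) :
    ∃ L, IsDPG a b L tA tB (KA + KB + 2 * C) α β := by
  obtain ⟨μ0, hμ0, hinv⟩ := hdom
  have h0 := (h.exists_intertwine_iff_zero hμ0).2 (h.exists_intertwine hμ0 hinv)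
  have hex : ∀ μ, ∃ L : X →L[ℂ] X, μ ∈ Sector tB → b μ * a 0 = a 0 * L := fun μ => by
    by_cases hμ : μ ∈ Sector tB
    · obtain ⟨L, hL⟩ := (h.exists_intertwine_iff_zero hμ).1 h0
      exact ⟨L, fun _ => hL⟩
    · exact ⟨0, fun h => absurd h hμ⟩
  choose L hL using hex
  have hKA := h.resA.nonneg h.tA_nonneg
  have hKB := h.resB.nonneg h.tB_nonneg
  have hC := h.C_nonneg
  refine ⟨L, hA0, hAπ, hB0, hBπ, h.α_nonneg, h.β_pos, h.add_lt,
    ⟨fun z hz => (h.resA.bound z hz).trans (by linarith), h.resA.res⟩,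
    ⟨fun z hz => (h.resB.bound z hz).trans (by linarith), h.resB.res⟩,
    ⟨fun z hz => (h.one_add_mul_norm_le hz (hL z hz)).trans (by linarith),
      fun z hz w hw => h.mul_left_cancel ?_⟩, hL, fun w hw μ hμ => ?_⟩
  · rw [mul_sub, ← hL z hz, ← hL w hw, ← sub_mul, h.resB.res z hz w hw, mul_smul_comm,
      ← mul_assoc, ← hL z hz, mul_assoc, ← hL w hw, smul_mul_assoc, mul_assoc]
  · refine (h.diff_le hμ (hL μ hμ) hw).trans ?_
    gcongr
    linarith

end IsCommPair

end Operator

section Commutator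

variable {𝔸 : Type*} [NormedRing 𝔸] [NormedAlgebra ℂ 𝔸] {a b L : ℂ → 𝔸} {tA tB N α β : ℝ}

theorem IsDPG.commutator_eq (h : IsDPG a b L tA tB N α β) {z w : ℂ} (hz : z ∈ Sector tB)
    (hw : w ∈ Sector tA) : b z * a w - a w * b z = a w * ((L z - b z) * (1 - w • a w)) := by
  have h0 := zero_mem_sector h.tA_pos.le
  have e1 : a w = a 0 * (1 - w • a w) := by
    have e := h.resA.res 0 h0 w hw
    rw [sub_zero] at e
    rw [mul_sub, mul_one, mul_smul_comm, ← e, sub_sub_cancel]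
  have e2 : a w = (1 - w • a w) * a 0 := by
    rw [sub_mul, one_mul, smul_mul_assoc, h.resA.comm hw h0, ← mul_smul_comm]
    conv_lhs => rw [e1]
    rw [mul_sub, mul_one]
  have e3 : a w * L z * (1 - w • a w) = (1 - w • a w) * (b z * a w) := by
    conv_lhs => rw [e2]
    rw [mul_assoc (1 - _) (a 0), ← h.intertwine z hz, mul_assoc (1 - _), mul_assoc (b z),
      ← e2, ← e1]
  rw [sub_mul, mul_sub, ← mul_assoc, e3, sub_mul, one_mul, mul_sub (b z), mul_sub (a w),
    mul_one, mul_smul_comm, mul_smul_comm, smul_mul_assoc]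
  abel

theorem div_one_add_le_rpow {s x : ℝ} (hs0 : 0 ≤ s) (hs1 : s ≤ 1) (hx : 0 < x) :
    x / (1 + x) ≤ x ^ s := by
  rw [div_le_iff₀ (by positivity), mul_add, mul_one]
  have h0 : 0 < x ^ s := by positivity
  rcases le_total x 1 with h | h
  · have := Real.rpow_le_rpow_of_exponent_ge hx h hs1
    rw [Real.rpow_one] at this
    nlinarith
  · have := Real.one_le_rpow h hs0
    nlinarith

theorem IsDPG.norm_commutator_le (h : IsDPG a b L tA tB N α β) {z w : ℂ} (hz : z ∈ csec tB)
    (hw : w ∈ csec tA) : ‖w‖ * ‖z‖ * ‖b z * a w - a w * b z‖ ≤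
      N * N * (mdec (min (1 / 4) (min β ((1 - α) / 2))) ‖z‖ *
        mdec (min (1 / 4) (min β ((1 - α) / 2))) ‖w‖) := by
  have hN := h.N_nonneg
  have hα := h.α_nonneg
  have hβ := h.β_pos
  have hαβ := h.add_lt
  have hzp := norm_pos_iff.2 hz.1
  have hwp := norm_pos_iff.2 hw.1
  have hzs := csec_subset_sector le_rfl hz
  have hws := csec_subset_sector le_rfl hw
  set μ := min (1 / 4) (min β ((1 - α) / 2))
  have hμβ : μ ≤ min 1 β :=
    le_min ((min_le_left _ _).trans (by norm_num)) ((min_le_right _ _).trans (min_le_left _ _))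
  have hμα : μ ≤ (1 - α) / 2 := (min_le_right _ _).trans (min_le_right _ _)
  have h1 : ‖z‖ / (1 + ‖z‖ ^ (1 + β)) ≤ mdec μ ‖z‖ := by
    have := rpow_div_one_add_rpow_le (β := 1) (γ := 1 + β) hzp
    rw [Real.rpow_one, add_sub_cancel_left] at this
    exact this.trans (mdec_anti hμβ)
  have h2 : ‖w‖ / (1 + ‖w‖) / (1 + ‖w‖ ^ (1 - α)) ≤ mdec μ ‖w‖ := by
    have := rpow_div_one_add_rpow_le (β := (1 - α) / 2) (γ := 1 - α) hwp
    rw [sub_half, min_self] at this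
    refine le_trans ?_ (this.trans (mdec_anti hμα))
    gcongr
    exact div_one_add_le_rpow (by linarith) (by linarith) hwp
  rw [h.commutator_eq hzs hws]
  calc ‖w‖ * ‖z‖ * ‖a w * ((L z - b z) * (1 - w • a w))‖
      ≤ ‖w‖ * ‖z‖ * (N / (1 + ‖w‖) * (N / ((1 + ‖w‖ ^ (1 - α)) * (1 + ‖z‖ ^ (1 + β))))) := by
        gcongr
        exact (norm_mul_le _ _).trans (mul_le_mul (h.resA.norm_le hws)
          (h.diff_le w hws z hzs) (norm_nonneg _) (by positivity))
    _ = N * N * ((‖z‖ / (1 + ‖z‖ ^ (1 + β))) *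
          (‖w‖ / (1 + ‖w‖) / (1 + ‖w‖ ^ (1 - α)))) := by
        field_simp
    _ ≤ _ := by
        have := (mdec_pos μ ‖z‖).le
        gcongr

end Commutator

section Operator

variable {X : Type u} [NormedAddCommGroup X] [NormedSpace ℂ X]

theorem IsResolventAt.zero_apply {A : X →ₗ.[ℂ] X} {R : X →L[ℂ] X} (h : IsResolventAt A 0 R)
    {u : X} (hu : u ∈ A.domain) : R (A ⟨u, hu⟩) = u := by
  have := h.2 ⟨u, hu⟩
  rwa [zero_smul, add_zero] at this

theorem exists_prodRes_apply {A B : X →ₗ.[ℂ] X} {a b : ℂ → X →L[ℂ] X}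
    (hA : IsResolventAt A 0 (a 0)) (hB : IsResolventAt B 0 (b 0)) {l : ℂ}
    (hu : IsUnit (1 + l • (b 0 * a 0))) (x : X) :
    ∃ h : prodRes a b l x ∈ B.domain, ∃ h2 : B ⟨prodRes a b l x, h⟩ ∈ A.domain,
      A ⟨B ⟨prodRes a b l x, h⟩, h2⟩ + l • prodRes a b l x = x := by
  have e : prodRes a b l x = b 0 (a 0 (Ring.inverse (1 + l • (b 0 * a 0)) x)) := rfl
  have hm : prodRes a b l x ∈ B.domain := by
    rw [e]
    exact hB.mem _
  have e2 : B ⟨prodRes a b l x, hm⟩ = a 0 (Ring.inverse (1 + l • (b 0 * a 0)) x) := by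
    simp only [e]
    rw [hB.apply_eq, zero_smul, sub_zero]
  have hm2 : B ⟨prodRes a b l x, hm⟩ ∈ A.domain := by
    rw [e2]
    exact hA.mem _
  refine ⟨hm, hm2, ?_⟩
  have e3 : A ⟨B ⟨prodRes a b l x, hm⟩, hm2⟩ = Ring.inverse (1 + l • (b 0 * a 0)) x := by
    simp only [e2]
    rw [hA.apply_eq, zero_smul, sub_zero]
  rw [e3]
  exact DFunLike.congr_fun (Ring.mul_inverse_cancel _ hu) x

theorem prodRes_apply {A B : X →ₗ.[ℂ] X} {a b : ℂ → X →L[ℂ] X}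
    (hA : IsResolventAt A 0 (a 0)) (hB : IsResolventAt B 0 (b 0)) {l : ℂ}
    (hu : IsUnit (1 + l • (b 0 * a 0))) {u : X} (h : u ∈ B.domain) (h2 : B ⟨u, h⟩ ∈ A.domain) :
    prodRes a b l (A ⟨B ⟨u, h⟩, h2⟩ + l • u) = u := by
  have e : b 0 (a 0 (A ⟨B ⟨u, h⟩, h2⟩)) = u := by
    rw [hA.zero_apply, hB.zero_apply]
  have e2 := DFunLike.congr_fun (prodRes_mul_cancel hu) (A ⟨B ⟨u, h⟩, h2⟩)
  change prodRes a b l (A ⟨B ⟨u, h⟩, h2⟩ + l • b 0 (a 0 (A ⟨B ⟨u, h⟩, h2⟩))) =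
    b 0 (a 0 (A ⟨B ⟨u, h⟩, h2⟩)) at e2
  rwa [e] at e2

end Operator

/-- Haller-Dintelmann–Hieber.  Let `A ∈ H^∞(θ_A)` and
`B ∈ RH^∞(θ_B)` with `θ_A + θ_B > π`, suppose `(B+μ)⁻¹D(A) ⊆ D(A)` for some
`μ ∈ S_{θ_B}`, and assume the Da Prato–Grisvard commutator estimate
`‖[A,(B+μ)⁻¹](A+λ)⁻¹‖ ≤ C/((1+|λ|^{1-α})(1+|μ|^{1+β}))` on `S_{θ_A} × S_{θ_B}`
with `α,C ≥ 0`, `β > 0`, `α+β < 1`.  Then for each `θ ∈ [0,θ_A+θ_B-π)` there is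
`c > 0` such that `AB + c`, with domain `{u ∈ D(B) : Bu ∈ D(A)}`, has bounded
`H^∞`-calculus of angle `θ`. -/
theorem statement19
    {X : Type u} [NormedAddCommGroup X] [NormedSpace ℂ X] [CompleteSpace X]
    (θA θB θA' θB' KA KB : ℝ)
    (hθA0 : 0 ≤ θA) (hθB0 : 0 ≤ θB) (hsum : Real.pi < θA + θB)
    (hθA : θA < θA') (hθA' : θA' < Real.pi) (hθB : θB < θB') (hθB' : θB' < Real.pi)
    (hKA : 1 ≤ KA) (hKB : 1 ≤ KB)
    (A B : X →ₗ.[ℂ] X)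
    (hAclosed : IsClosed (A.graph : Set (X × X)))
    (hBclosed : IsClosed (B.graph : Set (X × X)))
    (RA RB : ℂ → X →L[ℂ] X)
    -- A is invertible sectorial of angle θA' > θA:
    (hRA : ∀ lam ∈ Sector θA',
      IsResolventAt A lam (RA lam) ∧ (1 + ‖lam‖) * ‖RA lam‖ ≤ KA)
    -- B is invertible sectorial of angle θB' > θB:
    (hRB : ∀ lam ∈ Sector θB',
      IsResolventAt B lam (RB lam) ∧ (1 + ‖lam‖) * ‖RB lam‖ ≤ KB)
    -- A ∈ H^∞(θA):
    (hHA : HasBddHCalc RA θA' θA)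
    -- B ∈ RH^∞(θB): the H^∞-calculus of B is R-bounded:
    (hHB : ∃ C : ℝ, RBound C
      {T | ∃ f : ℂ → ℂ, MemH0 θB f ∧ (∀ z ∉ Sector θB, ‖f z‖ ≤ 1) ∧
        T = fCalc RB θB' f})
    -- (B+μ)⁻¹ D(A) ⊆ D(A) for some μ ∈ S_{θB}:
    (hdom : ∃ μ ∈ Sector θB, ∀ u ∈ A.domain, RB μ u ∈ A.domain)
    -- the commutator estimate (with [A,(B+μ)⁻¹](A+λ)⁻¹ evaluated using
    -- A(A+λ)⁻¹ = I - λ(A+λ)⁻¹):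
    (hcomm : ∃ α β C : ℝ, 0 ≤ α ∧ 0 < β ∧ 0 ≤ C ∧ α + β < 1 ∧
      ∀ lam ∈ Sector θA, ∀ μ ∈ Sector θB, ∀ x : X,
        ∀ h : RB μ (RA lam x) ∈ A.domain,
          ‖A ⟨RB μ (RA lam x), h⟩ - RB μ (x - lam • RA lam x)‖ ≤
            C / ((1 + ‖lam‖ ^ (1 - α)) * (1 + ‖μ‖ ^ (1 + β))) * ‖x‖) :
    ∀ θ : ℝ, 0 ≤ θ → θ < θA + θB - Real.pi →
      ∃ c : ℝ, 0 < c ∧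
      ∃ θ' : ℝ, θ < θ' ∧ θ' ≤ Real.pi ∧
      ∃ RAB : ℂ → X →L[ℂ] X,
        -- AB + c, with domain {u ∈ D(B) : Bu ∈ D(A)}, is invertible sectorial of
        -- angle θ' > θ ...
        (∀ lam ∈ Sector θ',
          (∀ x : X, ∃ h : RAB lam x ∈ B.domain,
            ∃ h2 : B ⟨RAB lam x, h⟩ ∈ A.domain,
              A ⟨B ⟨RAB lam x, h⟩, h2⟩ + (c : ℂ) • RAB lam x + lam • RAB lam x = x) ∧
          (∀ (u : X) (h : u ∈ B.domain) (h2 : B ⟨u, h⟩ ∈ A.domain),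
            RAB lam (A ⟨B ⟨u, h⟩, h2⟩ + (c : ℂ) • u + lam • u) = u)) ∧
        (∃ K : ℝ, ∀ lam ∈ Sector θ', (1 + ‖lam‖) * ‖RAB lam‖ ≤ K) ∧
        -- ... and has bounded H^∞-calculus of angle θ:
        HasBddHCalc RAB θ' θ := by
  obtain ⟨α, β, C, hα, hβ, hC, hαβ, hcm⟩ := hcomm
  obtain ⟨C0, hR⟩ := hHB
  intro θ hθ0 hθ
  have hπ := Real.pi_pos
  have hA0 := zero_mem_sector (hθA0.trans hθA.le)
  have hB0 := zero_mem_sector (hθB0.trans hθB.le)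
  have hsA : Sector θA ⊆ Sector θA' := fun z hz => le_trans hz hθA.le
  have ha : IsPRes RA θA' KA := isPRes_of_isResolventAt hRA
  have hb : IsPRes RB θB' KB := isPRes_of_isResolventAt hRB
  have hpair : IsCommPair A RA RB θA θB KA KB C α β :=
    ⟨hθA0, hθB0, hα, hβ, hαβ, hC, fun l hl => (hRA l (hsA hl)).1, ha.mono hθA.le,
      hb.mono hθB.le, hcm⟩
  obtain ⟨L, hL⟩ := hpair.exists_isDPG (by linarith) (by linarith) (by linarith) (by linarith)
    hdom
  obtain ⟨δ, hδ⟩ : ∃ δ, 8 * δ = θA + θB - π - θ := ⟨(θA + θB - π - θ) / 8, by ring⟩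
  have hrep : IsRep RA RB θA θB (θB - δ) (π - θ - 4 * δ) (θ + δ) δ (KA + KB + 2 * C) :=
    ⟨by linarith, by linarith, by linarith, by linarith, by linarith, by linarith, by linarith,
      by linarith, by linarith, hL.resA, hL.resB⟩
  have hN := hL.N_nonneg
  obtain ⟨CK, hCK, hkw⟩ := exists_norm_kwInt_le ha hHA hθA hθA' hb hθB hθB' hR
    (ω := θA - 2 * δ) (δ := δ) (τ := θB - δ) (χ := π - θ - 4 * δ)
    (μ := min (1 / 4) (min β ((1 - α) / 2))) (by linarith) (by linarith) (by ring)
    (by linarith) (by linarith) (by linarith)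
    (lt_min (by norm_num) (lt_min hβ (by linarith))) (min_le_left _ _) (mul_nonneg hN hN)
    fun z hz w hw => hL.norm_commutator_le ⟨hz.1, hz.2.trans (by linarith)⟩ hw
  obtain ⟨c, k, h⟩ := hL.exists_isProdRes hrep hCK hkw
  refine ⟨c, h.c_pos, θ + δ, by linarith, by linarith, fun z => prodRes RA RB (z + c),
    fun l hl => ⟨fun x => ?_, fun u hu hu2 => ?_⟩, ⟨_, h.isPRes.bound⟩,
    h.hasBddHCalc hθ0 (by linarith)⟩
  · obtain ⟨h1, h2, h3⟩ := exists_prodRes_apply (hRA 0 hA0).1 (hRB 0 hB0).1 (h.unit l hl) x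
    refine ⟨h1, h2, ?_⟩
    rw [add_smul, add_comm (l • _), ← add_assoc] at h3
    exact h3
  · have h3 := prodRes_apply (hRA 0 hA0).1 (hRB 0 hB0).1 (h.unit l hl) hu hu2
    rwa [add_smul, add_comm (l • u), ← add_assoc] at h3
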